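/- Let (R,m) be a Noetherian local domain whose m-adic completion is an integral domain (i.e. R is analytically irreducible), and let α₁,…,α_k ∈ ℤ^N_{≥0} be nonzero multi-indices. Then there exists c ∈ ℕ such that for every n ∈ ℕ and every a ∈ R^N with a^{αᵢ} ∈ m^{cn} for all i = 1,…,k, there exists b ∈ R^N with b^{αᵢ} = 0 for all i and a ≡ b (mod m^n R^N); that is, β_n(X^{α₁},…,X^{α_k}) ≤ cn for all n. -/

import Mathlib

open IsLocalRing

section

open Polynomial

namespace Izumi

section Gauss
variable {Ω : Type*} [Field Ω] {Γ : Type*} [LinearOrderedCommGroupWithZero Γ] (v : Valuation Ω Γ)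

/-- sup of values of the coefficients -/
noncomputable def gn (f : (Polynomial Ω)) : Γ := f.support.sup (fun i => v (f.coeff i))

lemma le_gn (f : (Polynomial Ω)) (i : ℕ) : v (f.coeff i) ≤ gn v f := by
  by_cases h : i ∈ f.support
  · exact Finset.le_sup (f := fun i => v (f.coeff i)) h
  · rw [notMem_support_iff.1 h, map_zero]; exact zero_le

lemma gn_le {f : (Polynomial Ω)} {g : Γ} (h : ∀ i, v (f.coeff i) ≤ g) : gn v f ≤ g :=
  Finset.sup_le fun i _ => h i

lemma gn_le_iff {f : (Polynomial Ω)} {g : Γ} : gn v f ≤ g ↔ ∀ i, v (f.coeff i) ≤ g :=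
  ⟨fun h i => (le_gn v f i).trans h, gn_le v⟩

lemma exists_gn {f : (Polynomial Ω)} (hf : f ≠ 0) : ∃ i, v (f.coeff i) = gn v f ∧ ∀ j < i, v (f.coeff j) < gn v f := by
  classical
  have hne : f.support.Nonempty := by simpa using hf
  obtain ⟨i, hi, h⟩ := Finset.exists_mem_eq_sup f.support hne (fun i => v (f.coeff i))
  have hex : ∃ i, v (f.coeff i) = gn v f := ⟨i, h.symm⟩
  refine ⟨Nat.find hex, Nat.find_spec hex, fun j hj => ?_⟩
  exact lt_of_le_of_ne (le_gn v f j) (Nat.find_min hex hj)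

lemma gn_ne_zero {f : (Polynomial Ω)} (hf : f ≠ 0) : gn v f ≠ 0 := by
  have hne : f.leadingCoeff ≠ 0 := by simpa using hf
  have := le_gn v f f.natDegree
  have h2 : v (f.coeff f.natDegree) ≠ 0 := by simpa using hne
  intro h
  rw [h] at this
  exact h2 (le_antisymm this zero_le)

lemma gn_zero : gn v 0 = 0 := le_antisymm (gn_le v (by simp)) zero_le

lemma gn_mul (f g : (Polynomial Ω)) : gn v (f * g) = gn v f * gn v g := by
  classical
  by_cases hf : f = 0
  · subst hf; rw [zero_mul, gn_zero, zero_mul]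
  by_cases hg : g = 0
  · subst hg; rw [mul_zero, gn_zero, mul_zero]
  apply le_antisymm
  · refine gn_le v fun n => ?_
    rw [coeff_mul]
    refine v.map_sum_le fun p _ => ?_
    rw [map_mul]
    exact mul_le_mul' (le_gn v f _) (le_gn v g _)
  · obtain ⟨i, hi, hi'⟩ := exists_gn v hf
    obtain ⟨j, hj, hj'⟩ := exists_gn v hg
    have hF := gn_ne_zero v hf
    have hG := gn_ne_zero v hg
    have key : v ((f * g).coeff (i + j)) = v (f.coeff i * g.coeff j) := by
      rw [coeff_mul]
      refine v.map_sum_eq_of_lt (s := Finset.HasAntidiagonal.antidiagonal (i + j))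
        (f := fun p : ℕ × ℕ => f.coeff p.1 * g.coeff p.2) (j := (i, j)) (by simp) ?_
      rintro ⟨a, b⟩ hp
      simp only [Finset.mem_sdiff, Finset.HasAntidiagonal.mem_antidiagonal, Finset.mem_singleton, Prod.mk.injEq,
        not_and] at hp
      simp only [map_mul, hi, hj]
      rcases lt_trichotomy a i with h | h | h
      · exact lt_of_le_of_lt (mul_le_mul_right (le_gn v g b) _)
          (mul_lt_mul_of_pos_right (hi' a h) (zero_lt_iff.2 hG))
      · exact absurd (by omega : b = j) (hp.2 h)
      · have : b < j := by omega
        exact lt_of_le_of_lt (mul_le_mul_left (le_gn v f a) _)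
          (mul_lt_mul_of_pos_left (hj' b this) (zero_lt_iff.2 hF))
    rw [map_mul, hi, hj] at key
    rw [← key]
    exact le_gn v _ _

/-- Gauss valuation. -/
noncomputable def gaussVal : Valuation (Polynomial Ω) Γ where
  toFun := gn v
  map_zero' := gn_zero v
  map_one' := by
    apply le_antisymm
    · refine gn_le v fun i => ?_
      rw [coeff_one]; split_ifs <;> simp
    · have := le_gn v (1 : (Polynomial Ω)) 0
      simpa using this
  map_mul' := gn_mul v
  map_add_le_max' f g := by
    refine gn_le v fun i => ?_
    rw [coeff_add]
    exact (v.map_add _ _).trans (max_le_max (le_gn v f i) (le_gn v g i))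

lemma gaussVal_apply (f : (Polynomial Ω)) : gaussVal v f = gn v f := rfl

/-- The norm on the disc with center `a` and radius `|ρ|`. -/
noncomputable def nrm (a ρ : Ω) : Valuation (Polynomial Ω) Γ :=
  (gaussVal v).comap (compRingHom (C ρ * X + C a))

lemma nrm_apply (a ρ : Ω) (f : (Polynomial Ω)) : nrm v a ρ f = gn v (f.comp (C ρ * X + C a)) := rfl

lemma eval_le_nrm (a ρ : Ω) (f : (Polynomial Ω)) : v (f.eval a) ≤ nrm v a ρ f := by
  have := le_gn v (f.comp (C ρ * X + C a)) 0
  rw [coeff_zero_eq_eval_zero, eval_comp] at this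
  rw [nrm_apply]
  simpa using this

lemma nrm_C (a ρ x : Ω) : nrm v a ρ (C x) = v x := by
  rw [nrm_apply, C_comp]
  apply le_antisymm
  · refine gn_le v fun i => ?_
    rw [coeff_C]; split_ifs <;> simp
  · simpa using le_gn v (C x) 0

lemma nrm_X_sub_C (a ρ ζ : Ω) : nrm v a ρ (X - C ζ) = max (v ρ) (v (a - ζ)) := by
  rw [nrm_apply]
  have : (X - C ζ).comp (C ρ * X + C a) = C ρ * X + C (a - ζ) := by
    simp; ring
  rw [this]
  apply le_antisymm
  · refine gn_le v fun i => ?_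
    rcases i with _ | _ | i
    · simp
    · simp [coeff_C]
    · simp [coeff_C, coeff_X]
  · refine max_le ?_ ?_
    · have := le_gn v (C ρ * X + C (a - ζ)) 1
      rwa [show coeff (C ρ * X + C (a - ζ)) 1 = ρ by simp [coeff_C]] at this
    · have := le_gn v (C ρ * X + C (a - ζ)) 0
      rwa [show coeff (C ρ * X + C (a - ζ)) 0 = a - ζ by simp] at this

lemma nrm_X (a ρ : Ω) : nrm v a ρ X = max (v ρ) (v a) := by
  simpa using nrm_X_sub_C v a ρ 0

lemma nrm_zero_le_iff (ρ : Ω) (f : (Polynomial Ω)) (g : Γ) :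
    nrm v 0 ρ f ≤ g ↔ ∀ i, v (f.coeff i) * v ρ ^ i ≤ g := by
  rw [nrm_apply, gn_le_iff]
  simp [comp_C_mul_X_coeff]

lemma nrm_ne_zero (a ρ : Ω) (hρ : ρ ≠ 0) {f : (Polynomial Ω)} (hf : f ≠ 0) : nrm v a ρ f ≠ 0 := by
  rw [nrm_apply]
  apply gn_ne_zero
  intro h
  rw [comp_eq_zero_iff] at h
  rcases h with h | ⟨_, h⟩
  · exact hf h
  · have := congrArg (fun p => coeff p 1) h
    simp [coeff_C] at this
    exact hρ this

/-- maximum principle -/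
lemma nrm_le_nrm_zero {a ρ s : Ω} (hs : s ≠ 0) (ha : v a ≤ v s) (hρ : v ρ ≤ v s) (f : (Polynomial Ω)) :
    nrm v a ρ f ≤ nrm v 0 s f := by
  have h1 : ∀ i, v (f.coeff i) * v s ^ i ≤ nrm v 0 s f := (nrm_zero_le_iff v s f _).1 le_rfl
  conv_lhs => rw [f.as_sum_support_C_mul_X_pow]
  refine (nrm v a ρ).map_sum_le fun i _ => ?_
  rw [map_mul, map_pow, nrm_C, nrm_X]
  refine le_trans ?_ (h1 i)
  gcongr
  exact max_le hρ ha

lemma val_ideal_pow {A : Type*} [CommRing A] (w : Valuation A Γ) (hw : ∀ a, w a ≤ 1) (I : Ideal A) (γ : Γ)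
    (hI : ∀ x ∈ I, w x ≤ γ) (n : ℕ) : ∀ x ∈ I ^ n, w x ≤ γ ^ n := by
  induction n with
  | zero => intro x _; simpa using hw x
  | succ n ih =>
    intro x hx
    rw [pow_succ] at hx
    refine Submodule.mul_induction_on hx ?_ ?_
    · intro a ha b hb
      rw [map_mul, pow_succ]
      exact mul_le_mul' (ih a ha) (hI b hb)
    · intro a b ha hb
      exact w.map_add_le ha hb

end Gauss
end Izumi

end

section

open Polynomial

namespace Izumi

section Gauss
variable {Ω : Type*} [Field Ω] {Γ : Type*} [LinearOrderedCommGroupWithZero Γ] (v : Valuation Ω Γ)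

/-- value of the truncated product -/
noncomputable def prd (τ : Ω) (Z : Multiset Ω) (a : Ω) : Γ :=
  (Z.map (fun ζ => max (v τ) (v (a - ζ)))).prod

lemma prd_cons (τ : Ω) (Z : Multiset Ω) (a ζ : Ω) :
    prd v τ (ζ ::ₘ Z) a = max (v τ) (v (a - ζ)) * prd v τ Z a := by
  simp [prd]

lemma prd_le_prd (τ τ' : Ω) (Z : Multiset Ω) (a b : Ω)
    (h : ∀ ζ ∈ Z, max (v τ) (v (a - ζ)) ≤ max (v τ') (v (b - ζ))) :
    prd v τ Z a ≤ prd v τ' Z b := by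
  induction Z using Multiset.induction_on with
  | empty => simp [prd]
  | cons x Z ih =>
    rw [prd_cons, prd_cons]
    exact mul_le_mul' (h x (by simp)) (ih fun ζ hζ => h ζ (by simp [hζ]))

lemma nrm_prod (a ρ : Ω) (Z : Multiset Ω) :
    nrm v a ρ (Z.map (fun ζ => X - C ζ)).prod = prd v ρ Z a := by
  induction Z using Multiset.induction_on with
  | empty => simp [prd]
  | cons x Z ih =>
    rw [Multiset.map_cons, Multiset.prod_cons, map_mul, ih, prd_cons, nrm_X_sub_C]

lemma exists_min_ms (Z : Multiset Ω) (hZ : Z ≠ 0) (φ : Ω → Γ) : ∃ ζ ∈ Z, ∀ z ∈ Z, φ ζ ≤ φ z := by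
  classical
  obtain ⟨ζ, h1, h2⟩ := Finset.exists_min_image Z.toFinset φ (by simpa using hZ)
  exact ⟨ζ, by simpa using h1, fun z hz => h2 z (by simpa using hz)⟩

lemma prd_le_near (τ : Ω) (Z : Multiset Ω) (a ζ : Ω) (h : ∀ z ∈ Z, v (a - ζ) ≤ v (a - z)) :
    prd v τ Z ζ ≤ prd v τ Z a := by
  refine prd_le_prd v τ τ Z ζ a fun z hz => max_le_max le_rfl ?_
  have : ζ - z = (a - z) - (a - ζ) := by ring
  rw [this]
  exact v.map_sub_le le_rfl (h z hz)

lemma interp (τ s t : Ω) (δ : Γ) (hτ : τ ≠ 0) (hs : s ≠ 0) (hτs : v τ ≤ v s) (hτt : v τ ≤ v t)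
    (hδ : v τ ≤ δ * v t) (g : Γ) : ∀ (n : ℕ) (Z : Multiset Ω) (_ : Z.card = n)
    (hZ : ∀ ζ ∈ Z, v ζ ≤ v s) (e : Polynomial Ω)
    (h1 : ∀ a, v a ≤ v s → nrm v a τ e ≤ g * prd v τ Z a)
    (h2 : nrm v 0 s e ≤ g * v s ^ n),
    ∃ rem h : Polynomial Ω, e = rem + h * (Z.map (fun ζ => X - C ζ)).prod ∧ nrm v 0 s h ≤ g ∧
      nrm v 0 t rem ≤ g * prd v t Z 0 * δ := by
  intro n
  induction n with
  | zero =>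
    intro Z hn hZ e h1 h2
    rw [Multiset.card_eq_zero] at hn
    subst hn
    exact ⟨0, e, by simp, by simpa using h2, by simp⟩
  | succ n ih =>
    intro Z hn hZ e h1 h2
    have hZ0 : Z ≠ 0 := by rintro rfl; simp at hn
    obtain ⟨ζ, hζ, hmin⟩ := exists_min_ms Z hZ0 (fun a => prd v τ Z a)
    have hmin' : ∀ a, prd v τ Z ζ ≤ prd v τ Z a := by
      intro a
      obtain ⟨ζ1, hζ1, h⟩ := exists_min_ms Z hZ0 (fun z => v (a - z))
      exact (hmin ζ1 hζ1).trans (prd_le_near v τ Z a ζ1 h)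
    obtain ⟨Z', rfl⟩ := Multiset.exists_cons_of_mem hζ
    obtain ⟨e₁, he₁⟩ : (X - C ζ) ∣ e - C (e.eval ζ) := by
      rw [dvd_iff_isRoot]; simp
    have hz : v (e.eval ζ) ≤ g * prd v τ (ζ ::ₘ Z') ζ :=
      (eval_le_nrm v ζ τ e).trans (h1 ζ (hZ ζ hζ))
    have hz2 : v (e.eval ζ) ≤ g * v s ^ (n + 1) :=
      ((eval_le_nrm v ζ τ e).trans (nrm_le_nrm_zero v hs (hZ ζ hζ) hτs e)).trans h2
    have hvτ : 0 < v τ := by simpa using (zero_lt_iff.2 ((v.ne_zero_iff).2 hτ))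
    have hvs : 0 < v s := by simpa using (zero_lt_iff.2 ((v.ne_zero_iff).2 hs))
    obtain ⟨rem, h, e1, e2, e3⟩ := ih Z' (by simpa using hn) (fun z hz => hZ z (by simp [hz])) e₁
      (by
        intro a ha
        have : nrm v a τ (e - C (e.eval ζ)) ≤ g * prd v τ (ζ ::ₘ Z') a := by
          refine (nrm v a τ).map_sub_le (h1 a ha) ?_
          rw [nrm_C]
          exact hz.trans (mul_le_mul_right (hmin' a) _)
        rw [he₁, map_mul, nrm_X_sub_C, prd_cons, mul_left_comm] at this
        exact le_of_mul_le_mul_left this (lt_of_lt_of_le hvτ (le_max_left _ _)))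
      (by
        have : nrm v 0 s (e - C (e.eval ζ)) ≤ g * v s ^ (n + 1) := by
          refine (nrm v 0 s).map_sub_le h2 ?_
          rw [nrm_C]
          exact hz2
        rw [he₁, map_mul, nrm_X_sub_C, zero_sub, Valuation.map_neg,
          max_eq_left (hZ ζ hζ), pow_succ, mul_comm, ← mul_assoc] at this
        exact le_of_mul_le_mul_right this hvs)
    refine ⟨C (e.eval ζ) + (X - C ζ) * rem, h, ?_, e2, ?_⟩
    · have : e = C (e.eval ζ) + (X - C ζ) * e₁ := by rw [← he₁]; ring
      conv_lhs => rw [this, e1]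
      rw [Multiset.map_cons, Multiset.prod_cons]; ring
    · refine (nrm v 0 t).map_add_le ?_ ?_
      · rw [nrm_C]
        refine hz.trans ?_
        rw [mul_assoc]
        refine mul_le_mul_right ?_ _
        obtain ⟨ζ0, hζ0, hz0⟩ := exists_min_ms (ζ ::ₘ Z') hZ0 (fun z => v z)
        refine (hmin' ζ0).trans ?_
        obtain ⟨W, hW⟩ := Multiset.exists_cons_of_mem hζ0
        rw [hW] at hz0 ⊢
        rw [prd_cons, prd_cons, sub_self, map_zero, zero_sub, Valuation.map_neg,
          max_eq_left zero_le]
        have hW' : prd v τ W ζ0 ≤ prd v t W 0 := by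
          refine prd_le_prd v τ t W ζ0 0 fun z hz => max_le_max hτt ?_
          rw [zero_sub, Valuation.map_neg]
          exact v.map_sub_le (hz0 z (by simp [hz])) le_rfl
        calc v τ * prd v τ W ζ0 ≤ (δ * v t) * prd v t W 0 := mul_le_mul' hδ hW'
          _ ≤ (δ * max (v t) (v ζ0)) * prd v t W 0 := by
            gcongr; exact le_max_left _ _
          _ = _ := by ac_rfl
      · rw [map_mul, nrm_X_sub_C, zero_sub, Valuation.map_neg, prd_cons, zero_sub, Valuation.map_neg]
        calc _ ≤ max (v t) (v ζ) * (g * prd v t Z' 0 * δ) := mul_le_mul_right e3 _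
          _ = _ := by ac_rfl

lemma approx_quot (s : Ω) (hs : s ≠ 0) (co : Polynomial Ω) (g : Γ) (hg : g ≠ 0) (h0 : v (co.eval 0) = g)
    (h1 : nrm v 0 s co ≤ g) : ∀ (K : ℕ) (γ : Γ) (h : Polynomial Ω) (hh : nrm v 0 s h ≤ g * γ),
    ∃ q u : Polynomial Ω, nrm v 0 s q ≤ γ ∧ (∀ i, K ≤ i → q.coeff i = 0) ∧ h - co * q = X ^ K * u := by
  have hvs : 0 < v s := by simpa using (zero_lt_iff.2 ((v.ne_zero_iff).2 hs))
  intro K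
  induction K with
  | zero => intro γ h hh; exact ⟨0, h, by simp, by simp, by simp⟩
  | succ K ih =>
    intro γ h hh
    have hco : co.eval 0 ≠ 0 := by
      intro h; rw [h, map_zero] at h0; exact hg h0.symm
    set q0 := h.eval 0 / co.eval 0 with hq0
    have hvq0 : v q0 ≤ γ := by
      rw [hq0, map_div₀, h0]
      have := (eval_le_nrm v 0 s h).trans hh
      rw [div_le_iff₀ (zero_lt_iff.2 hg), mul_comm]
      exact this
    obtain ⟨h', hh'⟩ : X ∣ h - co * C q0 := by
      rw [X_dvd_iff, coeff_zero_eq_eval_zero]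
      simp [hq0]
      field_simp
      simp
    have hn : nrm v 0 s (h - co * C q0) ≤ g * γ := by
      refine (nrm v 0 s).map_sub_le hh ?_
      rw [map_mul, nrm_C]
      exact mul_le_mul' h1 hvq0
    rw [hh', map_mul, nrm_X, map_zero, max_eq_left zero_le] at hn
    obtain ⟨q, u, a1, a2, a3⟩ := ih (γ / v s) h' (by
      rw [← mul_div_assoc, le_div_iff₀ hvs, mul_comm]; exact hn)
    refine ⟨C q0 + X * q, u, ?_, ?_, ?_⟩
    · refine (nrm v 0 s).map_add_le (by rwa [nrm_C]) ?_
      rw [map_mul, nrm_X, map_zero, max_eq_left zero_le]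
      rw [le_div_iff₀ hvs, mul_comm] at a1
      exact a1
    · intro i hi
      obtain ⟨j, rfl⟩ : ∃ j, i = j + 1 := ⟨i - 1, by omega⟩
      rw [coeff_add, coeff_X_mul, a2 j (by omega), coeff_C]; simp
    · have : h - co * (C q0 + X * q) = X * (h' - co * q) := by
        rw [mul_sub, ← hh']; ring
      rw [this, a3]; ring

end Gauss
end Izumi

end

section

open Polynomial

namespace Izumi

section Gauss
variable {Ω : Type*} [Field Ω] {Γ : Type*} [LinearOrderedCommGroupWithZero Γ] (v : Valuation Ω Γ)

lemma prd_const (τ : Ω) (Z : Multiset Ω) (a : Ω) (γ : Γ) (h : ∀ ζ ∈ Z, max (v τ) (v (a - ζ)) ≤ γ) :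
    prd v τ Z a ≤ γ ^ Z.card := by
  induction Z using Multiset.induction_on with
  | empty => simp [prd]
  | cons x Z ih =>
    rw [prd_cons, Multiset.card_cons, pow_succ, mul_comm]
    exact mul_le_mul' (ih fun ζ hζ => h ζ (by simp [hζ])) (h x (by simp)) 

lemma const_prd (τ : Ω) (Z : Multiset Ω) (a : Ω) (γ : Γ) (h : ∀ ζ ∈ Z, γ ≤ max (v τ) (v (a - ζ))) :
    γ ^ Z.card ≤ prd v τ Z a := by
  induction Z using Multiset.induction_on with
  | empty => simp [prd]
  | cons x Z ih =>
    rw [prd_cons, Multiset.card_cons, pow_succ, mul_comm]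
    exact mul_le_mul' (h x (by simp)) (ih fun ζ hζ => h ζ (by simp [hζ])) 

lemma prd_out (s τ : Ω) (Z : Multiset Ω) (hZ : ∀ ζ ∈ Z, v s < v ζ) (a : Ω) (ha : v a ≤ v s)
    (hτ : v τ ≤ v s) : prd v τ Z a = prd v 0 Z 0 := by
  have : ∀ ζ ∈ Z, max (v τ) (v (a - ζ)) = max (v 0) (v (0 - ζ)) := by
    intro ζ hζ
    have h := hZ ζ hζ
    rw [v.map_sub_eq_of_lt_right (ha.trans_lt h), max_eq_right (hτ.trans h.le)]
    simp
  exact le_antisymm (prd_le_prd v _ _ _ _ _ fun ζ hζ => (this ζ hζ).le)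
    (prd_le_prd v _ _ _ _ _ fun ζ hζ => (this ζ hζ).ge)

lemma twoD [IsAlgClosed Ω] (t s : Ω) (K : ℕ) (hst : s ^ (K + 1) = t) (ht0 : t ≠ 0) (ht1 : v t < 1)
    (c e : Polynomial Ω) (hc : c ≠ 0) (r : ℕ) (hcr : nrm v 0 t c = v t ^ r) (hc1 : nrm v 0 1 c ≤ 1)
    (D n : ℕ) (hn : (D + 1) * ((K + 1) * (r * (1 + (K + 1) * (K + 1)))) ≤ n)
    (hyp : ∀ a ρ, v a ≤ v s → v ρ ≤ v s → nrm v a ρ c < nrm v a ρ e →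
      nrm v a ρ e ^ (D + 1) ≤ v s ^ n) :
    ∃ q : Polynomial Ω, (∀ i, v (q.coeff i) ≤ 1) ∧
      nrm v 0 t (C (s ^ K) * e - c * q) ≤ v t ^ (r + K) := by
  classical
  have hs0 : s ≠ 0 := by rintro rfl; simp at hst; exact ht0 hst.symm
  have hvs : 0 < v s := zero_lt_iff.2 ((v.ne_zero_iff).2 hs0)
  have hvt : 0 < v t := zero_lt_iff.2 ((v.ne_zero_iff).2 ht0)
  have hvst : v s ^ (K + 1) = v t := by rw [← map_pow, hst]
  have hs1 : v s < 1 := by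
    by_contra h
    push Not at h
    have := one_le_pow₀ h (n := K + 1)
    rw [hvst] at this
    exact absurd ht1 (not_lt.2 this)
  have hts : v t ≤ v s := by
    rw [← hvst]; exact pow_le_of_le_one zero_le hs1.le (by omega)
  set τ := t ^ (K + 1) with hτdef
  have hτ0 : τ ≠ 0 := pow_ne_zero _ ht0
  have hvτ : v τ = v t ^ (K + 1) := by rw [hτdef, map_pow]
  have hτt : v τ ≤ v t := by rw [hvτ]; exact pow_le_of_le_one zero_le ht1.le (by omega)
  have hτs : v τ ≤ v s := hτt.trans hts
  set Z := c.roots.filter (fun ζ => v ζ ≤ v s) with hZdef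
  set Z' := c.roots.filter (fun ζ => ¬ v ζ ≤ v s) with hZ'def
  have hZ : ∀ ζ ∈ Z, v ζ ≤ v s := fun ζ hζ => (Multiset.mem_filter.1 hζ).2
  have hZ' : ∀ ζ ∈ Z', v s < v ζ := fun ζ hζ => not_le.1 (Multiset.mem_filter.1 hζ).2
  set cin := (Z.map (fun ζ => X - C ζ)).prod with hcin
  set cout := C c.leadingCoeff * (Z'.map (fun ζ => X - C ζ)).prod with hcout
  have hfac : c = cin * cout := by
    have h := (IsAlgClosed.splits c).eq_prod_roots
    have h2 : c.roots = Z + Z' := (Multiset.filter_add_not _ _).symm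
    conv_lhs => rw [h, h2, Multiset.map_add, Multiset.prod_add]
    rw [hcout]; ring
  set g := v c.leadingCoeff * prd v 0 Z' 0 with hg
  have hgn : ∀ a ρ, v a ≤ v s → v ρ ≤ v s → nrm v a ρ cout = g := by
    intro a ρ ha hρ
    rw [hcout, map_mul, nrm_C, nrm_prod, prd_out v s ρ Z' hZ' a ha hρ]
  have hcn : ∀ a ρ, v a ≤ v s → v ρ ≤ v s → nrm v a ρ c = g * prd v ρ Z a := by
    intro a ρ ha hρ
    rw [hfac, map_mul, hgn a ρ ha hρ, hcin, nrm_prod, mul_comm]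
  have h0s : v (0 : Ω) ≤ v s := by simp
  have hg0 : g ≠ 0 := by
    rw [← hgn 0 s h0s le_rfl]
    exact nrm_ne_zero v 0 s hs0 (by rintro h; rw [h, mul_zero] at hfac; exact hc hfac)
  have hg1 : v (cout.eval 0) = g := by
    have := hgn 0 0 h0s h0s
    rw [← this]
    apply le_antisymm (eval_le_nrm v 0 0 cout)
    rw [nrm_zero_le_iff]
    intro i
    rcases i with _ | i
    · rw [coeff_zero_eq_eval_zero]; simp
    · simp
  have hgle1 : g ≤ 1 := by
    have h1 : nrm v 0 1 c = nrm v 0 1 cin * nrm v 0 1 cout := by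
      rw [← map_mul, ← hfac]
    have h2 : 1 ≤ nrm v 0 1 cin := by
      rw [hcin, nrm_prod]
      have := const_prd v 1 Z 0 1 (fun ζ _ => by simp)
      simpa using this
    have h3 : g ≤ nrm v 0 1 cout := by rw [← hg1]; exact eval_le_nrm v 0 1 cout
    calc g = 1 * g := (one_mul _).symm
      _ ≤ nrm v 0 1 cin * nrm v 0 1 cout := mul_le_mul' h2 h3
      _ ≤ 1 := by rw [← h1]; exact hc1
  have hcr' : v t ^ r = g * prd v t Z 0 := by rw [← hcr]; exact hcn 0 t h0s hts
  have hprd : prd v t Z 0 ≤ v s ^ Z.card :=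
    prd_const v t Z 0 (v s) fun ζ hζ => max_le hts (by simpa using hZ ζ hζ)
  have hgr : v t ^ r ≤ g := by
    rw [hcr']
    calc _ ≤ g * 1 := mul_le_mul_right (hprd.trans (pow_le_one₀ zero_le hs1.le)) _
      _ = g := mul_one _
  have hN : Z.card ≤ (K + 1) * r := by
    by_contra h
    push Not at h
    have h1 : v s ^ ((K + 1) * r) ≤ v s ^ Z.card := by
      rw [pow_mul, hvst, hcr']
      calc _ ≤ 1 * v s ^ Z.card := mul_le_mul' hgle1 hprd
        _ = _ := one_mul _
    exact absurd (pow_lt_pow_right_of_lt_one₀ hvs hs1 h) (not_lt.2 h1)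
  -- lower bound
  have hlow : ∀ a ρ, v a ≤ v s → v ρ ≤ v s → v τ ≤ v ρ →
      v s ^ ((K + 1) * (r * (1 + (K + 1) * (K + 1)))) ≤ nrm v a ρ c := by
    intro a ρ ha hρ hτρ
    rw [hcn a ρ ha hρ, pow_mul, hvst]
    have h1 : v τ ^ Z.card ≤ prd v ρ Z a :=
      const_prd v ρ Z a _ fun ζ _ => hτρ.trans (le_max_left _ _)
    have h2 : v t ^ (r * ((K + 1) * (K + 1))) ≤ v τ ^ Z.card := by
      rw [hvτ, ← pow_mul]
      apply pow_le_pow_of_le_one zero_le ht1.le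
      calc _ ≤ (K + 1) * ((K + 1) * r) := Nat.mul_le_mul_left _ hN
        _ = _ := by ring
    calc _ = v t ^ r * v t ^ (r * ((K + 1) * (K + 1))) := by rw [← pow_add]; ring_nf
      _ ≤ _ := mul_le_mul' hgr (h2.trans h1)
  have hH : ∀ a ρ, v a ≤ v s → v ρ ≤ v s → v τ ≤ v ρ → nrm v a ρ e ≤ nrm v a ρ c := by
    intro a ρ ha hρ hτρ
    by_contra h
    push Not at h
    have h1 := hyp a ρ ha hρ h
    have h2 := hlow a ρ ha hρ hτρ
    have h3 : nrm v a ρ c ^ (D + 1) < nrm v a ρ e ^ (D + 1) :=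
      pow_lt_pow_left₀ h zero_le (by omega)
    have h4 : v s ^ n ≤ nrm v a ρ c ^ (D + 1) := by
      calc v s ^ n ≤ v s ^ ((D + 1) * ((K + 1) * (r * (1 + (K + 1) * (K + 1))))) :=
            pow_le_pow_of_le_one zero_le hs1.le hn
        _ = (v s ^ ((K + 1) * (r * (1 + (K + 1) * (K + 1))))) ^ (D + 1) := by
          rw [← pow_mul]; ring_nf
        _ ≤ _ := pow_le_pow_left₀ zero_le h2 _
    exact absurd (h4.trans_lt h3) (not_lt.2 h1)
  obtain ⟨rem, h, e1, e2, e3⟩ := interp v τ s t (v t ^ K) hτ0 hs0 hτs hτt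
    (by rw [hvτ, pow_succ]) g _ Z rfl hZ e
    (by intro a ha; rw [← hcn a τ ha hτs]; exact hH a τ ha hτs le_rfl)
    (by
      refine (hH 0 s h0s le_rfl hτs).trans ?_
      rw [hcn 0 s h0s le_rfl]
      refine mul_le_mul_right ?_ _
      exact prd_const v s Z 0 (v s) fun ζ hζ => max_le le_rfl (by simpa using hZ ζ hζ))
  obtain ⟨q, u, b1, b2, b3⟩ := approx_quot v s hs0 cout g hg0 hg1 (hgn 0 s h0s le_rfl).le K 1 h
    (by simpa using e2)
  refine ⟨C (s ^ K) * q, ?_, ?_⟩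
  · intro i
    rw [coeff_C_mul, map_mul, map_pow]
    by_cases hi : K ≤ i
    · simp [b2 i hi]
    · have := (nrm_zero_le_iff v s q 1).1 b1 i
      rw [mul_comm]
      refine le_trans (mul_le_mul_right ?_ _) this
      exact pow_le_pow_of_le_one zero_le hs1.le (by omega)
  · have hid : C (s ^ K) * e - c * (C (s ^ K) * q) = C (s ^ K) * rem + cin * (C (s ^ K) * (X ^ K * u)) := by
      rw [← b3, e1, hfac]; ring
    rw [hid]
    refine (nrm v 0 t).map_add_le ?_ ?_
    · rw [map_mul, nrm_C, pow_add, hcr']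
      calc _ ≤ 1 * (g * prd v t Z 0 * v t ^ K) :=
            mul_le_mul' (by rw [map_pow]; exact pow_le_one₀ zero_le hs1.le) e3
        _ = _ := one_mul _
    · have hu : v s ^ K * nrm v 0 s u ≤ g := by
        have : nrm v 0 s (h - cout * q) ≤ g := by
          refine (nrm v 0 s).map_sub_le e2 ?_
          rw [map_mul, hgn 0 s h0s le_rfl]
          calc _ ≤ g * 1 := mul_le_mul_right b1 _
            _ = g := mul_one _
        rw [b3, map_mul, map_pow, nrm_X, map_zero, max_eq_left zero_le] at this
        exact this
      have hu2 : nrm v 0 t u ≤ nrm v 0 s u := nrm_le_nrm_zero v hs0 h0s hts u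
      rw [map_mul, map_mul, map_mul, nrm_C, map_pow, map_pow, nrm_X, map_zero, max_eq_left zero_le,
        hcin, nrm_prod, pow_add, hcr']
      calc _ = prd v t Z 0 * v t ^ K * (v s ^ K * nrm v 0 t u) := by rw [mul_left_comm (v s ^ K), mul_assoc]
        _ ≤ prd v t Z 0 * v t ^ K * g := 
          mul_le_mul_right ((mul_le_mul_right hu2 _).trans hu) _
        _ = _ := by ac_rfl

end Gauss
end Izumi

end

section

open Polynomial

namespace Izumi

section TwoD
variable {O : Type*} [CommRing O] [IsDomain O] [IsDiscreteValuationRing O]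

lemma exists_val (t : O) (ht : Irreducible t) (Ω : Type*) [Field Ω] [Algebra O Ω] [FaithfulSMul O Ω] :
    ∃ B : ValuationSubring Ω, ∀ (x : O) (k : ℕ),
      B.valuation (algebraMap O Ω x) ≤ B.valuation (algebraMap O Ω t) ^ k ↔ t ^ k ∣ x := by
  let A : Subring Ω := (algebraMap O Ω).range
  have hinj := FaithfulSMul.algebraMap_injective O Ω
  let φ : O ≃+* A := RingEquiv.ofBijective (algebraMap O Ω).rangeRestrict
    ⟨fun x y h => hinj (congrArg Subtype.val h), (algebraMap O Ω).rangeRestrict_surjective⟩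
  obtain ⟨B, h1, h2⟩ := Ideal.image_subset_nonunits_valuationSubring (A := A) (Ideal.span {φ t}) (by
    rw [Ne, Ideal.span_singleton_eq_top]
    intro h
    have := h.map φ.symm
    rw [RingEquiv.symm_apply_apply] at this
    exact ht.not_isUnit this)
  have hle : ∀ x : O, B.valuation (algebraMap O Ω x) ≤ 1 := fun x =>
    (B.valuation_le_one_iff _).2 (h1 ⟨x, rfl⟩)
  have hlt : B.valuation (algebraMap O Ω t) < 1 := by
    have : algebraMap O Ω t ∈ B.nonunits := h2 ⟨φ t, Ideal.mem_span_singleton_self _, rfl⟩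
    exact (ValuationSubring.mem_nonunits_iff B).1 this
  have h0 : 0 < B.valuation (algebraMap O Ω t) := by
    refine zero_lt_iff.2 ((Valuation.ne_zero_iff _).2 ?_)
    rw [Ne, map_eq_zero_iff _ hinj]; exact ht.ne_zero
  have hun : ∀ x : O, IsUnit x → B.valuation (algebraMap O Ω x) = 1 := by
    rintro x ⟨u, rfl⟩
    have h3 := hle (↑u⁻¹)
    have h4 := hle u
    have h5 : B.valuation (algebraMap O Ω u) * B.valuation (algebraMap O Ω (↑u⁻¹)) = 1 := by
      rw [← map_mul, ← map_mul]; simp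
    refine le_antisymm h4 ?_
    rw [← h5]
    calc _ ≤ B.valuation (algebraMap O Ω u) * 1 := mul_le_mul_right h3 _
      _ = _ := mul_one _
  refine ⟨B, fun x k => ⟨fun h => ?_, ?_⟩⟩
  · by_cases hx : x = 0
    · simp [hx]
    obtain ⟨j, u, rfl⟩ := IsDiscreteValuationRing.eq_unit_mul_pow_irreducible hx ht
    rw [map_mul, map_mul, hun _ u.isUnit, one_mul, map_pow, map_pow] at h
    apply Dvd.dvd.mul_left
    apply pow_dvd_pow
    by_contra hjk
    push Not at hjk
    exact absurd (pow_lt_pow_right_of_lt_one₀ h0 hlt hjk) (not_lt.2 h)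
  · rintro ⟨y, rfl⟩
    rw [map_mul, map_mul, map_pow, map_pow]
    calc _ ≤ B.valuation (algebraMap O Ω t) ^ k * 1 := mul_le_mul_right (hle y) _
      _ = _ := mul_one _

lemma mem_span_pow_of_coeff {R : Type*} [CommRing R] (t : R) (f : R[X]) (n : ℕ)
    (h : ∀ i, t ^ (n - i) ∣ f.coeff i) :
    f ∈ (Ideal.span {C t, X} : Ideal R[X]) ^ n := by
  rw [f.as_sum_support_C_mul_X_pow]
  refine Ideal.sum_mem _ fun i _ => ?_
  obtain ⟨y, hy⟩ := h i
  rw [hy]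
  have h1 : C t ∈ (Ideal.span {C t, X} : Ideal R[X]) := Ideal.subset_span (by simp)
  have h2 : (X : R[X]) ∈ (Ideal.span {C t, X} : Ideal R[X]) := Ideal.subset_span (by simp)
  have h3 : C t ^ (n - i) * X ^ i ∈ (Ideal.span {C t, X} : Ideal R[X]) ^ ((n - i) + i) := by
    rw [pow_add]
    exact Ideal.mul_mem_mul (Ideal.pow_mem_pow h1 _) (Ideal.pow_mem_pow h2 _)
  have h4 := Ideal.pow_le_pow_right (show n ≤ (n - i) + i by omega) h3
  have : C (t ^ (n - i) * y) * X ^ i = C y * (C t ^ (n - i) * X ^ i) := by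
    rw [C_mul, C_pow]; ring
  rw [this]
  exact Ideal.mul_mem_left _ _ h4

theorem twoD_O (t : O) (ht : Irreducible t) (D K : ℕ) (r n : ℕ) (c e : O[X]) (a : ℕ → O[X])
    (hc : c ∈ (Ideal.span {C t, X} : Ideal O[X]) ^ r)
    (hc' : c ∉ (Ideal.span {C t, X} : Ideal O[X]) ^ (r + 1))
    (hn : (D + 1) * ((K + 1) * (r * (1 + (K + 1) * (K + 1)))) ≤ n)
    (he : e ^ (D + 1) + ∑ i ∈ Finset.range (D + 1), a i * c ^ (i + 1) * e ^ (D - i) ∈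
      (Ideal.span {C t, X} : Ideal O[X]) ^ n) :
    ∃ q, e - q * c ∈ (Ideal.span {C t, X} : Ideal O[X]) ^ (r + K) := by
  classical
  let Ω := AlgebraicClosure (FractionRing O)
  haveI hfaith : FaithfulSMul O Ω := by
    rw [faithfulSMul_iff_algebraMap_injective, IsScalarTower.algebraMap_eq O (FractionRing O) Ω]
    exact (algebraMap (FractionRing O) Ω).injective.comp (IsFractionRing.injective O (FractionRing O))
  obtain ⟨B, hB⟩ := exists_val t ht Ω
  set v := B.valuation with hv
  let i₀ := algebraMap O Ω
  have hinj : Function.Injective i₀ := FaithfulSMul.algebraMap_injective O Ω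
  have hle1 : ∀ x, v (i₀ x) ≤ 1 := fun x => by simpa using (hB x 0).2 (by simp)
  set T := i₀ t with hT
  have hT0 : T ≠ 0 := by rw [hT, Ne, map_eq_zero_iff _ hinj]; exact ht.ne_zero
  have hvT0 : 0 < v T := zero_lt_iff.2 ((v.ne_zero_iff).2 hT0)
  have hvT : v T < 1 := by
    by_contra h
    push Not at h
    have := (hB 1 1).1 (by simpa using h)
    rw [pow_one] at this
    exact ht.not_isUnit (isUnit_of_dvd_one this)
  obtain ⟨s, hs⟩ : ∃ s : Ω, s ^ (K + 1) = T := IsAlgClosed.exists_pow_nat_eq T (by omega)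
  have hs0 : s ≠ 0 := by rintro rfl; simp at hs; exact hT0 hs.symm
  have hvs : 0 < v s := zero_lt_iff.2 ((v.ne_zero_iff).2 hs0)
  have hvst : v s ^ (K + 1) = v T := by rw [← map_pow, hs]
  have hs1 : v s < 1 := by
    by_contra h
    push Not at h
    have := one_le_pow₀ h (n := K + 1)
    rw [hvst] at this
    exact absurd hvT (not_lt.2 this)
  have hts : v T ≤ v s := by
    rw [← hvst]; exact pow_le_of_le_one zero_le hs1.le (by omega)
  let m := mapRingHom i₀
  have hm1 : ∀ a ρ : Ω, v a ≤ 1 → v ρ ≤ 1 → ∀ f : O[X], nrm v a ρ (m f) ≤ 1 := by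
    intro a ρ ha hρ f
    have h1 := nrm_le_nrm_zero v (a := a) (ρ := ρ) one_ne_zero (by simpa using ha) (by simpa using hρ) (m f)
    refine h1.trans ((nrm_zero_le_iff v 1 _ _).2 fun i => ?_)
    simpa [m] using hle1 (f.coeff i)
  have hmpow : ∀ (a ρ : Ω) (γ : B.ValueGroup), γ ≤ 1 → v a ≤ γ → v ρ ≤ γ → v T ≤ γ → ∀ n,
      ∀ f ∈ (Ideal.span {C t, X} : Ideal O[X]) ^ n, nrm v a ρ (m f) ≤ γ ^ n := by
    intro a ρ γ hγ ha hρ hTγ n f hf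
    have hw1 := hm1 a ρ (ha.trans hγ) (hρ.trans hγ)
    refine val_ideal_pow ((nrm v a ρ).comap m) hw1 _ γ ?_ n f hf
    intro x hx
    obtain ⟨y, z, rfl⟩ := Ideal.mem_span_pair.1 hx
    refine Valuation.map_add_le _ ?_ ?_
    · rw [map_mul]
      have : (nrm v a ρ).comap m (C t) ≤ γ := by
        rw [Valuation.comap_apply]; simp only [m, coe_mapRingHom, map_C, nrm_C]; exact hTγ
      calc _ ≤ 1 * γ := mul_le_mul' (hw1 y) this
        _ = γ := one_mul _
    · rw [map_mul]
      have : (nrm v a ρ).comap m X ≤ γ := by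
        rw [Valuation.comap_apply]; simp only [m, coe_mapRingHom, map_X, nrm_X]; exact max_le hρ ha
      calc _ ≤ 1 * γ := mul_le_mul' (hw1 z) this
        _ = γ := one_mul _
  have hz1 : v (0 : Ω) ≤ v T := by simp
  have hcr : nrm v 0 T (m c) = v T ^ r := by
    refine le_antisymm (hmpow 0 T (v T) hvT.le hz1 le_rfl le_rfl r c hc) ?_
    by_contra hcon
    apply hc'
    apply mem_span_pow_of_coeff
    intro i
    by_contra hdvd
    apply hcon
    have hci : ¬ v (i₀ (c.coeff i)) ≤ v T ^ (r + 1 - i) := fun h => hdvd ((hB _ _).1 h)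
    have hc0 : c.coeff i ≠ 0 := fun h => hdvd (by simp [h])
    obtain ⟨j, u, hju⟩ := IsDiscreteValuationRing.eq_unit_mul_pow_irreducible hc0 ht
    have hj : j < r + 1 - i := by
      by_contra hj
      push Not at hj
      exact hdvd (hju ▸ (pow_dvd_pow t hj).mul_left _)
    have h1 := (nrm_zero_le_iff v T (m c) _).1 le_rfl i
    refine le_trans ?_ h1
    have h2 : v T ^ j ≤ v (i₀ (c.coeff i)) := by
      have : v (i₀ (↑u⁻¹ * c.coeff i)) = v T ^ j := by
        rw [hju, ← mul_assoc]; simp [hT]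
      rw [← this, map_mul, map_mul]
      calc _ ≤ 1 * v (i₀ (c.coeff i)) := mul_le_mul_left (hle1 _) _
        _ = _ := one_mul _
    calc v T ^ r ≤ v T ^ (j + i) := pow_le_pow_of_le_one zero_le hvT.le (by omega)
      _ = v T ^ j * v T ^ i := pow_add _ _ _
      _ ≤ _ := by
        refine mul_le_mul_left ?_ _
        simpa [m] using h2
  have hcne : m c ≠ 0 := by
    intro h
    rw [h, map_zero] at hcr
    exact (pow_pos hvT0 r).ne hcr
  obtain ⟨q, hq1, hq2⟩ := twoD v T s K hs hT0 hvT (m c) (m e) hcne r hcr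
    (hm1 0 1 (by simp) (by simp) c) D n hn (by
      intro a' ρ ha hρ hlt
      have hw1 := hm1 a' ρ (ha.trans hs1.le) (hρ.trans hs1.le)
      have h1 := hmpow a' ρ (v s) hs1.le ha hρ hts n _ he
      refine le_trans (le_of_eq ?_) h1
      rw [map_add, map_sum, ← map_pow]
      symm
      rw [map_pow m]
      apply Valuation.map_add_eq_of_lt_left
      have hpos : 0 < nrm v a' ρ (m e) := lt_of_le_of_lt zero_le hlt
      rw [map_pow]
      apply Valuation.map_sum_lt _ (pow_pos hpos _).ne'
      intro i hi
      rw [map_mul, map_mul, map_pow, map_pow, map_mul, map_mul, map_pow, map_pow]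
      have hiD : i ≤ D := by simpa [Nat.lt_succ_iff] using hi
      calc _ ≤ 1 * nrm v a' ρ (m c) ^ (i + 1) * nrm v a' ρ (m e) ^ (D - i) := by
            gcongr; exact hw1 _
        _ < nrm v a' ρ (m e) ^ (i + 1) * nrm v a' ρ (m e) ^ (D - i) := by
            rw [one_mul]
            refine mul_lt_mul_of_pos_right ?_ (pow_pos hpos _)
            exact pow_lt_pow_left₀ hlt zero_le (by omega)
        _ = _ := by rw [← pow_add]; congr 1; omega)
  -- descent
  let w : ℕ → Ω := fun i => (C (s ^ K) * m e - m c * q).coeff i / T ^ (r + K - i)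
  have hw : ∀ i, i ≤ r + K → v (w i) ≤ 1 := by
    intro i hi
    have := (nrm_zero_le_iff v T _ _).1 hq2 i
    simp only [w, map_div₀, map_pow]
    rw [div_le_one₀ (pow_pos hvT0 _)]
    have h2 : v T ^ (r + K) = v T ^ (r + K - i) * v T ^ i := by rw [← pow_add]; congr 1; omega
    rw [h2, C_pow] at this
    exact le_of_mul_le_mul_right this (pow_pos hvT0 _)
  let G : Finset Ω := {s ^ K} ∪ (Finset.range (q.natDegree + 1)).image q.coeff ∪
    (Finset.range (r + K + 1)).image w
  let W : Submodule O Ω := Submodule.span O (G : Set Ω)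
  have hWv : ∀ x ∈ W, v x ≤ 1 := by
    intro x hx
    refine Submodule.span_induction ?_ ?_ ?_ ?_ hx
    · intro x hx
      simp only [G, Finset.coe_union, Finset.coe_image, Set.mem_union, Set.mem_image, Finset.mem_coe,
        Finset.mem_range, Finset.mem_singleton] at hx
      rcases hx with (hx | ⟨i, _, rfl⟩) | ⟨i, hi, rfl⟩
      · rw [hx, map_pow]; exact pow_le_one₀ zero_le hs1.le
      · exact hq1 i
      · exact hw i (by omega)
    · simp
    · intro x y _ _ hx hy; exact v.map_add_le hx hy
    · intro a x _ hx
      rw [Algebra.smul_def, map_mul]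
      exact mul_le_one' (hle1 a) hx
  have : Module.Finite O W := Module.Finite.span_finset O G
  have : Module.IsTorsionFree O W := inferInstance
  have : Module.Free O W := inferInstance
  let sW : W := ⟨s ^ K, Submodule.subset_span (by simp [G])⟩
  have hqW : ∀ i, q.coeff i ∈ W := by
    intro i
    by_cases hi : i < q.natDegree + 1
    · refine Submodule.subset_span ?_
      simp only [G, Finset.coe_union, Finset.coe_image, Set.mem_union, Set.mem_image, Finset.mem_coe,
        Finset.mem_range, Finset.mem_singleton]
      exact Or.inl (Or.inr ⟨i, hi, rfl⟩)
    · rw [coeff_eq_zero_of_natDegree_lt (by omega)]; exact zero_mem _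
  have hwW : ∀ i, i ≤ r + K → w i ∈ W := by
    intro i hi
    refine Submodule.subset_span ?_
    simp only [G, Finset.coe_union, Finset.coe_image, Set.mem_union, Set.mem_image, Finset.mem_coe,
        Finset.mem_range, Finset.mem_singleton]
    exact Or.inr ⟨i, by omega, rfl⟩
  obtain ⟨l, hl⟩ : ∃ l : W →ₗ[O] O, IsUnit (l sW) := by
    let b := Module.Free.chooseBasis O W
    by_contra hcon
    push Not at hcon
    have hdiv : ∀ j, t ∣ b.repr sW j := by
      intro j
      have h1 := hcon (b.coord j)
      have h2 : b.repr sW j ∈ IsLocalRing.maximalIdeal O := h1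
      rw [ht.maximalIdeal_eq] at h2
      exact Ideal.mem_span_singleton.1 h2
    choose y hy using hdiv
    have : sW = t • ∑ j, y j • b j := by
      conv_lhs => rw [← b.sum_repr sW]
      rw [Finset.smul_sum]
      exact Finset.sum_congr rfl fun j _ => by rw [hy, mul_smul]
    have h2 := congrArg (fun x : W => v x.1) this
    have h3 : v (t • ∑ j, y j • b j : W).1 ≤ v T := by
      rw [Submodule.coe_smul, Algebra.smul_def, map_mul]
      calc _ ≤ v T * 1 := mul_le_mul_right (hWv _ (Subtype.property _)) _
        _ = _ := mul_one _
    have h4 : v s ^ K ≤ v T := by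
      rw [← map_pow]; exact h2.trans_le h3
    rw [← hvst] at h4
    exact absurd (pow_lt_pow_right_of_lt_one₀ hvs hs1 (Nat.lt_succ_self K)) (not_lt.2 h4)
  obtain ⟨u, hu⟩ := hl
  let Q : ℕ → W := fun i => ⟨q.coeff i, hqW i⟩
  let q' : O[X] := ∑ i ∈ Finset.range (q.natDegree + 1), monomial i (l (Q i))
  have hq' : ∀ i, q'.coeff i = l (Q i) := by
    intro i
    simp only [q', finset_sum_coeff, coeff_monomial, Finset.sum_ite_eq', Finset.mem_range]
    split_ifs with h
    · rfl
    · have : Q i = 0 := Subtype.ext (coeff_eq_zero_of_natDegree_lt (by omega))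
      rw [this, map_zero]
  have key : C (u : O) * e - c * q' ∈ (Ideal.span {C t, X} : Ideal O[X]) ^ (r + K) := by
    apply mem_span_pow_of_coeff
    intro i
    by_cases hi : i ≤ r + K
    · have hid : e.coeff i • sW - ∑ p ∈ Finset.HasAntidiagonal.antidiagonal i, c.coeff p.1 • Q p.2
          = t ^ (r + K - i) • (⟨w i, hwW i hi⟩ : W) := by
        apply Subtype.ext
        simp only [Submodule.coe_sub, Submodule.coe_smul, Submodule.coe_sum, Algebra.smul_def, sW, Q, w,
          map_pow]
        rw [mul_div_cancel₀ _ (pow_ne_zero _ hT0), coeff_sub, ← C_pow, coeff_C_mul, coeff_mul]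
        simp [m, i₀, mul_comm]
      have h2 := congrArg l hid
      simp only [map_sub, map_smul, map_sum, ← hu, smul_eq_mul] at h2
      refine ⟨l ⟨w i, hwW i hi⟩, ?_⟩
      rw [← h2, coeff_sub, coeff_C_mul, coeff_mul, mul_comm]
      congr 1
      exact Finset.sum_congr rfl fun p _ => by rw [hq']
    · rw [Nat.sub_eq_zero_of_le (by omega), pow_zero]; exact one_dvd _
  refine ⟨C (↑u⁻¹ : O) * q', ?_⟩
  have : e - C (↑u⁻¹ : O) * q' * c = C (↑u⁻¹ : O) * (C (u : O) * e - c * q') := by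
    rw [mul_sub, ← mul_assoc, ← C_mul]; simp; ring
  rw [this]
  exact Ideal.mul_mem_left _ _ key

end TwoD
end Izumi

end

section

namespace Izumi
section Alg
variable (k σ : Type*) [Field k]

/-- `k[a]` -/
abbrev NN := MvPolynomial σ k
/-- `k[a][b]` -/
abbrev MM := MvPolynomial σ (MvPolynomial σ k)

open Polynomial in
/-- `a_i ↦ a_i + b_i Y` -/
noncomputable def phi0 : MvPolynomial σ k →+* Polynomial (MM k σ) :=
  MvPolynomial.eval₂Hom ((Polynomial.C).comp (MvPolynomial.C.comp MvPolynomial.C))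
    (fun i => Polynomial.C (MvPolynomial.C (MvPolynomial.X i)) +
      Polynomial.C (MvPolynomial.X i) * Polynomial.X)

/-- `a_i ↦ a_i - b_i Y` -/
noncomputable def phi1 : MvPolynomial σ k →+* Polynomial (MM k σ) :=
  MvPolynomial.eval₂Hom ((Polynomial.C).comp (MvPolynomial.C.comp MvPolynomial.C))
    (fun i => Polynomial.C (MvPolynomial.C (MvPolynomial.X i)) +
      Polynomial.C (MvPolynomial.C (MvPolynomial.C (-1))) * (Polynomial.C (MvPolynomial.X i) * Polynomial.X))

/-- extension of a map on `k[a]` to `k[a,b,Y]`, fixing `b`, `Y` -/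
noncomputable def extY (f : MvPolynomial σ k →+* Polynomial (MM k σ)) :
    Polynomial (MM k σ) →+* Polynomial (MM k σ) :=
  Polynomial.eval₂RingHom (MvPolynomial.eval₂Hom f (fun i => Polynomial.C (MvPolynomial.X i)))
    Polynomial.X

lemma extY_X (f) : extY k σ f Polynomial.X = Polynomial.X := by simp [extY]
lemma extY_b (f) (i) : extY k σ f (Polynomial.C (MvPolynomial.X i)) = Polynomial.C (MvPolynomial.X i) := by
  simp [extY]
lemma extY_a (f) (p) : extY k σ f (Polynomial.C (MvPolynomial.C p)) = f p := by
  simp [extY]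

lemma phi0_X (i : σ) : phi0 k σ (MvPolynomial.X i) = Polynomial.C (MvPolynomial.C (MvPolynomial.X i)) +
      Polynomial.C (MvPolynomial.X i) * Polynomial.X := by simp [phi0]
lemma phi0_C (c : k) : phi0 k σ (MvPolynomial.C c) = 
    Polynomial.C (MvPolynomial.C (MvPolynomial.C c)) := by simp [phi0]
lemma phi1_X (i : σ) : phi1 k σ (MvPolynomial.X i) = Polynomial.C (MvPolynomial.C (MvPolynomial.X i)) +
      Polynomial.C (MvPolynomial.C (MvPolynomial.C (-1))) * (Polynomial.C (MvPolynomial.X i) * Polynomial.X) := by simp [phi1]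
lemma phi1_C (c : k) : phi1 k σ (MvPolynomial.C c) = 
    Polynomial.C (MvPolynomial.C (MvPolynomial.C c)) := by simp [phi1]

lemma cancelY (x y : Polynomial (MM k σ)) :
    x + (y + Polynomial.C (MvPolynomial.C (MvPolynomial.C (-1))) * y) = x := by
  have : (Polynomial.C (MvPolynomial.C (MvPolynomial.C (-1 : k))) : Polynomial (MM k σ)) + 1 = 0 := by
    rw [← map_one (Polynomial.C), ← map_one MvPolynomial.C, ← map_one MvPolynomial.C,
      ← map_add, ← map_add, ← map_add]
    simp
  calc _ = x + (Polynomial.C (MvPolynomial.C (MvPolynomial.C (-1 : k))) + 1) * y := by ring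
    _ = x := by rw [this]; ring

lemma cancelY' (x y : Polynomial (MM k σ)) :
    x + (Polynomial.C (MvPolynomial.C (MvPolynomial.C (-1))) * y + y) = x := by
  rw [add_comm _ y, cancelY]

lemma ext10 (p : MvPolynomial σ k) :
    extY k σ (phi1 k σ) (phi0 k σ p) = Polynomial.C (MvPolynomial.C p) := by
  have : (extY k σ (phi1 k σ)).comp (phi0 k σ) = (Polynomial.C).comp MvPolynomial.C := by
    apply MvPolynomial.ringHom_ext
    · intro c
      simp only [RingHom.comp_apply, phi0_C, extY_a, phi1_C]
    · intro i
      simp only [RingHom.comp_apply, phi0_X, map_add, map_mul, extY_a, extY_b, extY_X, phi1_X, add_assoc, cancelY']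
  exact congrArg (fun f => f p) this

lemma ext01 (p : MvPolynomial σ k) :
    extY k σ (phi0 k σ) (phi1 k σ p) = Polynomial.C (MvPolynomial.C p) := by
  have : (extY k σ (phi0 k σ)).comp (phi1 k σ) = (Polynomial.C).comp MvPolynomial.C := by
    apply MvPolynomial.ringHom_ext
    · intro c
      simp only [RingHom.comp_apply, phi1_C, extY_a, phi0_C]
    · intro i
      simp only [RingHom.comp_apply, phi1_X, map_add, map_mul, extY_a, extY_b, extY_X, phi0_X, phi0_C, add_assoc, cancelY]
  exact congrArg (fun f => f p) this

lemma ext_ext (P : Polynomial (MM k σ)) : extY k σ (phi0 k σ) (extY k σ (phi1 k σ) P) = P := by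
  have : (extY k σ (phi0 k σ)).comp (extY k σ (phi1 k σ)) = RingHom.id _ := by
    apply Polynomial.ringHom_ext'
    · apply MvPolynomial.ringHom_ext
      · intro c
        simp only [RingHom.comp_apply, extY_a, ext01, RingHom.id_apply]
      · intro i
        simp only [RingHom.comp_apply, extY_b, RingHom.id_apply]
    · simp only [RingHom.comp_apply, extY_X, RingHom.id_apply]
  exact congrArg (fun f => f P) this

lemma phi0_injective : Function.Injective (phi0 k σ) := by
  intro p q h
  have := congrArg (extY k σ (phi1 k σ)) h
  rw [ext10, ext10] at this
  exact MvPolynomial.C_injective _ _ (Polynomial.C_injective this)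

/-- set `a = 0`. -/
noncomputable def aZero : Polynomial (MM k σ) →+* Polynomial (MvPolynomial σ k) :=
  Polynomial.mapRingHom (MvPolynomial.map (MvPolynomial.constantCoeff))

lemma aZero_phi0 (p : MvPolynomial σ k) : aZero k σ (phi0 k σ p) =
    ∑ α ∈ p.support, Polynomial.monomial α.degree (MvPolynomial.monomial α (p.coeff α)) := by
  have h : ∀ (α : σ →₀ ℕ) (c : k), aZero k σ (phi0 k σ (MvPolynomial.monomial α c)) =
      Polynomial.monomial α.degree (MvPolynomial.monomial α c) := by
    intro α c
    induction α using Finsupp.induction with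
    | zero => 
      show aZero k σ (phi0 k σ (MvPolynomial.C c)) = _
      rw [phi0_C]; simp [aZero]
    | single_add i n α hi hn ih =>
      rw [MvPolynomial.monomial_single_add, map_mul, map_mul, ih, map_pow, map_pow, phi0_X]
      simp only [aZero, map_add, map_mul, Polynomial.coe_mapRingHom, Polynomial.map_C,
        MvPolynomial.map_C, MvPolynomial.constantCoeff_X, map_zero, zero_add, MvPolynomial.map_X,
        Polynomial.map_X, ← Polynomial.C_mul_X_pow_eq_monomial, mul_pow, Finsupp.degree_single]
      rw [pow_add, ← Polynomial.C_pow]; ring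
  conv_lhs => rw [p.as_sum, map_sum, map_sum]
  exact Finset.sum_congr rfl fun α _ => h _ _

lemma degree_le_natDegree (p : MvPolynomial σ k) (α) (hα : α ∈ p.support) :
    α.degree ≤ (phi0 k σ p).natDegree := by
  by_contra hlt
  push Not at hlt
  have h1 : (aZero k σ (phi0 k σ p)).coeff α.degree = 0 := by
    apply Polynomial.coeff_eq_zero_of_natDegree_lt
    exact lt_of_le_of_lt (Polynomial.natDegree_map_le) hlt
  rw [aZero_phi0, Polynomial.finset_sum_coeff] at h1
  have h2 := congrArg (MvPolynomial.coeff α) h1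
  classical
  rw [MvPolynomial.coeff_sum, Finset.sum_eq_single α] at h2
  · simp at h2
    exact (MvPolynomial.mem_support_iff.1 hα) h2
  · intro β _ hβ
    rw [Polynomial.coeff_monomial]
    split_ifs
    · rw [MvPolynomial.coeff_monomial, if_neg hβ]
    · simp
  · intro h; exact absurd hα h

lemma dvd_of_CC {p q : MvPolynomial σ k}
    (h : (Polynomial.C (MvPolynomial.C p) : Polynomial (MM k σ)) ∣ Polynomial.C (MvPolynomial.C q)) :
    p ∣ q := by
  have := map_dvd ((MvPolynomial.constantCoeff (σ := σ) (R := MvPolynomial σ k)).comp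
    (Polynomial.constantCoeff)) h
  simpa using this

lemma alg_coprime (ε γ : MvPolynomial σ k) (hγ : γ ≠ 0) (hrel : IsRelPrime ε γ)
    (H : MM k σ) (hH : H ≠ 0) (w : Polynomial (MM k σ))
    (h : Polynomial.C H * phi0 k σ ε = phi0 k σ γ * w) : IsUnit γ := by
  classical
  by_contra hu
  obtain ⟨π, hπ, hdvd⟩ := WfDvdMonoid.exists_irreducible_factor hu hγ
  have hprime : Prime π := hπ.prime
  have hnd : ¬ π ∣ ε := fun hd => hπ.not_isUnit (hrel hd hdvd)
  have hp2 : Prime (Polynomial.C (MvPolynomial.C π) : Polynomial (MM k σ)) :=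
    Polynomial.prime_C_iff.2 ((MvPolynomial.prime_C_iff σ).2 hprime)
  obtain ⟨γ', rfl⟩ := hdvd
  have h2 := congrArg (extY k σ (phi1 k σ)) h
  rw [map_mul, map_mul, map_mul, map_mul, ext10, ext10, ext10] at h2
  have h3 : (Polynomial.C (MvPolynomial.C π) : Polynomial (MM k σ)) ∣ 
      extY k σ (phi1 k σ) (Polynomial.C H) * Polynomial.C (MvPolynomial.C ε) := by
    rw [h2, mul_assoc]; exact dvd_mul_right _ _
  rcases hp2.dvd_or_dvd h3 with h4 | h4
  · have h5 := map_dvd (extY k σ (phi0 k σ)) h4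
    rw [ext_ext, extY_a] at h5
    have h6 : (phi0 k σ π).natDegree = 0 := by
      have := Polynomial.natDegree_le_of_dvd h5 (by simpa using hH)
      simpa using this
    have h7 : ∀ α ∈ π.support, α = 0 := by
      intro α hα
      have := degree_le_natDegree k σ π α hα
      rw [h6] at this
      simpa [Finsupp.degree_eq_zero_iff] using this
    have h8 : π = MvPolynomial.C (π.coeff 0) := by
      ext α
      by_cases hα : α ∈ π.support
      · rw [h7 α hα]; simp
      · rw [MvPolynomial.notMem_support_iff.1 hα, MvPolynomial.coeff_C]
        split_ifs with h0
        · subst h0; exact (MvPolynomial.notMem_support_iff.1 hα).symm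
        · rfl
    have h9 : π.coeff 0 ≠ 0 := by
      intro h0; rw [h0, map_zero] at h8; exact hπ.ne_zero h8
    exact hπ.not_isUnit (h8 ▸ (IsUnit.mk0 _ h9).map MvPolynomial.C)
  · exact hnd (dvd_of_CC k σ h4)

/-- The map to `κ[Y]`. -/
noncomputable def phiK : MvPolynomial σ k →+* Polynomial (FractionRing (MM k σ)) :=
  (Polynomial.mapRingHom (algebraMap (MM k σ) (FractionRing (MM k σ)))).comp (phi0 k σ)

lemma phiK_injective : Function.Injective (phiK k σ) := by
  have := Polynomial.map_injective _ (IsFractionRing.injective (MM k σ) (FractionRing (MM k σ)))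
  exact this.comp (phi0_injective k σ)

lemma degree_le_natDegreeK (p : MvPolynomial σ k) (α) (hα : α ∈ p.support) :
    α.degree ≤ (phiK k σ p).natDegree := by
  have : (phiK k σ p).natDegree = (phi0 k σ p).natDegree := 
    Polynomial.natDegree_map_eq_of_injective (IsFractionRing.injective (MM k σ) _) _
  rw [this]
  exact degree_le_natDegree k σ p α hα

theorem alg_main (ε γ : MvPolynomial σ k) (hγ : γ ≠ 0) (h : Polynomial (FractionRing (MM k σ)))
    (heq : phiK k σ ε = phiK k σ γ * h) :
    ∃ δ : MvPolynomial σ k, phiK k σ δ = h := by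
  classical
  obtain ⟨ε', γ', d, hrel, hε, hγ'⟩ := UniqueFactorizationMonoid.exists_reduced_factors' ε γ hγ
  have hd : d ≠ 0 := by rintro rfl; rw [zero_mul] at hγ'; exact hγ hγ'.symm
  have hγ0 : γ' ≠ 0 := by rintro rfl; rw [mul_zero] at hγ'; exact hγ hγ'.symm
  have hdK : phiK k σ d ≠ 0 := by
    rw [Ne, map_eq_zero_iff _ (phiK_injective k σ)]; exact hd
  have heq' : phiK k σ ε' = phiK k σ γ' * h := by
    apply mul_left_cancel₀ hdK
    rw [← map_mul, hε, ← mul_assoc, ← map_mul, hγ', heq]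
  obtain ⟨b, hb, hb'⟩ := IsLocalization.integerNormalization_spec (nonZeroDivisors (MM k σ)) h
  have hu := alg_coprime k σ ε' γ' hγ0 hrel b (nonZeroDivisors.ne_zero hb) 
    (IsLocalization.integerNormalization (nonZeroDivisors (MM k σ)) h) (by
      apply Polynomial.map_injective _ (IsFractionRing.injective (MM k σ) (FractionRing (MM k σ)))
      rw [Polynomial.map_mul, Polynomial.map_mul, hb', Polynomial.map_C]
      have e1 : (phi0 k σ ε').map (algebraMap (MM k σ) (FractionRing (MM k σ))) = phiK k σ ε' := rfl
      have e2 : (phi0 k σ γ').map (algebraMap (MM k σ) (FractionRing (MM k σ))) = phiK k σ γ' := rfl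
      rw [e1, e2, heq', ← IsScalarTower.algebraMap_smul (FractionRing (MM k σ)) b h, Polynomial.smul_eq_C_mul]
      ring)
  obtain ⟨u, rfl⟩ := hu
  refine ⟨ε' * ↑u⁻¹, ?_⟩
  rw [map_mul, heq', mul_right_comm, ← map_mul]
  simp
end Alg
end Izumi

end

section

namespace Izumi
section DataO
universe u v w
variable {V : Type u} {k : Type v} {σ : Type w} [CommRing V] [IsDomain V] [IsNoetherianRing V] [Finite σ] [Field k]

lemma exists_O (π : V) (hπ : π ≠ 0) (res : V →+* k)
    (hker : RingHom.ker res = Ideal.span {π}) :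
    ∃ (O : Type (max u w)) (_ : CommRing O) (_ : IsDomain O) (_ : IsDiscreteValuationRing O)
      (τ : MvPolynomial σ (MvPolynomial σ V) →+* O) (ρ : O →+* FractionRing (MM k σ)),
      Irreducible (τ (MvPolynomial.C (MvPolynomial.C π))) ∧ 
      (∀ x, ρ x = 0 ↔ τ (MvPolynomial.C (MvPolynomial.C π)) ∣ x) ∧
      (∀ x, ρ (τ x) = algebraMap (MM k σ) _ (MvPolynomial.map (MvPolynomial.map res) x)) ∧
      Function.Injective τ := by
  classical
  let W := MvPolynomial σ (MvPolynomial σ V)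
  let θ : W →+* FractionRing (MM k σ) := (algebraMap (MM k σ) _).comp
    (MvPolynomial.map (MvPolynomial.map res))
  let P : Ideal W := RingHom.ker θ
  have hPp : P.IsPrime := RingHom.ker_isPrime θ
  have hP : P = Ideal.span {MvPolynomial.C (MvPolynomial.C π)} := by
    have h1 : P = RingHom.ker (MvPolynomial.map (σ := σ) (MvPolynomial.map (σ := σ) res)) := by
      ext x
      simp only [P, θ, RingHom.mem_ker, RingHom.comp_apply]
      rw [map_eq_zero_iff _ (IsFractionRing.injective (MM k σ) _)]
    rw [h1, MvPolynomial.ker_map, MvPolynomial.ker_map, hker, Ideal.map_span, Ideal.map_span]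
    simp
  let O := Localization.AtPrime P
  let t : O := algebraMap W O (MvPolynomial.C (MvPolynomial.C π))
  have hinj : Function.Injective (algebraMap W O) := 
    IsLocalization.injective O P.primeCompl_le_nonZeroDivisors
  haveI : IsDomain O := IsLocalization.isDomain_localization P.primeCompl_le_nonZeroDivisors
  haveI : IsNoetherianRing O := IsLocalization.isNoetherianRing P.primeCompl O inferInstance
  have hmax : IsLocalRing.maximalIdeal O = Ideal.span {t} := by
    rw [← Localization.AtPrime.map_eq_maximalIdeal]
    refine (congrArg (Ideal.map _) hP).trans ?_
    rw [Ideal.map_span, Set.image_singleton]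
  have ht0 : t ≠ 0 := by
    intro h
    have := (map_eq_zero_iff _ hinj).1 h
    rw [← map_zero (MvPolynomial.C), ← map_zero (MvPolynomial.C)] at this
    exact hπ (MvPolynomial.C_injective _ _ (MvPolynomial.C_injective _ _ this))
  have hnf : ¬ IsField O := by
    intro h
    rw [IsLocalRing.isField_iff_maximalIdeal_eq, hmax] at h
    simp [ht0] at h
  have hpr : Submodule.IsPrincipal (IsLocalRing.maximalIdeal O) := ⟨t, hmax⟩
  haveI : IsDiscreteValuationRing O := 
    ((IsDiscreteValuationRing.TFAE O hnf).out 0 4).2 hpr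
  have hirr : Irreducible t := 
    (IsDiscreteValuationRing.irreducible_iff_uniformizer t).2 hmax
  have hu : ∀ y : P.primeCompl, IsUnit (θ y) := fun y => by
    rw [isUnit_iff_ne_zero]
    exact fun h => y.2 (RingHom.mem_ker.2 h)
  refine ⟨O, inferInstance, inferInstance, inferInstance, algebraMap W O,
    IsLocalization.lift (M := P.primeCompl) (g := θ) hu, hirr, ?_, ?_, hinj⟩
  · intro x
    have hx : t ∣ x ↔ x ∈ IsLocalRing.maximalIdeal O := by rw [hmax, Ideal.mem_span_singleton]
    rw [show (algebraMap W O (MvPolynomial.C (MvPolynomial.C π))) = t from rfl, hx]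
    obtain ⟨y, s, rfl⟩ := IsLocalization.exists_mk'_eq P.primeCompl x
    rw [IsLocalization.AtPrime.mk'_mem_maximal_iff O P, IsLocalization.lift_mk'_spec, mul_zero]
    rfl
  · intro x
    exact IsLocalization.lift_eq hu x

end DataO
end Izumi

end

section

namespace Izumi

/-- the ideal `(π, X_i)` -/
noncomputable def MI {V : Type*} (σ : Type*) [CommRing V] (π : V) : Ideal (MvPolynomial σ V) :=
  Ideal.span (insert (MvPolynomial.C π) (Set.range MvPolynomial.X))

section Fil
variable {V σ : Type*} [CommRing V]

/-- coefficientwise description of `MI ^ n` -/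
def PP (π : V) (n : ℕ) (f : MvPolynomial σ V) : Prop :=
  ∀ α, π ^ (n - α.degree) ∣ f.coeff α

lemma PP_add {π : V} {n : ℕ} {f g : MvPolynomial σ V} (hf : PP π n f) (hg : PP π n g) :
    PP π n (f + g) := fun α => by
  rw [MvPolynomial.coeff_add]; exact dvd_add (hf α) (hg α)

lemma PP_mul {π : V} {n m : ℕ} {f g : MvPolynomial σ V} (hf : PP π n f) (hg : PP π m g) :
    PP π (n + m) (f * g) := fun α => by
  classical
  rw [MvPolynomial.coeff_mul]
  refine Finset.dvd_sum fun x hx => ?_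
  refine dvd_trans ?_ (mul_dvd_mul (hf x.1) (hg x.2))
  rw [← pow_add]
  apply pow_dvd_pow
  rw [Finset.HasAntidiagonal.mem_antidiagonal] at hx
  rw [← hx, map_add]
  omega

lemma PP_zero {π : V} (f : MvPolynomial σ V) : PP π 0 f := fun α => by simp

lemma MI_le_PP {π : V} {f : MvPolynomial σ V} (hf : f ∈ MI σ π) : PP π 1 f := by
  classical
  refine Submodule.span_induction (p := fun f _ => PP π 1 f) ?_ ?_ ?_ ?_ hf
  · rintro x (rfl | ⟨i, rfl⟩) α
    · rw [MvPolynomial.coeff_C]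
      split_ifs with h
      · subst h; simp
      · simp
    · rw [MvPolynomial.coeff_X']
      split_ifs with h
      · subst h; simp
      · simp
  · intro α; simp
  · intro x y _ _ hx hy; exact PP_add hx hy
  · intro a x _ hx
    simpa using PP_mul (PP_zero a) hx

lemma mem_MI_pow {π : V} {n : ℕ} {f : MvPolynomial σ V} : f ∈ MI σ π ^ n ↔ PP π n f := by
  constructor
  · intro hf
    induction n generalizing f with
    | zero => exact PP_zero f
    | succ n ih =>
      rw [pow_succ] at hf
      refine Submodule.mul_induction_on hf ?_ ?_
      · intro a ha b hb
        exact PP_mul (ih ha) (MI_le_PP hb)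
      · intro a b ha hb; exact PP_add ha hb
  · intro hf
    rw [← MvPolynomial.support_sum_monomial_coeff f]
    refine Ideal.sum_mem _ fun α _ => ?_
    obtain ⟨u, hu⟩ := hf α
    rw [hu]
    have h1 : MvPolynomial.C π ^ (n - α.degree) ∈ MI σ π ^ (n - α.degree) :=
      Ideal.pow_mem_pow (Ideal.subset_span (Set.mem_insert _ _)) _
    have h2 : (MvPolynomial.monomial α (1 : V)) ∈ MI σ π ^ (α.degree) := by
      rw [MvPolynomial.monomial_eq, map_one, one_mul, Finsupp.prod, Finsupp.degree_apply]
      rw [← Finset.prod_pow_eq_pow_sum]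
      refine Ideal.prod_mem_prod fun i _ => ?_
      exact Ideal.pow_mem_pow (Ideal.subset_span (Set.mem_insert_of_mem _ (Set.mem_range_self i))) _
    have h3 := Ideal.mul_mem_mul h1 h2
    rw [← pow_add] at h3
    have h4 := Ideal.mul_mem_left _ (MvPolynomial.C u) (Ideal.pow_le_pow_right (show n ≤ n - α.degree + α.degree by omega) h3)
    convert h4 using 1
    rw [← map_pow, ← mul_assoc, ← map_mul, MvPolynomial.C_mul_monomial, mul_one, mul_comm]

end Fil

section Psi
universe u
variable {V k σ : Type*} [CommRing V] [IsDomain V] [Field k]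
variable {O : Type*} [CommRing O] [IsDomain O]
variable (τ : MvPolynomial σ (MvPolynomial σ V) →+* O) (ρ : O →+* FractionRing (MM k σ))
variable (π : V) (res : V →+* k) 

/-- constants -/
noncomputable abbrev cc : V →+* Polynomial O :=
  Polynomial.C.comp (τ.comp (MvPolynomial.C.comp MvPolynomial.C))
/-- `a_i + b_i Y` -/
noncomputable abbrev LL (i : σ) : Polynomial O :=
  Polynomial.C (τ (MvPolynomial.C (MvPolynomial.X i))) + Polynomial.C (τ (MvPolynomial.X i)) * Polynomial.X

noncomputable def Psi : MvPolynomial σ V →+* Polynomial O :=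
  MvPolynomial.eval₂Hom (cc τ) (fun i => Polynomial.C (τ (MvPolynomial.C (MvPolynomial.X i))) * cc τ π 
    + Polynomial.C (τ (MvPolynomial.X i)) * Polynomial.X)

noncomputable def Theta : MvPolynomial σ V →+* Polynomial O :=
  MvPolynomial.eval₂Hom (cc τ) (fun i => cc τ π * LL τ i)

/-- `y ↦ t Y` -/
noncomputable def scale (t : O) : Polynomial O →+* Polynomial O :=
  Polynomial.compRingHom (Polynomial.C t * Polynomial.X)

lemma scale_coeff (t : O) (f : Polynomial O) (i : ℕ) : (scale t f).coeff i = f.coeff i * t ^ i := by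
  simp [scale, Polynomial.comp_C_mul_X_coeff]

lemma scale_Psi (f : MvPolynomial σ V) :
    scale (τ (MvPolynomial.C (MvPolynomial.C π))) (Psi τ π f) = Theta τ π f := by
  have : (scale (τ (MvPolynomial.C (MvPolynomial.C π)))).comp (Psi τ π) = Theta τ π := by
    apply MvPolynomial.ringHom_ext
    · intro r; simp [scale, Psi, Theta]
    · intro i; simp [scale, Psi, Theta]; ring
  exact congrArg (fun g => g f) this

lemma scale_mem (t : O) (n : ℕ) (f : Polynomial O)
    (hf : f ∈ (Ideal.span {Polynomial.C t, Polynomial.X} : Ideal (Polynomial O)) ^ n) :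
    Polynomial.C t ^ n ∣ scale t f := by
  have h1 := Ideal.mem_map_of_mem (scale t) hf
  rw [Ideal.map_pow, Ideal.map_span] at h1
  rw [← Ideal.mem_span_singleton, ← Ideal.span_singleton_pow]
  refine Ideal.pow_right_mono ?_ n h1
  rw [Ideal.span_le]
  rintro _ ⟨x, (rfl | rfl), rfl⟩
  · simp [scale, Ideal.mem_span_singleton]
  · simp [scale, Ideal.mem_span_singleton]

lemma Psi_mem (n : ℕ) (f : MvPolynomial σ V) (hf : f ∈ MI σ π ^ n) :
    Psi τ π f ∈ (Ideal.span {Polynomial.C (τ (MvPolynomial.C (MvPolynomial.C π))), Polynomial.X} :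
      Ideal (Polynomial O)) ^ n := by
  have h1 := Ideal.mem_map_of_mem (Psi τ π) hf
  rw [MI, Ideal.map_pow, Ideal.map_span] at h1
  refine Ideal.pow_right_mono ?_ n h1
  rw [Ideal.span_le]
  rintro _ ⟨x, (rfl | ⟨i, rfl⟩), rfl⟩
  · simp only [Psi, MvPolynomial.coe_eval₂Hom, MvPolynomial.eval₂_C]
    exact Ideal.subset_span (by simp)
  · simp only [Psi, MvPolynomial.coe_eval₂Hom, MvPolynomial.eval₂_X]
    refine Ideal.add_mem _ (Ideal.mul_mem_left _ _ ?_) (Ideal.mul_mem_left _ _ ?_)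
    · exact Ideal.subset_span (by simp)
    · exact Ideal.subset_span (by simp)

lemma Theta_monomial (α : σ →₀ ℕ) (c : V) : Theta τ π (MvPolynomial.monomial α c) =
    cc τ c * cc τ π ^ α.degree * α.prod (fun i n => LL τ i ^ n) := by
  rw [Theta, MvPolynomial.eval₂Hom_monomial, mul_assoc]
  congr 1
  simp only [mul_pow, Finsupp.prod, Finset.prod_mul_distrib, Finsupp.degree_apply, Finset.prod_pow_eq_pow_sum]

variable {τ ρ π res}

lemma map_cc (hρ : ∀ x, ρ (τ x) = algebraMap (MM k σ) _ (MvPolynomial.map (MvPolynomial.map res) x))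
    (c : V) : Polynomial.map ρ (cc τ c) = phiK k σ (MvPolynomial.C (res c)) := by
  simp [phiK, phi0_C, hρ]

lemma map_LL (hρ : ∀ x, ρ (τ x) = algebraMap (MM k σ) _ (MvPolynomial.map (MvPolynomial.map res) x))
    (i : σ) : Polynomial.map ρ (LL τ i) = phiK k σ (MvPolynomial.X i) := by
  simp [phiK, phi0_X, hρ]

/-- leading form of an element of the `n`-th step of the filtration -/
lemma form (hker : RingHom.ker res = Ideal.span {π})
    (hρ : ∀ x, ρ (τ x) = algebraMap (MM k σ) _ (MvPolynomial.map (MvPolynomial.map res) x))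
    (n : ℕ) (f : MvPolynomial σ V) (hf : PP π n f) :
    ∃ (G : Polynomial O) (g : MvPolynomial σ k), Theta τ π f = cc τ π ^ n * G ∧
      Polynomial.map ρ G = phiK k σ g ∧ (∀ α, n < α.degree → g.coeff α = 0) ∧
      ∀ α, α.degree ≤ n → ∃ u, f.coeff α = π ^ (n - α.degree) * u ∧ res u = g.coeff α := by
  classical
  have hπ0 : res π = 0 := by
    have : π ∈ RingHom.ker res := hker ▸ Ideal.mem_span_singleton_self π
    exact this
  choose u hu using hf
  -- use zero where the coefficient of f vanishes
  let w : (σ →₀ ℕ) → V := fun α => if f.coeff α = 0 then 0 else u α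
  have hw : ∀ α, f.coeff α = π ^ (n - α.degree) * w α := by
    intro α
    simp only [w]
    split_ifs with h
    · simp [h]
    · exact hu α
  refine ⟨∑ α ∈ f.support, cc τ (w α) * cc τ π ^ (α.degree - n) * α.prod (fun i n => LL τ i ^ n),
    ∑ α ∈ f.support, MvPolynomial.monomial α (if α.degree ≤ n then res (w α) else 0), ?_, ?_, ?_, ?_⟩
  · conv_lhs => rw [← MvPolynomial.support_sum_monomial_coeff f]
    rw [map_sum, Finset.mul_sum]
    refine Finset.sum_congr rfl fun α _ => ?_
    rw [Theta_monomial, hw α, map_mul, map_pow]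
    have : cc τ π ^ (n - α.degree) * cc τ π ^ α.degree = cc τ π ^ n * cc τ π ^ (α.degree - n) := by
      rw [← pow_add, ← pow_add]; congr 1; omega
    calc _ = (cc τ π ^ (n - α.degree) * cc τ π ^ α.degree) * (cc τ (w α) * α.prod (fun i n => LL τ i ^ n)) := by ring
      _ = _ := by rw [this]; ring
  · rw [← Polynomial.coe_mapRingHom, map_sum, map_sum]
    refine Finset.sum_congr rfl fun α _ => ?_
    rw [map_mul, map_mul, map_pow]
    simp only [Polynomial.coe_mapRingHom]
    rw [map_cc hρ, map_cc hρ, hπ0]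
    have h1 : Polynomial.map ρ (α.prod (fun i n => LL τ i ^ n)) = phiK k σ (MvPolynomial.monomial α 1) := by
      rw [MvPolynomial.monomial_eq, map_one, one_mul, ← Polynomial.coe_mapRingHom, map_finsuppProd, map_finsuppProd]
      simp only [map_pow, Polynomial.coe_mapRingHom, map_LL hρ]
    rw [h1, ← map_pow, ← map_mul, ← map_mul]
    congr 1
    split_ifs with h
    · rw [Nat.sub_eq_zero_of_le h, pow_zero, mul_one, MvPolynomial.C_mul_monomial, mul_one]
    · rw [MvPolynomial.C_0, zero_pow (by omega)]; simp
  · intro α hα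
    rw [MvPolynomial.coeff_sum]
    refine Finset.sum_eq_zero fun β _ => ?_
    rw [MvPolynomial.coeff_monomial]
    split_ifs with h1 h2
    · subst h1; omega
    · rfl
    · rfl
  · intro α hα
    refine ⟨w α, hw α, ?_⟩
    rw [MvPolynomial.coeff_sum]
    simp only [MvPolynomial.coeff_monomial]
    rw [Finset.sum_ite_eq']
    split_ifs with h
    · rfl
    · have : w α = 0 := by
        simp only [w]; rw [if_pos (by simpa using h)]
      rw [this, map_zero]

lemma PP_succ_of_form (hker : RingHom.ker res = Ideal.span {π}) (n : ℕ) (f : MvPolynomial σ V)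
    (h : ∀ α, α.degree ≤ n → ∃ u, f.coeff α = π ^ (n - α.degree) * u ∧ res u = 0) :
    PP π (n + 1) f := by
  intro α
  by_cases hα : α.degree ≤ n
  · obtain ⟨u, hu, h0⟩ := h α hα
    have : u ∈ Ideal.span {π} := hker ▸ (RingHom.mem_ker.2 h0)
    obtain ⟨v, rfl⟩ := Ideal.mem_span_singleton.1 this
    rw [hu, show n + 1 - α.degree = (n - α.degree) + 1 by omega, pow_succ, ← mul_assoc]
    exact dvd_mul_right _ _
  · rw [Nat.sub_eq_zero_of_le (by omega)]; simp

lemma C_dvd_iff (hρ0 : ∀ x, ρ x = 0 ↔ τ (MvPolynomial.C (MvPolynomial.C π)) ∣ x) (G : Polynomial O) :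
    cc τ π ∣ G ↔ Polynomial.map ρ G = 0 := by
  simp only [RingHom.comp_apply, Polynomial.C_dvd_iff_dvd_coeff, ← hρ0, Polynomial.ext_iff, Polynomial.coeff_map,
    Polynomial.coeff_zero]

lemma cc_ne (hirr : Irreducible (τ (MvPolynomial.C (MvPolynomial.C π)))) : cc τ π ≠ 0 := by
  simp only [RingHom.comp_apply]
  simpa using hirr.ne_zero

lemma PP_iff (hker : RingHom.ker res = Ideal.span {π})
    (hρ : ∀ x, ρ (τ x) = algebraMap (MM k σ) _ (MvPolynomial.map (MvPolynomial.map res) x))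
    (hρ0 : ∀ x, ρ x = 0 ↔ τ (MvPolynomial.C (MvPolynomial.C π)) ∣ x)
    (hirr : Irreducible (τ (MvPolynomial.C (MvPolynomial.C π))))
    (n : ℕ) (f : MvPolynomial σ V) : PP π n f ↔ cc τ π ^ n ∣ Theta τ π f := by
  constructor
  · intro hf
    obtain ⟨G, g, h, _⟩ := form (ρ := ρ) hker hρ n f hf
    exact ⟨G, h⟩
  · intro hf
    induction n with
    | zero => exact PP_zero f
    | succ n ih =>
      have := ih (dvd_trans (pow_dvd_pow _ (Nat.le_succ n)) hf)
      obtain ⟨G, g, h1, h2, h3, h4⟩ := form (ρ := ρ) hker hρ n f this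
      rw [h1, pow_succ] at hf
      have h5 := (mul_dvd_mul_iff_left (pow_ne_zero n (cc_ne hirr))).1 hf
      rw [C_dvd_iff hρ0, h2, map_eq_zero_iff _ (phiK_injective k σ)] at h5
      subst h5
      exact PP_succ_of_form hker n f (by simpa using h4)

end Psi
end Izumi

end

section

namespace Izumi

/-- Order multiplicative and Lemma N. -/
def PropN (A : Type*) [CommRing A] (m : Ideal A) : Prop :=
  (∀ r s x y, x ∉ m ^ (r + 1) → y ∉ m ^ (s + 1) → x * y ∉ m ^ (r + s + 1)) ∧
  ∀ D K : ℕ, ∃ C : ℕ, ∀ (r n : ℕ) (c e : A) (a : ℕ → A), c ∈ m ^ r → c ∉ m ^ (r + 1) →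
    C * (r + 1) ≤ n →
    e ^ (D + 1) + ∑ i ∈ Finset.range (D + 1), a i * c ^ (i + 1) * e ^ (D - i) ∈ m ^ n →
    ∃ q, e - q * c ∈ m ^ (r + K)

section Main
variable {V k σ : Type*} [CommRing V] [IsDomain V] [Field k]
variable {O : Type*} [CommRing O] [IsDomain O]
variable {τ : MvPolynomial σ (MvPolynomial σ V) →+* O} {ρ : O →+* FractionRing (MM k σ)}
variable {π : V} {res : V →+* k}

lemma stepB (hπ : π ≠ 0) (hsurj : Function.Surjective res) (hker : RingHom.ker res = Ideal.span {π})
    (hρ : ∀ x, ρ (τ x) = algebraMap (MM k σ) _ (MvPolynomial.map (MvPolynomial.map res) x))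
    (hρ0 : ∀ x, ρ x = 0 ↔ τ (MvPolynomial.C (MvPolynomial.C π)) ∣ x)
    (hirr : Irreducible (τ (MvPolynomial.C (MvPolynomial.C π))))
    (hprime : Prime (cc τ π))
    (r j K : ℕ) (hj : j < K) (c e : MvPolynomial σ V) (hc : PP π r c) (hc' : ¬ PP π (r + 1) c)
    (he : PP π (r + j) e) (h' : Polynomial O)
    (hh : cc τ π ^ (r + K) ∣ Theta τ π e - scale (τ (MvPolynomial.C (MvPolynomial.C π))) h' * Theta τ π c) :
    ∃ Q, PP π (r + j + 1) (e - Q * c) := by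
  classical
  have ht0 := cc_ne hirr
  obtain ⟨E, ε, hE, hEε, -, -⟩ := form (ρ := ρ) hker hρ _ e he
  obtain ⟨G, γ, hG, hGγ, -, -⟩ := form (ρ := ρ) hker hρ _ c hc
  have hGt : ¬ cc τ π ∣ G := by
    intro h
    apply hc'
    rw [PP_iff hker hρ hρ0 hirr, hG, pow_succ]
    exact mul_dvd_mul_left _ h
  have hγ : γ ≠ 0 := by
    rintro rfl
    rw [map_zero] at hGγ
    exact hGt ((C_dvd_iff hρ0 G).2 hGγ)
  set H := scale (τ (MvPolynomial.C (MvPolynomial.C π))) h' with hH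
  obtain ⟨W, hW⟩ := hh
  rw [hE, hG] at hW
  obtain ⟨l, rfl⟩ : ∃ l, K = j + (l + 1) := ⟨K - j - 1, by omega⟩
  have e1 : H * G = cc τ π ^ j * (E - cc τ π ^ (l + 1) * W) := by
    apply mul_left_cancel₀ (pow_ne_zero r ht0)
    linear_combination (norm := (ring_nf)) -hW
  have e2 : cc τ π ^ j ∣ H := hprime.pow_dvd_of_dvd_mul_right j hGt ⟨_, e1⟩
  obtain ⟨h1, hh1⟩ := e2
  have e3 : G * h1 = E - cc τ π ^ (l + 1) * W := by
    apply mul_left_cancel₀ (pow_ne_zero j ht0)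
    rw [← e1, hh1]; ring
  have e4 : phiK k σ ε = phiK k σ γ * Polynomial.map ρ h1 := by
    rw [← hEε, ← hGγ, ← Polynomial.map_mul, e3]
    have : Polynomial.map ρ (cc τ π ^ (l + 1) * W) = 0 := by
      rw [← C_dvd_iff hρ0]
      exact Dvd.dvd.mul_right (dvd_pow_self _ (by omega)) _
    rw [Polynomial.map_sub, this, sub_zero]
  obtain ⟨δ, hδ⟩ := alg_main k σ ε γ hγ _ e4
  have hdeg : (Polynomial.map ρ h1).natDegree ≤ j := by
    rw [Polynomial.natDegree_le_iff_coeff_eq_zero]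
    intro i hi
    rw [Polynomial.coeff_map, hρ0]
    have e5 := congrArg (fun p => Polynomial.coeff p i) hh1
    simp only [hH, scale_coeff, RingHom.comp_apply, ← Polynomial.C_pow, Polynomial.coeff_C_mul] at e5
    obtain ⟨s, rfl⟩ : ∃ s, i = j + (s + 1) := ⟨i - j - 1, by omega⟩
    refine ⟨h'.coeff (j + (s + 1)) * τ (MvPolynomial.C (MvPolynomial.C π)) ^ s, ?_⟩
    apply mul_left_cancel₀ (pow_ne_zero j hirr.ne_zero)
    rw [← e5]; ring
  have hδdeg : ∀ α ∈ δ.support, α.degree ≤ j := fun α hα =>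
    (degree_le_natDegreeK k σ δ α hα).trans (hδ ▸ hdeg)
  obtain ⟨s, hs⟩ := hsurj.hasRightInverse
  let Q : MvPolynomial σ V := ∑ α ∈ δ.support, MvPolynomial.monomial α (π ^ (j - α.degree) * s (δ.coeff α))
  have hQc : ∀ α, Q.coeff α = π ^ (j - α.degree) * (if α ∈ δ.support then s (δ.coeff α) else 0) := by
    intro α
    simp only [Q, MvPolynomial.coeff_sum, MvPolynomial.coeff_monomial]
    rw [Finset.sum_ite_eq']
    split_ifs <;> simp
  have hQ : PP π j Q := fun α => ⟨_, hQc α⟩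
  obtain ⟨GQ, gQ, hGQ, hgQ, hz, hu⟩ := form (ρ := ρ) hker hρ _ Q hQ
  have hgδ : gQ = δ := by
    ext α
    by_cases hα : α.degree ≤ j
    · obtain ⟨u, hu1, hu2⟩ := hu α hα
      rw [hQc α] at hu1
      have := mul_left_cancel₀ (pow_ne_zero _ hπ) hu1
      rw [← hu2, ← this]
      split_ifs with h
      · exact hs _
      · rw [map_zero]; symm; simpa using h
    · rw [hz α (by omega)]
      symm
      by_contra h
      exact hα (hδdeg α (by simpa using h))
  refine ⟨Q, ?_⟩
  rw [PP_iff hker hρ hρ0 hirr, map_sub, map_mul, hE, hG, hGQ]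
  have e6 : cc τ π ∣ E - GQ * G := by
    rw [C_dvd_iff hρ0, Polynomial.map_sub, Polynomial.map_mul, hEε, hgQ, hGγ, e4, hgδ, hδ, mul_comm, sub_self]
  rw [pow_succ, show cc τ π ^ (r + j) * E - cc τ π ^ j * GQ * (cc τ π ^ r * G) = cc τ π ^ (r + j) * (E - GQ * G) by ring]
  exact mul_dvd_mul_left _ e6

end Main

theorem propN_poly {V k σ : Type*} [CommRing V] [IsDomain V] [IsNoetherianRing V] [Field k] [Finite σ]
    (π : V) (hπ : π ≠ 0) (res : V →+* k) (hsurj : Function.Surjective res)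
    (hker : RingHom.ker res = Ideal.span {π}) : PropN (MvPolynomial σ V) (MI σ π) := by
  classical
  obtain ⟨O, _, _, _, τ, ρ, hirr, hρ0, hρ, hinj⟩ := exists_O (σ := σ) π hπ res hker
  have hprime : Prime (cc τ π) := by
    simp only [RingHom.comp_apply]
    rw [Polynomial.prime_C_iff]
    exact hirr.prime
  set t := τ (MvPolynomial.C (MvPolynomial.C π)) with ht
  constructor
  · intro r s x y hx hy
    simp only [mem_MI_pow, PP_iff hker hρ hρ0 hirr, map_mul] at hx hy ⊢
    intro hxy
    obtain ⟨r', hr', hr1, hr2⟩ : ∃ r' ≤ r, cc τ π ^ r' ∣ Theta τ π x ∧ ¬ cc τ π ^ (r' + 1) ∣ Theta τ π x := by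
      have hex : ∃ i, ¬ cc τ π ^ (i + 1) ∣ Theta τ π x := ⟨r, hx⟩
      refine ⟨Nat.find hex, Nat.find_min' hex hx, ?_, Nat.find_spec hex⟩
      rcases hz : Nat.find hex with _ | i
      · simp
      · by_contra h
        have := Nat.find_min' hex h
        omega
    obtain ⟨s', hs', hs1, hs2⟩ : ∃ s' ≤ s, cc τ π ^ s' ∣ Theta τ π y ∧ ¬ cc τ π ^ (s' + 1) ∣ Theta τ π y := by
      have hex : ∃ i, ¬ cc τ π ^ (i + 1) ∣ Theta τ π y := ⟨s, hy⟩
      refine ⟨Nat.find hex, Nat.find_min' hex hy, ?_, Nat.find_spec hex⟩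
      rcases hz : Nat.find hex with _ | i
      · simp
      · by_contra h
        have := Nat.find_min' hex h
        omega
    have h1 : cc τ π ^ (r' + s' + 1) ∣ Theta τ π x * Theta τ π y := 
      dvd_trans (pow_dvd_pow _ (by omega)) hxy
    rcases succ_dvd_or_succ_dvd_of_succ_sum_dvd_mul hprime hr1 hs1 h1 with h | h
    · exact hr2 h
    · exact hs2 h
  · intro D K
    refine ⟨(D + 1) * ((K + 1) * (1 + (K + 1) * (K + 1))), ?_⟩
    intro r n c e a hc hc' hn he
    have he' := Psi_mem τ π n _ he
    simp only [map_add, map_sum, map_mul, map_pow] at he'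
    have hcP := Psi_mem τ π r _ hc
    have hcP' : Psi τ π c ∉ (Ideal.span {Polynomial.C t, Polynomial.X} : Ideal (Polynomial O)) ^ (r + 1) := by
      intro h
      have := scale_mem _ _ _ h
      rw [scale_Psi] at this
      exact hc' (mem_MI_pow.2 ((PP_iff hker hρ hρ0 hirr _ _).2 this))
    obtain ⟨h', hh'⟩ := twoD_O t hirr D K r n (Psi τ π c) (Psi τ π e) (fun i => Psi τ π (a i)) hcP hcP'
      (le_trans (by
        have : (D + 1) * ((K + 1) * (r * (1 + (K + 1) * (K + 1)))) = (D + 1) * ((K + 1) * (1 + (K + 1) * (K + 1))) * r := by ring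
        rw [this]
        exact Nat.mul_le_mul_left _ (Nat.le_succ r)) hn) he'
    have hfin : ∀ j ≤ K, ∃ q, PP π (r + j) (e - q * c) := by
      intro j
      induction j with
      | zero =>
        intro _
        refine ⟨0, ?_⟩
        rw [zero_mul, sub_zero, add_zero, PP_iff hker hρ hρ0 hirr]
        have h2 := scale_mem _ _ _ hh'
        rw [map_sub, map_mul, scale_Psi, scale_Psi] at h2
        have h3 := dvd_trans (pow_dvd_pow (Polynomial.C t) (Nat.le_add_right r K)) h2
        have h4 : cc τ π ^ r ∣ Theta τ π c := (PP_iff hker hρ hρ0 hirr _ _).1 (mem_MI_pow.1 hc)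
        have h5 := dvd_add h3 (Dvd.dvd.mul_left h4 (scale t h'))
        rwa [sub_add_cancel] at h5
      | succ j ih =>
        intro hj
        obtain ⟨q, hq⟩ := ih (by omega)
        obtain ⟨Q, hQ⟩ := stepB (ρ := ρ) hπ hsurj hker hρ hρ0 hirr hprime r j K (by omega) c (e - q * c)
          (mem_MI_pow.1 hc) (fun h => hc' (mem_MI_pow.2 h)) hq (h' - Psi τ π q) (by
            have h2 := scale_mem _ _ _ hh'
            rw [map_sub, map_mul, scale_Psi, scale_Psi] at h2
            refine dvd_trans (b := Theta τ π e - scale t h' * Theta τ π c) h2 (dvd_of_eq ?_)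
            rw [map_sub, map_mul, map_sub, scale_Psi]
            ring)
        refine ⟨q + Q, ?_⟩
        rw [add_mul, ← sub_sub]
        exact hQ
    obtain ⟨q, hq⟩ := hfin K le_rfl
    exact ⟨q, mem_MI_pow.2 hq⟩

end Izumi

end

section

namespace Izumi
section Adic
variable {A : Type*} [CommRing A] {I : Ideal A}

lemma haus_zero (h : IsHausdorff I A) (x : A) (hx : ∀ n, x ∈ I ^ n) : x = 0 :=
  h.haus x fun n => by
    rw [SModEq.zero, smul_eq_mul, Ideal.mul_top]; exact hx n

lemma haus_zero' (h : IsHausdorff I A) (x : A) (N : ℕ) (hx : ∀ n ≥ N, x ∈ I ^ n) : x = 0 :=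
  haus_zero h x fun n => Ideal.pow_le_pow_right (le_max_left n N) (hx _ (le_max_right n N))

lemma cauchy_le {f : ℕ → A} (hf : ∀ n, f (n + 1) - f n ∈ I ^ n) {m n : ℕ} (h : m ≤ n) :
    f n - f m ∈ I ^ m := by
  induction n, h using Nat.le_induction with
  | base => simp
  | succ n hmn ih =>
    have := Ideal.add_mem _ (Ideal.pow_le_pow_right hmn (hf n)) ih
    simpa using this

lemma prec_lim (h : IsPrecomplete I A) (f : ℕ → A) (hf : ∀ n, f (n + 1) - f n ∈ I ^ n) :
    ∃ L, ∀ n, L - f n ∈ I ^ n := by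
  obtain ⟨L, hL⟩ := h.prec (f := f) (fun {m n} hmn => by
    rw [SModEq.sub_mem, smul_eq_mul, Ideal.mul_top]
    have := cauchy_le hf hmn
    rw [← neg_mem_iff]; simpa using this)
  refine ⟨L, fun n => ?_⟩
  have := hL n
  rw [SModEq.sub_mem, smul_eq_mul, Ideal.mul_top] at this
  rw [← neg_mem_iff]; simpa using this

lemma isAdicComplete_of (h1 : ∀ x : A, (∀ n, x ∈ I ^ n) → x = 0)
    (h2 : ∀ f : ℕ → A, (∀ n, f (n + 1) - f n ∈ I ^ n) → ∃ L, ∀ n, L - f n ∈ I ^ n) :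
    IsAdicComplete I A := by
  have a1 : IsHausdorff I A := ⟨fun x hx => h1 x fun n => by
    simpa [SModEq.zero, smul_eq_mul, Ideal.mul_top] using hx n⟩
  have a2 : IsPrecomplete I A := ⟨fun f hf => by
    obtain ⟨L, hL⟩ := h2 f (fun n => by
      have := hf (Nat.le_succ n)
      rw [SModEq.sub_mem, smul_eq_mul, Ideal.mul_top] at this
      rw [← neg_mem_iff]; simpa using this)
    refine ⟨L, fun n => ?_⟩
    rw [SModEq.sub_mem, smul_eq_mul, Ideal.mul_top]
    rw [← neg_mem_iff]; simpa using hL n⟩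
  exact { a1, a2 with }

end Adic

/-- dense embedding of adic rings -/
structure Dense {P A : Type*} [CommRing P] [CommRing A] (M : Ideal P) (m : Ideal A) (ι : P →+* A) : Prop where
  comap : ∀ n x, ι x ∈ m ^ n ↔ x ∈ M ^ n
  dense : ∀ n a, ∃ x, a - ι x ∈ m ^ n

section Ext
variable {P A S : Type*} [CommRing P] [CommRing A] [CommRing S] {M : Ideal P} {m : Ideal A} {ι : P →+* A}

lemma Dense.extend (h : Dense M m ι) (J : Ideal S) [IsAdicComplete J S] (g : P →+* S)
    (hg : M ≤ J.comap g) :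
    ∃ G : A →+* S, G.comp ι = g ∧ (∀ n x, x ∈ m ^ n → G x ∈ J ^ n) := by
  classical
  have hgn : ∀ n x, x ∈ M ^ n → g x ∈ J ^ n := by
    intro n x hx
    have h1 := Ideal.mem_map_of_mem g hx
    rw [Ideal.map_pow] at h1
    exact Ideal.pow_right_mono (Ideal.map_le_iff_le_comap.2 hg) n h1
  choose ap hap using h.dense
  -- approximations
  have key : ∀ n a x, a - ι x ∈ m ^ n → ∀ k, n ≤ k → g (ap k a) - g x ∈ J ^ n := by
    intro n a x hx k hk
    rw [← map_sub]
    apply hgn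
    rw [← h.comap, map_sub]
    have h1 := Ideal.pow_le_pow_right hk (hap k a)
    have h2 := Ideal.sub_mem _ hx h1
    convert h2 using 1; ring
  have hc : ∀ a n, g (ap (n + 1) a) - g (ap n a) ∈ J ^ n := fun a n => key n a _ (hap n a) _ (Nat.le_succ n)
  choose L hL using fun a => prec_lim (I := J) inferInstance (fun n => g (ap n a)) (hc a)
  have key2 : ∀ n a x, a - ι x ∈ m ^ n → L a - g x ∈ J ^ n := by
    intro n a x hx
    have := Ideal.add_mem _ (hL a n) (key n a x hx n le_rfl)
    simpa using this
  have uniq : ∀ a y, (∀ n, ∃ x, a - ι x ∈ m ^ n ∧ y - g x ∈ J ^ n) → L a = y := by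
    intro a y hy
    rw [← sub_eq_zero]
    apply haus_zero (I := J) inferInstance
    intro n
    obtain ⟨x, hx1, hx2⟩ := hy n
    have := Ideal.sub_mem _ (key2 n a x hx1) hx2
    simpa using this
  have hcoe : ∀ x, L (ι x) = g x := fun x => uniq _ _ fun n => ⟨x, by simp, by simp⟩
  refine ⟨{ toFun := L, map_one' := ?_, map_mul' := ?_, map_zero' := ?_, map_add' := ?_ }, ?_, ?_⟩
  · rw [← map_one ι, hcoe, map_one]
  · intro a b
    refine uniq _ _ fun n => ⟨ap n a * ap n b, ?_, ?_⟩
    · rw [map_mul]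
      have : a * b - ι (ap n a) * ι (ap n b) = (a - ι (ap n a)) * b + ι (ap n a) * (b - ι (ap n b)) := by ring
      rw [this]
      exact Ideal.add_mem _ (Ideal.mul_mem_right _ _ (hap n a)) (Ideal.mul_mem_left _ _ (hap n b))
    · rw [map_mul]
      have : L a * L b - g (ap n a) * g (ap n b) = (L a - g (ap n a)) * L b + g (ap n a) * (L b - g (ap n b)) := by ring
      rw [this]
      exact Ideal.add_mem _ (Ideal.mul_mem_right _ _ (hL a n)) (Ideal.mul_mem_left _ _ (hL b n))
  · rw [← map_zero ι, hcoe, map_zero]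
  · intro a b
    refine uniq _ _ fun n => ⟨ap n a + ap n b, ?_, ?_⟩
    · rw [map_add]
      have := Ideal.add_mem _ (hap n a) (hap n b)
      convert this using 1; ring
    · rw [map_add]
      have := Ideal.add_mem _ (hL a n) (hL b n)
      convert this using 1; ring
  · ext x; exact hcoe x
  · intro n x hx
    have := key2 n x 0 (by simpa using hx)
    simpa using this

end Ext
end Izumi

end

section

namespace Izumi

lemma exists_ord {A : Type*} [CommRing A] {m : Ideal A} {r : ℕ} {x : A} (hx : x ∉ m ^ (r + 1)) :
    ∃ r' ≤ r, x ∈ m ^ r' ∧ x ∉ m ^ (r' + 1) := by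
  classical
  have hex : ∃ i, x ∉ m ^ (i + 1) := ⟨r, hx⟩
  refine ⟨Nat.find hex, Nat.find_min' hex hx, ?_, Nat.find_spec hex⟩
  rcases hz : Nat.find hex with _ | i
  · simp
  · by_contra h
    have := Nat.find_min' hex h
    omega

lemma mem_iff_of_sub_mem {A : Type*} [CommRing A] {I : Ideal A} {x y : A} (h : x - y ∈ I) :
    x ∈ I ↔ y ∈ I := by
  constructor
  · intro hx
    have := Ideal.sub_mem _ hx h
    simpa using this
  · intro hy
    have := Ideal.add_mem _ h hy
    simpa using this

lemma PropN.transfer {P A : Type*} [CommRing P] [CommRing A] {M : Ideal P} {m : Ideal A} {ι : P →+* A}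
    (h : Dense M m ι) (hP : PropN P M) : PropN A m := by
  classical
  have sm : ∀ (x y : A) (i j : ℕ), i ≤ j → x - y ∈ m ^ j → (x ∈ m ^ i ↔ y ∈ m ^ i) := 
    fun x y i j hij hxy => mem_iff_of_sub_mem (Ideal.pow_le_pow_right hij hxy)
  constructor
  · intro r s x y hx hy hxy
    obtain ⟨x', hx'⟩ := h.dense (r + s + 1) x
    obtain ⟨y', hy'⟩ := h.dense (r + s + 1) y
    rw [sm _ _ _ _ (by omega) hx', h.comap] at hx
    rw [sm _ _ _ _ (by omega) hy', h.comap] at hy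
    refine hP.1 r s x' y' hx hy ?_
    rw [← h.comap, map_mul, ← sm (x * y) _ _ (r + s + 1) le_rfl]
    · exact hxy
    · have : x * y - ι x' * ι y' = (x - ι x') * y + ι x' * (y - ι y') := by ring
      rw [this]
      exact Ideal.add_mem _ (Ideal.mul_mem_right _ _ hx') (Ideal.mul_mem_left _ _ hy')
  · intro D K
    obtain ⟨C, hC⟩ := hP.2 D K
    refine ⟨C, fun r n c e a hc hc' hn he => ?_⟩
    let N := n + r + K + 1
    obtain ⟨c', hcc⟩ := h.dense N c
    obtain ⟨e', hee⟩ := h.dense N e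
    choose a' haa using fun i => h.dense N (a i)
    rw [sm _ _ _ _ (by omega) hcc, h.comap] at hc hc'
    have hcq := (Ideal.Quotient.mk_eq_mk_iff_sub_mem _ _).2 hcc
    have heq := (Ideal.Quotient.mk_eq_mk_iff_sub_mem _ _).2 hee
    have haq := fun i => (Ideal.Quotient.mk_eq_mk_iff_sub_mem _ _).2 (haa i)
    obtain ⟨q, hq⟩ := hC r n c' e' a' hc hc' hn (by
      rw [← h.comap]
      refine (sm _ _ _ N (by omega) ?_).1 he
      rw [← Ideal.Quotient.mk_eq_mk_iff_sub_mem]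
      simp only [map_add, map_sum, map_mul, map_pow, hcq, heq, haq])
    refine ⟨ι q, ?_⟩
    rw [← h.comap] at hq
    refine (sm _ _ _ N (by omega) ?_).2 hq
    rw [← Ideal.Quotient.mk_eq_mk_iff_sub_mem]
    simp only [map_sub, map_mul, hcq, heq]

/-- equal characteristic version -/
theorem propN_poly_field {k σ : Type*} [Field k] [Finite σ] :
    PropN (MvPolynomial (Option σ) k) (MI (Option σ) (0 : k)) := by
  classical
  have h1 : PropN (MvPolynomial σ (Polynomial k)) (MI σ (Polynomial.X : Polynomial k)) := by
    refine propN_poly (k := k) Polynomial.X Polynomial.X_ne_zero Polynomial.constantCoeff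
      Polynomial.constantCoeff_surjective ?_
    ext x
    rw [RingHom.mem_ker, Ideal.mem_span_singleton, Polynomial.X_dvd_iff]
    rfl
  let E := (MvPolynomial.optionEquivRight k σ)
  have hmap : (MI σ (Polynomial.X : Polynomial k)).map (E.symm : _ →+* MvPolynomial (Option σ) k) = MI (Option σ) 0 := by
    have e1 : E.symm (MvPolynomial.C Polynomial.X) = MvPolynomial.X none := by
      rw [AlgEquiv.symm_apply_eq, MvPolynomial.optionEquivRight_X_none]
    have e2 : ∀ i, E.symm (MvPolynomial.X i) = MvPolynomial.X (some i) := fun i => by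
      rw [AlgEquiv.symm_apply_eq, MvPolynomial.optionEquivRight_X_some]
    rw [MI, MI, Ideal.map_span]
    apply le_antisymm
    · rw [Ideal.span_le]
      rintro _ ⟨x, (rfl | ⟨i, rfl⟩), rfl⟩
      · refine Ideal.subset_span (Or.inr ⟨none, e1.symm⟩)
      · refine Ideal.subset_span (Or.inr ⟨some i, (e2 i).symm⟩)
    · rw [Ideal.span_le]
      rintro _ (rfl | ⟨i, rfl⟩)
      · simp
      · rcases i with _ | i
        · exact Ideal.subset_span ⟨_, Or.inl rfl, e1⟩
        · exact Ideal.subset_span ⟨_, Or.inr ⟨i, rfl⟩, e2 i⟩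
  refine PropN.transfer (ι := (E.symm : _ →+* MvPolynomial (Option σ) k)) ⟨?_, ?_⟩ h1
  · intro n x
    rw [← hmap, ← Ideal.map_pow]
    constructor
    · intro hx
      have : (MI σ (Polynomial.X : Polynomial k) ^ n).map (E.symm.toRingEquiv : _ →+* MvPolynomial (Option σ) k) =
        (MI σ (Polynomial.X : Polynomial k) ^ n).map (E.symm : _ →+* MvPolynomial (Option σ) k) := rfl
      rw [← this] at hx
      have h3 := (Ideal.mem_map_of_equiv E.symm.toRingEquiv _).1 hx
      obtain ⟨y, hy, hyx⟩ := h3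
      rwa [← E.symm.injective hyx]
    · exact fun hx => Ideal.mem_map_of_mem _ hx
  · intro n a
    exact ⟨E a, by simp⟩

/-- the ideal `(π, X_i)` of the power series ring -/
noncomputable def MPI {V : Type*} (σ : Type*) [CommRing V] (π : V) : Ideal (MvPowerSeries σ V) :=
  Ideal.span (insert (MvPowerSeries.C π) (Set.range MvPowerSeries.X))

section PS
variable {V σ : Type*} [CommRing V]

def SS (π : V) (n : ℕ) (f : MvPowerSeries σ V) : Prop :=
  ∀ α, π ^ (n - α.degree) ∣ MvPowerSeries.coeff α f

lemma SS_add {π : V} {n : ℕ} {f g : MvPowerSeries σ V} (hf : SS π n f) (hg : SS π n g) :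
    SS π n (f + g) := fun α => by
  rw [map_add]; exact dvd_add (hf α) (hg α)

lemma SS_mul {π : V} {n m : ℕ} {f g : MvPowerSeries σ V} (hf : SS π n f) (hg : SS π m g) :
    SS π (n + m) (f * g) := fun α => by
  classical
  rw [MvPowerSeries.coeff_mul]
  refine Finset.dvd_sum fun x hx => ?_
  refine dvd_trans ?_ (mul_dvd_mul (hf x.1) (hg x.2))
  rw [← pow_add]
  apply pow_dvd_pow
  rw [Finset.HasAntidiagonal.mem_antidiagonal] at hx
  rw [← hx, map_add]
  omega

lemma SS_zero {π : V} (f : MvPowerSeries σ V) : SS π 0 f := fun α => by simp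

lemma MPI_le_SS {π : V} {f : MvPowerSeries σ V} (hf : f ∈ MPI σ π) : SS π 1 f := by
  classical
  refine Submodule.span_induction (p := fun f _ => SS π 1 f) ?_ ?_ ?_ ?_ hf
  · rintro x (rfl | ⟨i, rfl⟩) α
    · rw [MvPowerSeries.coeff_C]
      split_ifs with h
      · subst h; simp
      · simp
    · rw [MvPowerSeries.coeff_X]
      split_ifs with h
      · subst h; simp
      · simp
  · intro α; simp
  · intro x y _ _ hx hy; exact SS_add hx hy
  · intro a x _ hx
    simpa using SS_mul (SS_zero a) hx

lemma coe_MI_pow {π : V} {n : ℕ} {f : MvPolynomial σ V} (hf : f ∈ MI σ π ^ n) :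
    (f : MvPowerSeries σ V) ∈ MPI σ π ^ n := by
  have h1 := Ideal.mem_map_of_mem (MvPolynomial.coeToMvPowerSeries.ringHom) hf
  rw [Ideal.map_pow] at h1
  refine Ideal.pow_right_mono ?_ n h1
  rw [MI, Ideal.map_span, Ideal.span_le]
  rintro _ ⟨x, (rfl | ⟨i, rfl⟩), rfl⟩
  · refine Ideal.subset_span (Or.inl ?_)
    simp
  · refine Ideal.subset_span (Or.inr ⟨i, ?_⟩)
    simp

lemma mem_of_coeff_eq_zero [Finite σ] {n : ℕ} {f : MvPowerSeries σ V}
    (hf : ∀ α : σ →₀ ℕ, α.degree < n → MvPowerSeries.coeff α f = 0) :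
    f ∈ (Ideal.span (Set.range MvPowerSeries.X) : Ideal (MvPowerSeries σ V)) ^ n := by
  let E := MvPowerSeries.toAdicCompletionAlgEquiv σ V
  have h0 : MvPowerSeries.truncTotal n f = 0 := by
    ext α
    rw [MvPowerSeries.coeff_truncTotal_eq_ite]
    split_ifs with h
    · rw [hf α h]; simp
    · simp
  have h1 : E f ∈ MvPolynomial.idealOfVars σ V ^ n • (⊤ : Submodule (MvPolynomial σ V)
      (AdicCompletion (MvPolynomial.idealOfVars σ V) (MvPolynomial σ V))) := by
    rw [AdicCompletion.pow_smul_top_eq_ker_eval (MvPolynomial.idealOfVars_fg σ V), LinearMap.mem_ker]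
    change (MvPowerSeries.toAdicCompletion σ V f).val n = 0
    rw [MvPowerSeries.toAdicCompletion_apply_eq_mk_truncTotal, h0]
    rfl
  have h2 : ∀ x ∈ MvPolynomial.idealOfVars σ V ^ n • (⊤ : Submodule (MvPolynomial σ V)
      (AdicCompletion (MvPolynomial.idealOfVars σ V) (MvPolynomial σ V))), 
      E.symm x ∈ (Ideal.span (Set.range MvPowerSeries.X) : Ideal (MvPowerSeries σ V)) ^ n := by
    intro x hx
    refine Submodule.smul_induction_on hx ?_ ?_
    · intro r hr y _
      rw [map_smul, Algebra.smul_def]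
      refine Ideal.mul_mem_right _ _ ?_
      have h3 := Ideal.mem_map_of_mem (algebraMap (MvPolynomial σ V) (MvPowerSeries σ V)) hr
      rw [Ideal.map_pow, MvPolynomial.idealOfVars, Ideal.map_span, ← Set.range_comp] at h3
      have hX : (⇑(algebraMap (MvPolynomial σ V) (MvPowerSeries σ V)) ∘ MvPolynomial.X) = MvPowerSeries.X := by
        funext i
        exact MvPolynomial.coe_X i
      rw [hX] at h3
      exact h3
    · intro x y hx hy
      rw [map_add]; exact Ideal.add_mem _ hx hy
  simpa using h2 _ h1

lemma mem_MPI_pow [Finite σ] {π : V} {n : ℕ} {f : MvPowerSeries σ V} : f ∈ MPI σ π ^ n ↔ SS π n f := by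
  constructor
  · intro hf
    induction n generalizing f with
    | zero => exact SS_zero f
    | succ n ih =>
      rw [pow_succ] at hf
      refine Submodule.mul_induction_on hf ?_ ?_
      · intro a ha b hb
        exact SS_mul (ih ha) (MPI_le_SS hb)
      · intro a b ha hb; exact SS_add ha hb
  · intro hf
    have h1 : (MvPowerSeries.truncTotal n f : MvPowerSeries σ V) ∈ MPI σ π ^ n := by
      apply coe_MI_pow
      rw [mem_MI_pow]
      intro α
      rw [MvPowerSeries.coeff_truncTotal_eq_ite]
      split_ifs
      · exact hf α
      · simp
    have h2 : f - (MvPowerSeries.truncTotal n f : MvPowerSeries σ V) ∈ MPI σ π ^ n := by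
      refine Ideal.pow_right_mono ?_ n (mem_of_coeff_eq_zero (n := n) ?_)
      · exact Ideal.span_mono (Set.subset_insert _ _)
      · intro α hα
        rw [map_sub, MvPolynomial.coeff_coe, MvPowerSeries.coeff_truncTotal _ hα, sub_self]
    have := Ideal.add_mem _ h2 h1
    simpa using this

lemma dense_ps [Finite σ] (π : V) : Dense (MI σ π) (MPI σ π) (MvPolynomial.coeToMvPowerSeries.ringHom) := by
  constructor
  · intro n x
    rw [mem_MPI_pow, mem_MI_pow]
    simp [SS, PP]
  · intro n a
    refine ⟨MvPowerSeries.truncTotal n a, ?_⟩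
    rw [mem_MPI_pow]
    intro α
    rw [map_sub, MvPolynomial.coeToMvPowerSeries.ringHom_apply, MvPolynomial.coeff_coe, MvPowerSeries.coeff_truncTotal_eq_ite]
    split_ifs with h
    · simp
    · rw [Nat.sub_eq_zero_of_le (by omega)]; simp

lemma complete_ps [Finite σ] (π : V) [IsAdicComplete (Ideal.span {π}) V] :
    IsAdicComplete (MPI σ π) (MvPowerSeries σ V) := by
  have hp : ∀ n x, x ∈ Ideal.span {π} ^ n ↔ π ^ n ∣ x := fun n x => by
    rw [Ideal.span_singleton_pow, Ideal.mem_span_singleton]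
  apply isAdicComplete_of
  · intro f hf
    ext α
    rw [map_zero]
    apply haus_zero (I := Ideal.span {π}) inferInstance
    intro n
    rw [hp]
    have := mem_MPI_pow.1 (hf (n + α.degree)) α
    simpa using this
  · intro f hf
    have h1 : ∀ α : σ →₀ ℕ, ∃ L, ∀ n, L - MvPowerSeries.coeff α (f (n + α.degree)) ∈ Ideal.span {π} ^ n := by
      intro α
      apply prec_lim (I := Ideal.span {π}) inferInstance (fun n => MvPowerSeries.coeff α (f (n + α.degree)))
      intro n
      rw [hp, ← map_sub]
      have := mem_MPI_pow.1 (hf (n + α.degree)) α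
      rw [show n + 1 + α.degree = n + α.degree + 1 by omega]
      simpa using this
    choose L hL using h1
    let F : MvPowerSeries σ V := fun α => L α
    refine ⟨F, fun n => ?_⟩
    rw [mem_MPI_pow]
    intro α
    rw [map_sub]
    change _ ∣ L α - _
    by_cases hn : n ≤ α.degree
    · rw [Nat.sub_eq_zero_of_le hn]; simp
    · have := hL α (n - α.degree)
      rw [hp, show n - α.degree + α.degree = n by omega] at this
      exact this

end PS

theorem propN_ps_field {k σ : Type*} [Field k] [Finite σ] :
    PropN (MvPowerSeries (Option σ) k) (MPI (Option σ) (0 : k)) :=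
  PropN.transfer (dense_ps 0) propN_poly_field

theorem propN_ps {V k σ : Type*} [CommRing V] [IsDomain V] [IsNoetherianRing V] [Field k] [Finite σ]
    (π : V) (hπ : π ≠ 0) (res : V →+* k) (hsurj : Function.Surjective res)
    (hker : RingHom.ker res = Ideal.span {π}) : PropN (MvPowerSeries σ V) (MPI σ π) :=
  PropN.transfer (dense_ps π) (propN_poly π hπ res hsurj hker)

end Izumi

end

section

namespace Izumi

open Polynomial Filter

section
variable {A : Type*} [CommRing A] {m : Ideal A}

/-- multiplicativity of the order function -/
def Mult (A : Type*) [CommRing A] (m : Ideal A) : Prop :=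
  ∀ r s (x y : A), x ∉ m ^ (r + 1) → y ∉ m ^ (s + 1) → x * y ∉ m ^ (r + s + 1)

lemma Mult.mem_or {h : Mult A m} {r s : ℕ} {x y : A} (hxy : x * y ∈ m ^ (r + s)) :
    x ∈ m ^ r ∨ y ∈ m ^ s := by
  rcases r with _ | r
  · left; simp
  rcases s with _ | s
  · right; simp
  by_contra hcon
  push Not at hcon
  refine h r s x y hcon.1 hcon.2 (Ideal.pow_le_pow_right ?_ hxy)
  omega

lemma Mult.pow_not_mem (h : Mult A m) {r : ℕ} {c : A} (hc : c ∉ m ^ (r + 1)) (d : ℕ) (h1 : m ≠ ⊤) :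
    c ^ d ∉ m ^ (r * d + 1) := by
  induction d with
  | zero => simpa [Ideal.eq_top_iff_one] using h1
  | succ d ih =>
    rw [pow_succ c, mul_add, mul_one]
    exact h _ _ _ _ ih hc

lemma cluster (h : Mult A m) (h1 : m ≠ ⊤) (U : Ultrafilter ℕ) (L D : ℕ) (Φ : Polynomial A) (hΦ : Φ.Monic)
    (hD : Φ.natDegree = D) (q : ℕ → A) (hq : ∀ᶠ j in (U : Filter ℕ), Φ.eval (q j) ∈ m ^ (L * D + 1)) :
    ∃ a, ∀ᶠ j in (U : Filter ℕ), q j - a ∈ m ^ L := by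
  induction D generalizing Φ with
  | zero =>
    exfalso
    rw [hΦ.natDegree_eq_zero.1 hD] at hq
    obtain ⟨j, hj⟩ := hq.exists
    simp at hj
    exact h1 ((Ideal.eq_top_iff_one _).2 hj)
  | succ D ih =>
    obtain ⟨i, hi⟩ := hq.exists
    have hne : Nontrivial A := by
      by_contra hn
      rw [not_nontrivial_iff_subsingleton] at hn
      exact h1 (Subsingleton.elim _ _)
    have key : ∀ᶠ j in (U : Filter ℕ), q j - q i ∈ m ^ L ∨ (Φ /ₘ (X - C (q i))).eval (q j) ∈ m ^ (L * D + 1) := by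
      filter_upwards [hq] with j hj
      apply Mult.mem_or (h := h)
      have h3 := congrArg (eval (q j)) (X_sub_C_mul_divByMonic_eq_sub_modByMonic Φ (q i))
      simp only [eval_mul, eval_sub, eval_X, eval_C, modByMonic_X_sub_C_eq_C_eval] at h3
      rw [h3]
      have : L + (L * D + 1) = L * (D + 1) + 1 := by ring
      rw [this]
      exact Ideal.sub_mem _ hj hi
    rw [Ultrafilter.eventually_or] at key
    rcases key with key | key
    · exact ⟨q i, key⟩
    · refine ih _ ?_ ?_ key
      · have hd : 1 ≤ Φ.degree := by
          rw [degree_eq_natDegree hΦ.ne_zero, hD]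
          exact_mod_cast Nat.succ_le_succ (Nat.zero_le D)
        exact (leadingCoeff_divByMonic_of_monic (monic_X_sub_C (q i)) (by rwa [degree_X_sub_C])).trans hΦ
      · rw [natDegree_divByMonic _ (monic_X_sub_C _), hD]; simp

lemma approx_root (h : Mult A m) (h1 : m ≠ ⊤) (hc : IsAdicComplete m A) (Φ : Polynomial A) (hΦ : Φ.Monic)
    (hK : ∀ K, ∃ q, Φ.eval q ∈ m ^ K) : ∃ ρ, Φ.eval ρ = 0 := by
  choose q hq using hK
  have hU : ∀ K, ∀ᶠ j in (hyperfilter ℕ : Filter ℕ), K ≤ j := fun K => by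
    apply Nat.hyperfilter_le_atTop
    exact eventually_ge_atTop K
  have h2 : ∀ L, ∃ a, ∀ᶠ j in (hyperfilter ℕ : Filter ℕ), q j - a ∈ m ^ L := by
    intro L
    refine cluster h h1 (hyperfilter ℕ) L _ Φ hΦ rfl q ?_
    filter_upwards [hU (L * Φ.natDegree + 1)] with j hj
    exact Ideal.pow_le_pow_right hj (hq j)
  choose a ha using h2
  obtain ⟨ρ, hρ⟩ := prec_lim (I := m) hc.toIsPrecomplete a (by
    intro n
    obtain ⟨j, h3, h4⟩ := ((ha n).and (ha (n + 1))).exists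
    have := Ideal.sub_mem _ h3 (Ideal.pow_le_pow_right (Nat.le_succ n) h4)
    simpa using this)
  refine ⟨ρ, haus_zero (I := m) hc.toIsHausdorff _ fun L => ?_⟩
  obtain ⟨j, h3, h4⟩ := ((ha L).and (hU L)).exists
  have h5 : ρ - q j ∈ m ^ L := by
    have := Ideal.sub_mem _ (hρ L) h3
    simpa using this
  have h6 : Φ.eval ρ - Φ.eval (q j) ∈ m ^ L := Ideal.mem_of_dvd _ (sub_dvd_eval_sub ρ (q j) Φ) h5
  have := Ideal.add_mem _ h6 (Ideal.pow_le_pow_right h4 (hq j))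
  simpa using this

/-- The prime of null sequences -/
def Q (h : Mult A m) (h1 : m ≠ ⊤) (U : Ultrafilter ℕ) (N : ℕ → ℕ) : Ideal (ℕ → A) where
  carrier := {a | ∃ s : ℕ, ∀ᶠ j in (U : Filter ℕ), a j ∈ m ^ (N j / (s + 1))}
  add_mem' := by
    rintro a b ⟨s, hs⟩ ⟨t, ht⟩
    refine ⟨max s t, ?_⟩
    filter_upwards [hs, ht] with j h1 h2
    refine Ideal.add_mem _ (Ideal.pow_le_pow_right ?_ h1) (Ideal.pow_le_pow_right ?_ h2)
    · exact Nat.div_le_div_left (by omega) (by omega)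
    · exact Nat.div_le_div_left (by omega) (by omega)
  zero_mem' := ⟨0, by simp⟩
  smul_mem' := by
    rintro c a ⟨s, hs⟩
    refine ⟨s, ?_⟩
    filter_upwards [hs] with j h1
    exact Ideal.mul_mem_left _ _ h1

lemma mem_Q {h : Mult A m} {h1 : m ≠ ⊤} {U : Ultrafilter ℕ} {N : ℕ → ℕ} {a : ℕ → A} :
    a ∈ Q h h1 U N ↔ ∃ s : ℕ, ∀ᶠ j in (U : Filter ℕ), a j ∈ m ^ (N j / (s + 1)) := Iff.rfl

lemma not_mem_Q {h : Mult A m} {h1 : m ≠ ⊤} {U : Ultrafilter ℕ} {N : ℕ → ℕ} {a : ℕ → A} :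
    a ∉ Q h h1 U N ↔ ∀ s : ℕ, ∀ᶠ j in (U : Filter ℕ), a j ∉ m ^ (N j / (s + 1)) := by
  rw [mem_Q]
  push Not
  refine forall_congr' fun s => ?_
  rw [Ultrafilter.eventually_not]

lemma prime_Q (h : Mult A m) (h1 : m ≠ ⊤) (U : Ultrafilter ℕ) (N : ℕ → ℕ) (hN : Tendsto N U atTop) :
    (Q h h1 U N).IsPrime := by
  refine ⟨?_, ?_⟩
  · rw [Ne, Ideal.eq_top_iff_one]
    rw [not_mem_Q]
    intro s
    filter_upwards [hN.eventually (eventually_ge_atTop (s + 1))] with j hj hmem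
    apply h1
    rw [Ideal.eq_top_iff_one]
    have := Ideal.pow_le_pow_right (I := m) ((Nat.one_le_div_iff (by omega)).2 hj) hmem
    simpa using this
  · intro a b hab
    by_contra hcon
    push Not at hcon
    obtain ⟨s, hs⟩ := hab
    have h2 := not_mem_Q.1 hcon.1 (2 * (s + 1) - 1)
    have h3 := not_mem_Q.1 hcon.2 (2 * (s + 1) - 1)
    obtain ⟨j, hj1, hj2, hj3⟩ := (hs.and (h2.and h3)).exists
    rw [show 2 * (s + 1) - 1 + 1 = (s + 1) * 2 by omega, ← Nat.div_div_eq_div_mul] at hj2 hj3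
    rcases Mult.mem_or (h := h) (Ideal.pow_le_pow_right (show N j / (s + 1) / 2 + N j / (s + 1) / 2 ≤ N j / (s + 1) by omega) hj1) with h4 | h4
    · exact hj2 h4
    · exact hj3 h4

/-- homogenization -/
lemma homog_sub_mem {r K D : ℕ} {c e q : A} (a : ℕ → A) (hc : c ∈ m ^ r) (he : e - q * c ∈ m ^ (r + K))  :
    (e ^ (D + 1) + ∑ i ∈ Finset.range (D + 1), a i * c ^ (i + 1) * e ^ (D - i)) -
    ((q * c) ^ (D + 1) + ∑ i ∈ Finset.range (D + 1), a i * c ^ (i + 1) * (q * c) ^ (D - i)) ∈ m ^ (r * (D + 1) + K) := by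
  have hqc : q * c ∈ m ^ r := Ideal.mul_mem_left _ _ hc
  have he' : e ∈ m ^ r := by
    have := Ideal.add_mem _ (Ideal.pow_le_pow_right (Nat.le_add_right r K) he) hqc
    simpa using this
  have hp : ∀ d, e ^ (d + 1) - (q * c) ^ (d + 1) ∈ m ^ (r * (d + 1) + K) := by
    intro d
    rw [← geom_sum₂_mul, show r * (d + 1) + K = r * d + (r + K) by ring, pow_add]
    refine Ideal.mul_mem_mul (Ideal.sum_mem _ fun i hi => ?_) he
    have hi' : i ≤ d := by simpa [Nat.lt_succ_iff] using hi
    rw [show r * d = r * i + r * (d - i) by rw [← mul_add]; congr 1; omega, pow_add, pow_mul, pow_mul,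
      show d + 1 - 1 - i = d - i by omega]
    exact Ideal.mul_mem_mul (Ideal.pow_mem_pow he' _) (Ideal.pow_mem_pow hqc _)
  rw [add_sub_add_comm, ← Finset.sum_sub_distrib]
  refine Ideal.add_mem _ (hp D) (Ideal.sum_mem _ fun i hi => ?_)
  have hi' : i ≤ D := by simpa [Nat.lt_succ_iff] using hi
  rw [← mul_sub]
  rcases Nat.eq_zero_or_pos (D - i) with h0 | h0
  · rw [h0]; simp
  · obtain ⟨d, hd⟩ := Nat.exists_eq_succ_of_ne_zero h0.ne'
    rw [hd, mul_assoc]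
    refine Ideal.mul_mem_left _ _ ?_
    rw [show r * (D + 1) + K = r * (i + 1) + (r * (d + 1) + K) by
      rw [← add_assoc, ← mul_add]; congr 2; omega, pow_add, pow_mul]
    exact Ideal.mul_mem_mul (Ideal.pow_mem_pow hc _) (hp d)

lemma homog_eval (Φ : Polynomial A) (hΦ : Φ.Monic) {D : ℕ} (hD : Φ.natDegree = D + 1) (q c : A) :
    ((q * c) ^ (D + 1) + ∑ i ∈ Finset.range (D + 1), Φ.coeff (D - i) * c ^ (i + 1) * (q * c) ^ (D - i)) =
      c ^ (D + 1) * Φ.eval q := by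
  have hlc : Φ.coeff (D + 1) = 1 := by rw [← hD]; exact hΦ.coeff_natDegree
  rw [eval_eq_sum_range, hD, Finset.sum_range_succ _ (D + 1), hlc,
    ← Finset.sum_range_reflect (fun i => Φ.coeff i * q ^ i), mul_add, Finset.mul_sum, add_comm]
  congr 1
  · refine Finset.sum_congr rfl fun i hi => ?_
    have hi' : i ≤ D := by simpa [Nat.lt_succ_iff] using hi
    rw [show D + 1 - 1 - i = D - i by omega, mul_pow, show D + 1 = (i + 1) + (D - i) by omega, pow_add]
    ring
  · ring

end

section Fr
variable {A : Type*} [CommRing A] {m : Ideal A} (h : Mult A m) (h1 : m ≠ ⊤) (U : Ultrafilter ℕ) (N : ℕ → ℕ)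
  {F : Type*} [Field F] (τ : (ℕ → A) →+* F)

lemma approx_of_root (hP : PropN A m) (hH : IsHausdorff m A)
    (hker : ∀ a, τ a = 0 ↔ a ∈ Q h h1 U N) (θ : F) (e c : ℕ → A)
    (hc0 : τ c ≠ 0) (hθ : θ * τ c = τ e)
    (Φ : Polynomial A) (hΦ : Φ.Monic) {D : ℕ} (hD : Φ.natDegree = D + 1)
    (hroot : Φ.eval₂ (τ.comp (Pi.constRingHom ℕ A)) θ = 0) (K : ℕ) : ∃ q, Φ.eval q ∈ m ^ K := by
  have hmem : (e ^ (D + 1) + ∑ i ∈ Finset.range (D + 1), (fun _ => Φ.coeff (D - i)) * c ^ (i + 1) * e ^ (D - i)) ∈ Q h h1 U N := by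
    rw [← hker, map_add, map_sum, map_pow, ← hθ]
    simp only [map_mul, map_pow, ← hθ]
    have h3 := homog_eval (Φ.map (τ.comp (Pi.constRingHom ℕ A))) (hΦ.map _) (D := D)
      (by rw [hΦ.natDegree_map, hD]) θ (τ c)
    rw [eval_map, hroot, mul_zero] at h3
    simp only [coeff_map] at h3
    exact h3
  obtain ⟨s, hs⟩ := hmem
  obtain ⟨C, hC⟩ := hP.2 D (K + 1)
  have hcQ : c ∉ Q h h1 U N := by rwa [← hker]
  let C' := C + (D + 1 + (K + 1))
  have h4 := not_mem_Q.1 hcQ (C' * (s + 1) - 1)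
  obtain ⟨j, hj1, hj2⟩ := (hs.and h4).exists
  rw [show C' * (s + 1) - 1 + 1 = (s + 1) * C' by
    have : 0 < C' * (s + 1) := by positivity
    rw [mul_comm (s + 1)]; omega, ← Nat.div_div_eq_div_mul] at hj2
  have hcj : c j ≠ 0 := by
    intro h0
    rw [h0] at hj2
    exact hj2 (Ideal.zero_mem _)
  obtain ⟨r0, hr0⟩ : ∃ r0, c j ∉ m ^ (r0 + 1) := by
    by_contra hcon
    push Not at hcon
    exact hcj (haus_zero hH _ fun n => Ideal.pow_le_pow_right (Nat.le_succ n) (hcon n))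
  obtain ⟨r, -, hr1, hr2⟩ := exists_ord hr0
  have hr3 : r + 1 ≤ N j / (s + 1) / C' := by
    by_contra hcon
    exact hj2 (Ideal.pow_le_pow_right (by omega) hr1)
  have hr4 : (r + 1) * C' ≤ N j / (s + 1) := (Nat.mul_le_mul_right _ hr3).trans (Nat.div_mul_le_self _ _)
  have hj3 : (e j) ^ (D + 1) + ∑ i ∈ Finset.range (D + 1), Φ.coeff (D - i) * (c j) ^ (i + 1) * (e j) ^ (D - i) ∈ m ^ (N j / (s + 1)) := by
    simpa using hj1
  obtain ⟨q, hq⟩ := hC r (N j / (s + 1)) (c j) (e j) (fun i => Φ.coeff (D - i)) hr1 hr2 (by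
    refine le_trans ?_ hr4
    rw [mul_comm]; exact Nat.mul_le_mul_left _ (Nat.le_add_right _ _)) hj3
  refine ⟨q, ?_⟩
  have h6 := homog_sub_mem (fun i => Φ.coeff (D - i)) (D := D) hr1 hq
  rw [homog_eval Φ hΦ hD] at h6
  have h7 : c j ^ (D + 1) * eval q Φ ∈ m ^ (r * (D + 1) + (K + 1)) := by
    have h8 : r * (D + 1) + (K + 1) ≤ N j / (s + 1) := by
      refine le_trans ?_ hr4
      simp only [C']
      nlinarith
    have := Ideal.sub_mem _ (Ideal.pow_le_pow_right h8 hj3) h6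
    simpa using this
  rw [show r * (D + 1) + (K + 1) = (r * (D + 1) + 1) + K by ring] at h7
  rcases Mult.mem_or (h := h) h7 with h8 | h8
  · exact absurd h8 (h.pow_not_mem hr2 _ h1)
  · exact h8

lemma root_in (hP : PropN A m) (hH : IsAdicComplete m A) 
    (hker : ∀ a, τ a = 0 ↔ a ∈ Q h h1 U N) (hfrac : ∀ θ : F, ∃ e c, τ c ≠ 0 ∧ θ * τ c = τ e)
    (θ : F) (D : ℕ) (Φ : Polynomial A) (hΦ : Φ.Monic) (hD : Φ.natDegree = D)
    (hroot : Φ.eval₂ (τ.comp (Pi.constRingHom ℕ A)) θ = 0) : ∃ ρ : A, θ = τ (fun _ => ρ) := by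
  induction D generalizing Φ with
  | zero =>
    rw [hΦ.natDegree_eq_zero.1 hD] at hroot
    simp at hroot
  | succ D ih =>
    have hne : Nontrivial A := by
      by_contra hn
      rw [not_nontrivial_iff_subsingleton] at hn
      exact h1 (Subsingleton.elim _ _)
    obtain ⟨e, c, hc0, hθ⟩ := hfrac θ
    obtain ⟨ρ, hρ⟩ := approx_root h h1 hH Φ hΦ (approx_of_root h h1 U N τ hP hH.toIsHausdorff hker θ e c hc0 hθ Φ hΦ hD hroot)
    have h3 := mul_divByMonic_eq_iff_isRoot.2 (show IsRoot Φ ρ from hρ)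
    rw [← h3, eval₂_mul] at hroot
    rcases mul_eq_zero.1 hroot with h4 | h4
    · refine ⟨ρ, ?_⟩
      simp at h4
      exact sub_eq_zero.1 h4
    · refine ih _ ?_ ?_ h4
      · have hd : 1 ≤ Φ.degree := by
          rw [degree_eq_natDegree hΦ.ne_zero, hD]
          exact_mod_cast Nat.succ_le_succ (Nat.zero_le D)
        exact (leadingCoeff_divByMonic_of_monic (monic_X_sub_C ρ) (by rwa [degree_X_sub_C])).trans hΦ
      · rw [natDegree_divByMonic _ (monic_X_sub_C _), hD]; simp

end Fr
end Izumi

end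

section

namespace Izumi

open Polynomial TensorProduct

lemma irreducible_map_of_closed {K F : Type*} [Field K] [Field F] [Algebra K F]
    (hcl : ∀ θ : F, IsIntegral K θ → θ ∈ (algebraMap K F).range) {f : Polynomial K} (hf : f.Monic)
    (hirr : Irreducible f) : Irreducible (f.map (algebraMap K F)) := by
  have hlift : ∀ g : Polynomial F, g.Monic → g ∣ f.map (algebraMap K F) → ∃ g' : Polynomial K, g'.map (algebraMap K F) = g := by
    intro g hg hd
    have h1 := integralClosure.mem_lifts_of_monic_of_dvd_map F hf hg hd
    have : g ∈ lifts (algebraMap K F) := by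
      rw [lifts_iff_coeff_lifts] at h1 ⊢
      intro n
      obtain ⟨y, hy⟩ := h1 n
      rw [← hy]
      exact hcl _ y.2
    exact (mem_lifts _).1 this
  rw [(hf.map _).irreducible_iff_natDegree]
  refine ⟨?_, ?_⟩
  · intro h
    have : f = 1 := Polynomial.map_injective _ (algebraMap K F).injective (by rw [h, Polynomial.map_one])
    exact hirr.not_isUnit (this ▸ isUnit_one)
  · intro u v hu hv huv
    obtain ⟨u', rfl⟩ := hlift u hu (Dvd.intro _ huv)
    obtain ⟨v', rfl⟩ := hlift v hv (Dvd.intro_left _ huv)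
    rw [← Polynomial.map_mul] at huv
    have h2 := Polynomial.map_injective _ (algebraMap K F).injective huv
    rw [natDegree_map, natDegree_map]
    rcases hirr.isUnit_or_isUnit h2.symm with h3 | h3
    · left; exact natDegree_eq_zero_of_isUnit h3
    · right; exact natDegree_eq_zero_of_isUnit h3

theorem tensor_domain {K F L : Type*} [Field K] [Field F] [Field L] [Algebra K F] [Algebra K L]
    [FiniteDimensional K L] (p : ℕ) [ExpChar K p]
    (hcl : ∀ θ : F, IsIntegral K θ → θ ∈ (algebraMap K F).range)
    (hred : ∀ n (x : F ⊗[K] L), x ^ (p ^ n) = 0 → x = 0) (x y : F ⊗[K] L) (hxy : x * y = 0) :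
    x = 0 ∨ y = 0 := by
  let Ls := separableClosure K L
  obtain ⟨α, hα⟩ := Field.exists_primitive_element K Ls
  let n := IsPurelyInseparable.exponent Ls L
  have hn : ∀ z : L, ∃ w : Ls, (w : L) = z ^ p ^ n := by
    intro z
    haveI : ExpChar Ls p := expChar_of_injective_algebraMap (algebraMap K Ls).injective p
    obtain ⟨w, hw⟩ := IsPurelyInseparable.exponent_def' (K := Ls) p z
    exact ⟨w, hw⟩
  let ev : Polynomial F →ₐ[F] F ⊗[K] L := aeval ((1 : F) ⊗ₜ[K] (α : L))
  have hev : ∀ P : Polynomial K, ev (P.map (algebraMap K F)) = 1 ⊗ₜ[K] ((aeval α P : Ls) : L) := by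
    intro P
    have h1 : ((aeval α P : Ls) : L) = aeval (α : L) P := by
      exact (Polynomial.aeval_algebraMap_apply L α P).symm
    rw [h1]
    simp only [ev, aeval_map_algebraMap]
    exact (Polynomial.aeval_algHom_apply (Algebra.TensorProduct.includeRight : L →ₐ[K] F ⊗[K] L) (α : L) P)
  have hαint : IsIntegral K α := Algebra.IsIntegral.isIntegral α
  have hirr := irreducible_map_of_closed hcl (minpoly.monic hαint) (minpoly.irreducible hαint)
  have hker : RingHom.ker ev.toRingHom = Ideal.span {(minpoly K α).map (algebraMap K F)} := by
    have hmax := PrincipalIdealRing.isMaximal_of_irreducible hirr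
    symm
    apply hmax.eq_of_le
    · exact RingHom.ker_ne_top _
    · rw [Ideal.span_singleton_le_iff_mem]
      change ev _ = 0
      rw [hev]; simp
  have hprime : ∀ P Q, ev P * ev Q = 0 → ev P = 0 ∨ ev Q = 0 := by
    intro P Q hPQ
    have hp : (RingHom.ker ev.toRingHom).IsPrime := by
      rw [hker]
      exact (PrincipalIdealRing.isMaximal_of_irreducible hirr).isPrime
    exact hp.mem_or_mem (show P * Q ∈ _ by
      change ev (P * Q) = 0
      rw [map_mul, hPQ])
  haveI : ExpChar (F ⊗[K] L) p := expChar_of_injective_algebraMap (algebraMap K (F ⊗[K] L)).injective p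
  have hrange : ∀ x : F ⊗[K] L, ∃ P, ev P = x ^ p ^ n := by
    intro x
    induction x using TensorProduct.induction_on with
    | zero => exact ⟨0, by rw [map_zero, zero_pow]; exact pow_ne_zero _ (expChar_pos K p).ne'⟩
    | tmul g l =>
      obtain ⟨w, hw⟩ := hn l
      have hw2 : w ∈ IntermediateField.adjoin K {α} := by rw [hα]; trivial
      rw [← IntermediateField.mem_toSubalgebra, IntermediateField.adjoin_simple_toSubalgebra_of_isAlgebraic (Algebra.IsAlgebraic.isAlgebraic α), Algebra.adjoin_singleton_eq_range_aeval] at hw2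
      obtain ⟨P, hP⟩ := hw2
      refine ⟨(g ^ p ^ n) • P.map (algebraMap K F), ?_⟩
      rw [map_smul, hev]
      have hP' : aeval α P = w := hP
      rw [hP', hw, Algebra.TensorProduct.tmul_pow, TensorProduct.smul_tmul', smul_eq_mul, mul_one]
    | add x y hx hy =>
      obtain ⟨P, hP⟩ := hx
      obtain ⟨Q, hQ⟩ := hy
      exact ⟨P + Q, by rw [map_add, hP, hQ, add_pow_expChar_pow]⟩
  obtain ⟨P, hP⟩ := hrange x
  obtain ⟨Q, hQ⟩ := hrange y
  have h1 : ev P * ev Q = 0 := by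
    rw [hP, hQ, ← mul_pow, hxy, zero_pow]; exact pow_ne_zero _ (expChar_pos K p).ne'
  rcases hprime P Q h1 with h2 | h2
  · left; exact hred n x (hP ▸ h2)
  · right; exact hred n y (hQ ▸ h2)

end Izumi

end

section

namespace Izumi

open Polynomial TensorProduct Filter

def HasPsi (A : Type*) [CommRing A] (m : Ideal A) (q : ℕ) : Prop :=
  ∀ f : A, f ≠ 0 → ∃ ψ : A →+ A, ψ f ≠ 0 ∧ (∀ g f, ψ (g ^ q * f) = g * ψ f) ∧
    ∃ C ≥ 1, ∀ n, ∀ f ∈ m ^ (C * (n + 1)), ψ f ∈ m ^ n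

lemma hasPsi_one (A : Type*) [CommRing A] (m : Ideal A) : HasPsi A m 1 := by
  intro f hf
  refine ⟨AddMonoidHom.id A, hf, by simp, 1, le_rfl, fun n f hf => ?_⟩
  exact Ideal.pow_le_pow_right (by omega) hf

section
variable {A : Type*} [CommRing A] [IsDomain A] {m : Ideal A} (h : Mult A m) (h1 : m ≠ ⊤) (U : Ultrafilter ℕ) (N : ℕ → ℕ)
  {K F L : Type*} [Field K] [Field F] [Field L] [Algebra A K] [IsFractionRing A K] [Algebra K F] [Algebra A F]
  [IsScalarTower A K F] [Algebra K L] [FiniteDimensional K L]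
  (τ : (ℕ → A) →+* F)

lemma closed_in (hτ : ∀ a, τ (fun _ => a) = algebraMap A F a) (hP : PropN A m) (hH : IsAdicComplete m A) (hker : ∀ a, τ a = 0 ↔ a ∈ Q h h1 U N)
   (hfrac : ∀ θ : F, ∃ e c, τ c ≠ 0 ∧ θ * τ c = τ e) (θ : F) (hθ : IsIntegral K θ) :
    θ ∈ (algebraMap K F).range := by
  obtain ⟨⟨d, hd⟩, hintg⟩ := IsIntegral.exists_multiple_integral_of_isLocalization (nonZeroDivisors A) θ hθ
  obtain ⟨Φ, hΦ, hroot⟩ := hintg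
  have hc : τ.comp (Pi.constRingHom ℕ A) = algebraMap A F := RingHom.ext hτ
  rw [← hc] at hroot
  obtain ⟨ρ, hρ⟩ := root_in h h1 U N τ hP hH hker hfrac _ _ Φ hΦ rfl hroot
  have hd0 : algebraMap A F d ≠ 0 := by
    rw [IsScalarTower.algebraMap_apply A K F]
    simp only [ne_eq, FaithfulSMul.algebraMap_eq_zero_iff]
    exact nonZeroDivisors.ne_zero hd
  refine ⟨algebraMap A K ρ / algebraMap A K d, ?_⟩
  rw [map_div₀, ← IsScalarTower.algebraMap_apply, ← IsScalarTower.algebraMap_apply]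
  rw [hτ, Submonoid.smul_def, Algebra.smul_def] at hρ
  rw [← hρ]
  field_simp

lemma psi_mem (hτ : ∀ a, τ (fun _ => a) = algebraMap A F a) (hker : ∀ a, τ a = 0 ↔ a ∈ Q h h1 U N)
    {q : ℕ} {ψ : A →+ A} (hlin : ∀ g f, ψ (g ^ q * f) = g * ψ f)
    {C : ℕ} (hC1 : C ≥ 1) (hC : ∀ n, ∀ f ∈ m ^ (C * (n + 1)), ψ f ∈ m ^ n) {ι : Type*} [Fintype ι]
    (e : ι → ℕ → A) (a : ι → A) (hsum : ∑ i, τ (e i) ^ q * algebraMap A F (a i) = 0) :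
    ∑ i, τ (e i) * algebraMap A F (ψ (a i)) = 0 := by
  simp only [← hτ, ← map_pow, ← map_mul, ← map_sum] at hsum ⊢
  rw [hker] at hsum ⊢
  obtain ⟨s, hs⟩ := hsum
  refine ⟨(s + 1) * (2 * C) - 1, ?_⟩
  filter_upwards [hs] with j hj
  have h2 : (∑ i, e i * (fun _ => ψ (a i) : ℕ → A) : ℕ → A) j = ψ ((∑ i, e i ^ q * (fun _ => a i : ℕ → A) : ℕ → A) j) := by
    simp [hlin]
  rw [h2, show (s + 1) * (2 * C) - 1 + 1 = (s + 1) * (2 * C) by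
    have : 0 < (s + 1) * (2 * C) := by positivity
    omega, ← Nat.div_div_eq_div_mul]
  generalize N j / (s + 1) = M at hj
  rcases Nat.eq_zero_or_pos (M / (2 * C)) with h0 | h0
  · rw [h0]; simp
  · apply hC
    refine Ideal.pow_le_pow_right ?_ hj
    have := Nat.mul_div_le M (2 * C)
    nlinarith

lemma reduced_tensor (hτ : ∀ a, τ (fun _ => a) = algebraMap A F a) (hker : ∀ a, τ a = 0 ↔ a ∈ Q h h1 U N)
    (hfrac : ∀ θ : F, ∃ e c, τ c ≠ 0 ∧ θ * τ c = τ e)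
    {p : ℕ} [ExpChar K p] {n : ℕ} (hpsi : HasPsi A m (p ^ n)) (x : F ⊗[K] L) (hx : x ^ (p ^ n) = 0) : x = 0 := by
  classical
  haveI : ExpChar F p := expChar_of_injective_algebraMap (algebraMap K F).injective p
  haveI : ExpChar L p := expChar_of_injective_algebraMap (algebraMap K L).injective p
  haveI : ExpChar (F ⊗[K] L) p := expChar_of_injective_algebraMap (algebraMap K (F ⊗[K] L)).injective p
  have hq : p ^ n ≠ 0 := pow_ne_zero _ (expChar_pos K p).ne'
  let b := Module.finBasis K L
  let B := Algebra.TensorProduct.basis F b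
  let g := fun i => B.repr x i
  have hxg : x = ∑ i, g i ⊗ₜ[K] b i := by
    conv_lhs => rw [← B.sum_repr x]
    refine Finset.sum_congr rfl fun i _ => ?_
    rw [Algebra.TensorProduct.basis_apply, TensorProduct.smul_tmul', smul_eq_mul, mul_one]
  -- the relation
  let κ := fun i l => b.repr (b i ^ p ^ n) l
  have hκ : ∀ i, b i ^ p ^ n = ∑ l, κ i l • b l := fun i => (b.sum_repr _).symm
  have hrel : ∀ l, ∑ i, g i ^ p ^ n * algebraMap K F (κ i l) = 0 := by
    have h3 : x ^ p ^ n = ∑ l, (∑ i, g i ^ p ^ n * algebraMap K F (κ i l)) • B l := by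
      rw [hxg, sum_pow_char_pow]
      simp only [Algebra.TensorProduct.tmul_pow]
      simp only [Finset.sum_smul]
      rw [Finset.sum_comm]
      refine Finset.sum_congr rfl fun i _ => ?_
      rw [hκ i, TensorProduct.tmul_sum]
      refine Finset.sum_congr rfl fun l _ => ?_
      rw [Algebra.TensorProduct.basis_apply, TensorProduct.smul_tmul', smul_eq_mul, mul_one, mul_comm,
        ← Algebra.smul_def, TensorProduct.smul_tmul]
    rw [hx] at h3
    have := (Fintype.linearIndependent_iff.1 B.linearIndependent) _ h3.symm
    exact this
  -- clear denominators
  obtain ⟨⟨d, hd⟩, hdint⟩ := IsLocalization.exist_integer_multiples_of_finite (nonZeroDivisors A) (fun il : _ × _ => κ il.1 il.2)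
  choose a0 ha0 using hdint
  let a := fun i l => a0 (i, l)
  have ha : ∀ i l, algebraMap A K (a i l) = algebraMap A K d * κ i l := by
    intro i l
    have := ha0 (i, l)
    rw [Algebra.smul_def] at this
    exact this
  have hd0 : algebraMap A K d ≠ 0 := by
    simp only [ne_eq, FaithfulSMul.algebraMap_eq_zero_iff]
    exact nonZeroDivisors.ne_zero hd
  have hrel2 : ∀ l, ∑ i, g i ^ p ^ n * algebraMap A F (a i l) = 0 := by
    intro l
    have := congrArg (fun z => algebraMap K F (algebraMap A K d) * z) (hrel l)
    simp only [mul_zero, Finset.mul_sum] at this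
    rw [← this]
    refine Finset.sum_congr rfl fun i _ => ?_
    rw [IsScalarTower.algebraMap_apply A K F, ha, map_mul]
    ring
  -- common denominators for g
  choose e c hc0 hec using fun i => hfrac (g i)
  let c' := ∏ i, c i
  have hc' : τ c' ≠ 0 := by
    simp only [c', map_prod]
    exact Finset.prod_ne_zero_iff.2 fun i _ => hc0 i
  let e' := fun i => e i * ∏ l ∈ Finset.univ.erase i, c l
  have hec' : ∀ i, τ (e' i) = g i * τ c' := by
    intro i
    simp only [e', c', map_mul, ← hec, ← Finset.mul_prod_erase Finset.univ c (Finset.mem_univ i)]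
    ring
  -- admissible psi
  let Adm : Set (A →+ A) := {ψ | (∀ g f, ψ (g ^ (p ^ n) * f) = g * ψ f) ∧ ∃ C ≥ 1, ∀ n, ∀ f ∈ m ^ (C * (n + 1)), ψ f ∈ m ^ n}
  have hvan : ∀ ψ ∈ Adm, ∀ l, ∑ i, g i * algebraMap A F (ψ (a i l)) = 0 := by
    rintro ψ ⟨hlin, C, hC1, hC⟩ l
    have := psi_mem h h1 U N τ hτ hker hlin hC1 hC e' (fun i => a i l) (by
      have := congrArg (fun z => τ c' ^ p ^ n * z) (hrel2 l)
      simp only [mul_zero, Finset.mul_sum] at this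
      rw [← this]
      refine Finset.sum_congr rfl fun i _ => ?_
      rw [hec', mul_pow]; ring)
    apply mul_left_cancel₀ hc'
    rw [mul_zero, ← this, Finset.mul_sum]
    refine Finset.sum_congr rfl fun i _ => ?_
    rw [hec']; ring
  -- span
  let W : Submodule K (Fin (Module.finrank K L) → K) := Submodule.span K {v | ∃ ψ ∈ Adm, ∃ l, v = fun i => algebraMap A K (ψ (a i l))}
  have hW : W = ⊤ := by
    by_contra hne
    obtain ⟨φ, hφ0, hφ⟩ := Submodule.exists_le_ker_of_lt_top W (lt_top_iff_ne_top.2 hne)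
    let η := fun i => φ (Pi.single i 1)
    have hη : ∀ v, φ v = ∑ i, v i * η i := by
      intro v
      conv_lhs => rw [← Finset.univ_sum_single v, map_sum]
      refine Finset.sum_congr rfl fun i _ => ?_
      rw [← smul_eq_mul, ← map_smul, ← Pi.single_smul, smul_eq_mul, mul_one]
    obtain ⟨⟨u, hu⟩, huint⟩ := IsLocalization.exist_integer_multiples_of_finite (nonZeroDivisors A) η
    choose w hw using huint
    have hw' : ∀ i, algebraMap A K (w i) = algebraMap A K u * η i := by
      intro i
      have := hw i
      rw [Algebra.smul_def] at this
      exact this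
    have hu0 : algebraMap A K u ≠ 0 := by
      simp only [ne_eq, FaithfulSMul.algebraMap_eq_zero_iff]
      exact nonZeroDivisors.ne_zero hu
    have h5 : ∀ l, ∑ i, w i ^ (p ^ n) * a i l = 0 := by
      intro l
      by_contra hne0
      obtain ⟨ψ, hψ0, hlin, hC⟩ := hpsi _ hne0
      apply hψ0
      rw [map_sum]
      simp only [hlin]
      apply IsFractionRing.injective A K
      have h6 : φ (fun i => algebraMap A K (ψ (a i l))) = 0 := by
        apply hφ
        exact Submodule.subset_span ⟨ψ, ⟨hlin, hC⟩, l, rfl⟩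
      rw [hη] at h6
      rw [map_sum, map_zero]
      simp only [map_mul, hw']
      calc _ = algebraMap A K u * ∑ i, algebraMap A K (ψ (a i l)) * η i := by
            rw [Finset.mul_sum]; refine Finset.sum_congr rfl fun i _ => by ring
        _ = 0 := by rw [h6, mul_zero]
    have h7 : (∑ i, algebraMap A K (w i) • b i) ^ p ^ n = 0 := by
      rw [sum_pow_char_pow]
      simp only [_root_.smul_pow, hκ, Finset.smul_sum, smul_smul]
      rw [Finset.sum_comm]
      refine Finset.sum_eq_zero fun l _ => ?_
      rw [← Finset.sum_smul]
      have : ∑ i, algebraMap A K (w i) ^ p ^ n * κ i l = 0 := by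
        apply mul_left_cancel₀ hd0
        rw [mul_zero, ← map_zero (algebraMap A K), ← h5 l, map_sum, Finset.mul_sum]
        refine Finset.sum_congr rfl fun i _ => ?_
        rw [map_mul, map_pow, ha]; ring
      rw [this, zero_smul]
    have h8 := (Fintype.linearIndependent_iff.1 b.linearIndependent) _ (pow_eq_zero_iff hq |>.1 h7)
    apply hφ0
    ext v
    simp
    have := h8 v
    rw [hw'] at this
    exact (mul_eq_zero.1 this).resolve_left hu0
  have hall : ∀ v ∈ W, ∑ i, g i * algebraMap K F (v i) = 0 := by
    intro v hv
    induction hv using Submodule.span_induction with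
    | mem v hv =>
      obtain ⟨ψ, hψ, l, rfl⟩ := hv
      rw [← hvan ψ hψ l]
      refine Finset.sum_congr rfl fun i _ => ?_
      rw [IsScalarTower.algebraMap_apply A K F]
    | zero => simp
    | add v w _ _ hv hw =>
      simp only [Pi.add_apply, map_add, mul_add, Finset.sum_add_distrib, hv, hw, add_zero]
    | smul r v _ hv =>
      simp only [Pi.smul_apply, smul_eq_mul, map_mul]
      rw [← mul_zero (algebraMap K F r), ← hv, Finset.mul_sum]
      refine Finset.sum_congr rfl fun i _ => by ring
  rw [hxg]
  refine Finset.sum_eq_zero fun i _ => ?_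
  have := hall (Pi.single i 1) (by rw [hW]; trivial)
  rw [Finset.sum_eq_single i] at this
  · simp at this
    rw [this, TensorProduct.zero_tmul]
  · intro l _ hl
    simp [hl]
  · simp

end

end Izumi

end

section

namespace Izumi

open TensorProduct Filter

lemma ar_cancel {S : Type*} [CommRing S] [IsDomain S] [IsNoetherianRing S] (I : Ideal S) (δ : S) (hδ : δ ≠ 0) :
    ∃ C, ∀ n x, δ * x ∈ I ^ (n + C) → x ∈ I ^ n := by
  obtain ⟨k, hk⟩ := Ideal.exists_pow_inf_eq_pow_smul I (Ideal.span {δ} : Submodule S S)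
  refine ⟨k, fun n x hx => ?_⟩
  have h1 : δ * x ∈ (I ^ (n + k) • ⊤ ⊓ Ideal.span {δ} : Submodule S S) := by
    refine ⟨?_, ?_⟩
    · change δ * x ∈ (I ^ (n + k) • ⊤ : Ideal S)
      rw [smul_eq_mul, Ideal.mul_top]
      exact hx
    · exact Ideal.mul_mem_right _ _ (Ideal.mem_span_singleton_self δ)
  rw [hk _ (by omega), Nat.add_sub_cancel] at h1
  have h2 : δ * x ∈ I ^ n * Ideal.span {δ} := by
    rw [← smul_eq_mul]
    exact Submodule.smul_mono le_rfl inf_le_right h1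
  rw [Ideal.mem_mul_span_singleton] at h2
  obtain ⟨z, hz, hzx⟩ := h2
  have : z = x := mul_left_cancel₀ hδ (by rw [mul_comm, hzx])
  rwa [← this]

section coord
variable {A S : Type*} [CommRing A] [IsDomain A] [CommRing S] [IsDomain S]
    [IsNoetherianRing S] [Algebra A S] [Module.Finite A S] (m : Ideal A)
    (K L : Type*) [Field K] [Field L] [Algebra A K] [IsFractionRing A K] [Algebra S L] [IsFractionRing S L]
    [Algebra K L] [Algebra A L] [IsScalarTower A K L] [IsScalarTower A S L] [FiniteDimensional K L]

lemma exists_coord {ι : Type*} [Fintype ι] (b : Module.Basis ι K L) : ∃ (δ : A) (c : S → ι → A), δ ≠ 0 ∧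
    (∀ s i, algebraMap A K (c s i) = algebraMap A K δ * b.repr (algebraMap S L s) i) ∧
    (∀ n s, s ∈ (m.map (algebraMap A S)) ^ n → ∀ i, c s i ∈ m ^ n) ∧
    ∃ C, ∀ n s, (∀ i, c s i ∈ m ^ (n + C)) → s ∈ (m.map (algebraMap A S)) ^ n := by
  classical
  obtain ⟨r, f, hf⟩ := Module.Finite.exists_fin' A S
  obtain ⟨⟨δ, hδ⟩, hintg⟩ := IsLocalization.exist_integer_multiples_of_finite (nonZeroDivisors A)
    (fun il : Fin r × ι => b.repr (algebraMap S L (f (Pi.single il.1 1))) il.2)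
  have hδ0 : δ ≠ 0 := nonZeroDivisors.ne_zero hδ
  have hex : ∀ s i, ∃ a, algebraMap A K a = algebraMap A K δ * b.repr (algebraMap S L s) i := by
    intro s i
    obtain ⟨v, rfl⟩ := hf s
    choose a ha using fun l => hintg (l, i)
    refine ⟨∑ l, v l * a l, ?_⟩
    have h1 : f v = ∑ l, v l • f (Pi.single l 1) := by
      conv_lhs => rw [← Finset.univ_sum_single v, map_sum]
      refine Finset.sum_congr rfl fun l _ => ?_
      rw [← map_smul, ← Pi.single_smul, smul_eq_mul, mul_one]
    rw [h1, map_sum, map_sum, map_sum, Finsupp.finsetSum_apply, Finset.mul_sum]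
    refine Finset.sum_congr rfl fun l _ => ?_
    have h2 : algebraMap S L (v l • f (Pi.single l 1)) = algebraMap A K (v l) • algebraMap S L (f (Pi.single l 1)) := by
      rw [Algebra.smul_def, map_mul, ← IsScalarTower.algebraMap_apply, Algebra.smul_def,
        ← IsScalarTower.algebraMap_apply]
    rw [h2, map_smul, Finsupp.smul_apply, map_mul, ha l, Algebra.smul_def, smul_eq_mul]
    ring
  choose c hc using hex
  have hinj := IsFractionRing.injective A K
  have hcadd : ∀ s t i, c (s + t) i = c s i + c t i := by
    intro s t i
    apply hinj
    rw [map_add, hc, hc, hc, map_add, map_add, Finsupp.add_apply]; ring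
  have hcsmul : ∀ (a : A) s i, c (a • s) i = a * c s i := by
    intro a s i
    apply hinj
    have h2 : algebraMap S L (a • s) = algebraMap A K a • algebraMap S L s := by
      rw [Algebra.smul_def, map_mul, ← IsScalarTower.algebraMap_apply, Algebra.smul_def,
        ← IsScalarTower.algebraMap_apply]
    rw [map_mul, hc, hc, h2, map_smul, Finsupp.smul_apply, smul_eq_mul]; ring
  refine ⟨δ, c, hδ0, hc, ?_, ?_⟩
  · intro n s hs i
    rw [← Ideal.map_pow] at hs
    have hs' : s ∈ (m ^ n • ⊤ : Submodule A S) := by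
      rw [Ideal.smul_top_eq_map]; exact hs
    refine Submodule.smul_induction_on (p := fun s => c s i ∈ m ^ n) hs' ?_ ?_
    · intro a ha t _
      rw [hcsmul]; exact Ideal.mul_mem_right _ _ ha
    · intro s t hs ht
      rw [hcadd]; exact Ideal.add_mem _ hs ht
  · obtain ⟨⟨δ2, hδ2⟩, hint2⟩ := IsLocalization.exist_integer_multiples_of_finite (nonZeroDivisors S) (fun i => b i)
    choose z hz using hint2
    have hδ20 : δ2 ≠ 0 := nonZeroDivisors.ne_zero hδ2
    have hinjS : Function.Injective (algebraMap A S) := by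
      have h3 : Function.Injective (algebraMap A L) := by
        rw [IsScalarTower.algebraMap_eq A K L]
        exact (algebraMap K L).injective.comp hinj
      rw [IsScalarTower.algebraMap_eq A S L] at h3
      exact Function.Injective.of_comp h3
    have hrel : ∀ s, algebraMap A S δ * δ2 * s = ∑ i, algebraMap A S (c s i) * z i := by
      intro s
      apply IsFractionRing.injective S L
      rw [map_mul, map_mul, map_sum, ← IsScalarTower.algebraMap_apply]
      conv_lhs => rw [← b.sum_repr (algebraMap S L s)]
      rw [Finset.mul_sum]
      refine Finset.sum_congr rfl fun i _ => ?_
      rw [map_mul, hz, ← IsScalarTower.algebraMap_apply, IsScalarTower.algebraMap_apply A K L (c s i), hc, map_mul,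
        Algebra.smul_def, Algebra.smul_def, ← IsScalarTower.algebraMap_apply]
      ring
    obtain ⟨C, hC⟩ := ar_cancel (m.map (algebraMap A S)) (algebraMap A S δ * δ2)
      (mul_ne_zero (by rwa [Ne, map_eq_zero_iff _ hinjS]) hδ20)
    refine ⟨C, fun n s hs => hC n s ?_⟩
    rw [hrel]
    refine Ideal.sum_mem _ fun i _ => Ideal.mul_mem_right _ _ ?_
    rw [← Ideal.map_pow]
    exact Ideal.mem_map_of_mem _ (hs i)

end coord

lemma izumi_aux {A S : Type*} [CommRing A] [IsDomain A] [CommRing S] [IsDomain S]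
    [IsNoetherianRing S] [Algebra A S] [Module.Finite A S] (m : Ideal A)
    (K L : Type*) [Field K] [Field L] [Algebra A K] [IsFractionRing A K] [Algebra S L] [IsFractionRing S L]
    [Algebra K L] [Algebra A L] [IsScalarTower A K L] [IsScalarTower A S L] [FiniteDimensional K L]
    (F : Type*) [Field F] [Algebra K F] [Algebra A F] [IsScalarTower A K F] (h : Mult A m) (h1 : m ≠ ⊤) (hP : PropN A m) (hH : IsAdicComplete m A)
    (p : ℕ) [ExpChar K p] (hpsi : ∀ n, HasPsi A m (p ^ n)) (n : ℕ → ℕ) (x y : ℕ → S) (τ : (ℕ → A) →+* F)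
    (hτ : ∀ a, τ (fun _ => a) = algebraMap A F a)
    (hker : ∀ a, τ a = 0 ↔ a ∈ Q h h1 (hyperfilter ℕ) (fun j => j * n j))
    (hfrac : ∀ θ : F, ∃ e c, τ c ≠ 0 ∧ θ * τ c = τ e)
    (hxy : ∀ j, x j * y j ∈ (m.map (algebraMap A S)) ^ (j * n j)) (hx : ∀ j, x j ∉ (m.map (algebraMap A S)) ^ (n j))
    (hy : ∀ j, y j ∉ (m.map (algebraMap A S)) ^ (n j)) : False := by
  classical
  let b := Module.finBasis K L
  let B := Algebra.TensorProduct.basis F b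
  obtain ⟨δ, c, hδ, hc, hc1, C, hC⟩ := exists_coord (S := S) m K L b
  let τ' : (ℕ → A) →ₐ[A] F := { τ with commutes' := fun a => by exact hτ a }
  let f1 : (ℕ → A) →ₐ[A] F ⊗[K] L := (Algebra.TensorProduct.includeLeft : F →ₐ[A] F ⊗[K] L).comp τ'
  let g1 : S →ₐ[A] F ⊗[K] L := ((Algebra.TensorProduct.includeRight : L →ₐ[K] F ⊗[K] L).restrictScalars A).comp (IsScalarTower.toAlgHom A S L)
  let Ξ : (ℕ → A) ⊗[A] S →ₐ[A] F ⊗[K] L := Algebra.TensorProduct.lift f1 g1 (fun _ _ => Commute.all _ _)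
  have hΞ : ∀ a s, Ξ (a ⊗ₜ s) = τ a ⊗ₜ[K] algebraMap S L s := by
    intro a s
    simp only [Ξ, Algebra.TensorProduct.lift_tmul, f1, g1]
    change (τ a ⊗ₜ[K] (1 : L)) * ((1 : F) ⊗ₜ[K] algebraMap S L s) = _
    rw [Algebra.TensorProduct.tmul_mul_tmul, one_mul, mul_one]
  let ev : ∀ j : ℕ, (ℕ → A) ⊗[A] S →ₐ[A] S := fun j =>
    Algebra.TensorProduct.lift ((Algebra.ofId A S).comp (Pi.evalAlgHom A (fun _ : ℕ => A) j)) (AlgHom.id A S) (fun _ _ => Commute.all _ _)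
  have hev : ∀ j a s, ev j (a ⊗ₜ s) = a j • s := by
    intro j a s
    simp only [ev, Algebra.TensorProduct.lift_tmul]
    rw [Algebra.smul_def]
    rfl
  have hinj := IsFractionRing.injective A K
  have hcadd : ∀ s t i, c (s + t) i = c s i + c t i := by
    intro s t i
    apply hinj
    rw [map_add, hc, hc, hc, map_add, map_add, Finsupp.add_apply]; ring
  have hc0 : ∀ i, c 0 i = 0 := by
    intro i
    apply hinj
    rw [hc]; simp
  have hcsmul : ∀ (a : A) s i, c (a • s) i = a * c s i := by
    intro a s i
    apply hinj
    have h2 : algebraMap S L (a • s) = algebraMap A K a • algebraMap S L s := by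
      rw [Algebra.smul_def, map_mul, ← IsScalarTower.algebraMap_apply, Algebra.smul_def,
        ← IsScalarTower.algebraMap_apply]
    rw [map_mul, hc, hc, h2, map_smul, Finsupp.smul_apply, smul_eq_mul]; ring
  have hcoord : ∀ Z i, algebraMap A F δ * B.repr (Ξ Z) i = τ (fun j => c (ev j Z) i) := by
    intro Z i
    induction Z using TensorProduct.induction_on with
    | zero =>
      have : (fun j => c (ev j 0) i) = 0 := by
        funext j; rw [map_zero, hc0]; rfl
      rw [this]; simp
    | tmul a s =>
      rw [hΞ, Algebra.TensorProduct.basis_repr_tmul]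
      have : (fun j => c (ev j (a ⊗ₜ s)) i) = a * (fun _ => c s i) := by
        funext j; rw [hev, hcsmul]; rfl
      rw [this, map_mul, hτ, IsScalarTower.algebraMap_apply A K F (c s i), hc, map_mul,
        ← IsScalarTower.algebraMap_apply]
      simp
      ring
    | add X Y hX hY =>
      have : (fun j => c (ev j (X + Y)) i) = (fun j => c (ev j X) i) + (fun j => c (ev j Y) i) := by
        funext j; rw [map_add, hcadd]; rfl
      rw [this, map_add, map_add, map_add, Finsupp.add_apply, mul_add, hX, hY]
  have hδF : algebraMap A F δ ≠ 0 := by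
    rw [IsScalarTower.algebraMap_apply A K F]
    simpa using hδ
  have hzero : ∀ Z, Ξ Z = 0 ↔ ∀ i, (fun j => c (ev j Z) i) ∈ Q h h1 (hyperfilter ℕ) (fun j => j * n j) := by
    intro Z
    rw [← B.repr.map_eq_zero_iff, Finsupp.ext_iff]
    refine forall_congr' fun i => ?_
    rw [← hker, ← hcoord]
    simp [hδF]
  have hlift : ∀ x : ℕ → S, ∃ X, ∀ j, ev j X = x j := by
    intro x
    obtain ⟨r, f, hf⟩ := Module.Finite.exists_fin' A S
    choose v hv using fun j => hf (x j)
    refine ⟨∑ l, (fun j => v j l) ⊗ₜ f (Pi.single l 1), fun j => ?_⟩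
    rw [map_sum, ← hv]
    conv_rhs => rw [← Finset.univ_sum_single (v j), map_sum]
    refine Finset.sum_congr rfl fun l _ => ?_
    rw [hev, ← map_smul, ← Pi.single_smul, smul_eq_mul, mul_one]
  obtain ⟨X, hX⟩ := hlift x
  obtain ⟨Y, hY⟩ := hlift y
  have hfin : ∀ (X : (ℕ → A) ⊗[A] S) (x : ℕ → S), (∀ j, ev j X = x j) → (∀ j, x j ∉ (m.map (algebraMap A S)) ^ (n j)) → Ξ X ≠ 0 := by
    intro X x hX hx h0
    rw [hzero] at h0
    choose s hs using h0
    have hall := (eventually_all.2 hs)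
    have hbig : ∀ᶠ j in (hyperfilter ℕ : Filter ℕ), ((∑ i, s i) + 1) * (C + 1) ≤ j :=
      Nat.hyperfilter_le_atTop (eventually_ge_atTop _)
    obtain ⟨j, hj1, hj2⟩ := (hall.and hbig).exists
    apply hx j
    apply hC
    intro i
    have h3 := hj1 i
    simp only [hX] at h3
    refine Ideal.pow_le_pow_right ?_ h3
    rw [Nat.le_div_iff_mul_le (by omega)]
    have hn1 : 1 ≤ n j := by
      by_contra hcon
      apply hx j
      rw [show n j = 0 by omega]; simp
    have hsi : s i ≤ ∑ i, s i := Finset.single_le_sum (fun _ _ => Nat.zero_le _) (Finset.mem_univ i)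
    calc (n j + C) * (s i + 1) ≤ (n j * (C + 1)) * ((∑ i, s i) + 1) := by
          refine Nat.mul_le_mul ?_ (by omega)
          nlinarith
      _ = n j * (((∑ i, s i) + 1) * (C + 1)) := by ring
      _ ≤ n j * j := Nat.mul_le_mul_left _ hj2
      _ = j * n j := mul_comm _ _
  have hprod : Ξ X * Ξ Y = 0 := by
    rw [← map_mul, hzero]
    intro i
    refine ⟨0, Eventually.of_forall fun j => ?_⟩
    simp only [zero_add, Nat.div_one]
    apply hc1
    rw [map_mul, hX, hY]
    exact hxy j
  rcases tensor_domain p (closed_in h h1 (hyperfilter ℕ) _ τ hτ hP hH hker hfrac) 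
    (fun n x hx => reduced_tensor h h1 (hyperfilter ℕ) _ τ hτ hker hfrac (hpsi n) x hx) _ _ hprod with h0 | h0
  · exact hfin X x hX hx h0
  · exact hfin Y y hY hy h0

theorem izumi_finite {A S : Type*} [CommRing A] [IsDomain A] [IsNoetherianRing A] [CommRing S] [IsDomain S]
    [Algebra A S] [Module.Finite A S] [FaithfulSMul A S] (m : Ideal A) (h1 : m ≠ ⊤) (hP : PropN A m)
    (hH : IsAdicComplete m A) (p : ℕ) [ExpChar A p] (hpsi : ∀ n, HasPsi A m (p ^ n)) :
    ∃ c : ℕ, ∀ n (x y : S), x * y ∈ (m.map (algebraMap A S)) ^ (c * n) →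
      x ∈ (m.map (algebraMap A S)) ^ n ∨ y ∈ (m.map (algebraMap A S)) ^ n := by
  by_contra hcon
  push Not at hcon
  choose n x y hxy hx hy using hcon
  have h : Mult A m := hP.1
  haveI : IsNoetherianRing S := IsNoetherianRing.of_finite A S
  have hn1 : ∀ j, 1 ≤ n j := by
    intro j
    by_contra hcon
    apply hx j
    rw [show n j = 0 by omega]; simp
  have hN : Tendsto (fun j => j * n j) (hyperfilter ℕ : Filter ℕ) atTop := by
    have : Tendsto (fun j => j * n j) atTop atTop :=
      tendsto_atTop_mono (fun j => Nat.le_mul_of_pos_right j (hn1 j)) tendsto_id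
    exact this.mono_left Nat.hyperfilter_le_atTop
  let P := Q h h1 (hyperfilter ℕ) (fun j => j * n j)
  haveI : P.IsPrime := prime_Q h h1 _ _ hN
  obtain ⟨F, fieldF, τ, hker, hfrac⟩ : ∃ (F : Type _) (_ : Field F) (τ : (ℕ → A) →+* F), (∀ a, τ a = 0 ↔ a ∈ P) ∧
      ∀ θ : F, ∃ e c, τ c ≠ 0 ∧ θ * τ c = τ e := by
    let F := FractionRing ((ℕ → A) ⧸ P)
    let τ : (ℕ → A) →+* F := (algebraMap ((ℕ → A) ⧸ P) F).comp (Ideal.Quotient.mk P)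
    have hker : ∀ a, τ a = 0 ↔ a ∈ P := by
      intro a
      simp only [τ, RingHom.comp_apply]
      rw [map_eq_zero_iff _ (IsFractionRing.injective ((ℕ → A) ⧸ P) F), Ideal.Quotient.eq_zero_iff_mem]
    have hfrac : ∀ θ : F, ∃ e c, τ c ≠ 0 ∧ θ * τ c = τ e := by
      intro θ
      obtain ⟨⟨e, c⟩, hec⟩ := IsLocalization.surj (nonZeroDivisors ((ℕ → A) ⧸ P)) θ
      obtain ⟨e, rfl⟩ := Ideal.Quotient.mk_surjective e
      obtain ⟨c', hc'⟩ := Ideal.Quotient.mk_surjective (c : (ℕ → A) ⧸ P)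
      refine ⟨e, c', ?_, ?_⟩
      · simp only [τ, RingHom.comp_apply, hc']
        exact IsLocalization.to_map_ne_zero_of_mem_nonZeroDivisors F le_rfl c.2
      · simp only [τ, RingHom.comp_apply, hc']
        exact hec
    exact ⟨F, inferInstance, τ, hker, hfrac⟩
  letI algAF : Algebra A F := (τ.comp (Pi.constRingHom ℕ A)).toAlgebra
  have hτ : ∀ a, τ (fun _ => a) = algebraMap A F a := fun a => rfl
  haveI : FaithfulSMul A F := by
    rw [faithfulSMul_iff_algebraMap_injective, injective_iff_map_eq_zero]
    intro a ha
    rw [← hτ, hker] at ha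
    obtain ⟨s, hs⟩ := ha
    apply haus_zero (I := m) hH.toIsHausdorff
    intro r
    obtain ⟨j, hj1, hj2⟩ := (hs.and (hN.eventually (eventually_ge_atTop (r * (s + 1))))).exists
    exact Ideal.pow_le_pow_right ((Nat.le_div_iff_mul_le (by omega)).2 hj2) hj1
  letI := FractionRing.liftAlgebra A F
  haveI := FractionRing.isScalarTower_liftAlgebra A F
  letI := FractionRing.liftAlgebra A (FractionRing S)
  haveI := FractionRing.isScalarTower_liftAlgebra A (FractionRing S)
  haveI : ExpChar (FractionRing A) p := expChar_of_injective_algebraMap (IsFractionRing.injective A (FractionRing A)) p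
  exact izumi_aux m (FractionRing A) (FractionRing S) F h h1 hP hH p hpsi n x y τ hτ hker hfrac hxy hx hy

end Izumi

end

section

namespace Izumi

lemma exists_semilin {K E : Type*} [Field K] [Field E] (ρ : K →+* E) (u : E) (hu : u ≠ 0) :
    ∃ φ : E →+ K, φ u ≠ 0 ∧ ∀ c x, φ (ρ c * x) = c * φ x := by
  letI := ρ.toAlgebra
  have := mt (Module.forall_dual_apply_eq_zero_iff K u).1 hu
  push Not at this
  obtain ⟨f, hf⟩ := this
  refine ⟨f.toAddMonoidHom, hf, fun c x => ?_⟩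
  have := f.map_smul c x
  rw [Algebra.smul_def] at this
  exact this

lemma hasPsi_ps {σ k : Type*} [Finite σ] [Field k] (p : ℕ) [ExpChar k p] (n : ℕ) :
    HasPsi (MvPowerSeries σ k) (MPI σ (0 : k)) (p ^ n) := by
  classical
  intro f hf
  have hq : p ^ n ≠ 0 := pow_ne_zero _ (expChar_ne_zero k p)
  have hq0 : 0 < p ^ n := Nat.pos_of_ne_zero hq
  obtain ⟨α, hα⟩ : ∃ α, MvPowerSeries.coeff α f ≠ 0 := by
    by_contra h
    push Not at h
    exact hf (MvPowerSeries.ext h)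
  obtain ⟨φ, hφ, hφm⟩ := exists_semilin (iterateFrobenius k p n) _ hα
  have hfr : ∀ g : MvPowerSeries σ k, g ^ p ^ n = MvPowerSeries.map (iterateFrobenius k p n) (MvPowerSeries.expand (p ^ n) hq g) := 
    fun g => (MvPowerSeries.map_iterateFrobenius_expand p (expChar_ne_zero k p) g n).symm
  set q := p ^ n with hqdef
  let I : σ →₀ ℕ := α.mapRange (fun x => x % q) (by simp)
  let M0 : σ →₀ ℕ := α.mapRange (fun x => x / q) (by simp)
  have hIq : ∀ i, I i < q := fun i => Nat.mod_lt _ hq0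
  have hαI : q • M0 + I = α := by
    ext i
    exact Nat.div_add_mod _ _
  let ψ : MvPowerSeries σ k →+ MvPowerSeries σ k :=
    { toFun := fun f => (fun M => φ (MvPowerSeries.coeff (q • M + I) f))
      map_zero' := by funext M; simp; rfl
      map_add' := by intro x y; funext M; simp; rfl }
  have hψ : ∀ f M, MvPowerSeries.coeff M (ψ f) = φ (MvPowerSeries.coeff (q • M + I) f) := fun _ _ => rfl
  refine ⟨ψ, ?_, ?_, q + I.degree, by omega, ?_⟩
  · intro h
    have := hψ f M0
    rw [h, hαI] at this
    exact hφ (by rw [← this]; simp)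
  · intro g f
    ext M
    rw [hψ, hfr, MvPowerSeries.coeff_mul, MvPowerSeries.coeff_mul, map_sum]
    symm
    refine Finset.sum_of_injOn (fun u => (q • u.1, q • u.2 + I)) ?_ ?_ ?_ ?_
    · intro u _ v _ h
      simp only [Prod.mk.injEq, add_left_inj] at h
      refine Prod.ext ?_ ?_
      · ext i
        have := DFunLike.congr_fun h.1 i
        simpa [hq] using this
      · ext i
        have := DFunLike.congr_fun h.2 i
        simpa [hq] using this
    · intro u hu
      simp only [Finset.mem_coe, Finset.HasAntidiagonal.mem_antidiagonal] at hu ⊢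
      rw [← hu, smul_add, add_assoc]
    · intro u hu hnot
      rw [MvPowerSeries.coeff_map]
      rw [Finset.HasAntidiagonal.mem_antidiagonal] at hu
      have : ∃ i, ¬ q ∣ u.1 i := by
        by_contra h
        push Not at h
        apply hnot
        have hle : ∀ i, u.1 i / q ≤ M i := by
          intro i
          have := DFunLike.congr_fun hu i
          simp only [Finsupp.add_apply, Finsupp.smul_apply, smul_eq_mul] at this
          have h2 := hIq i
          by_contra hc
          push Not at hc
          have h3 := Nat.div_mul_cancel (h i)
          have : q * (M i + 1) ≤ q * (u.1 i / q) := Nat.mul_le_mul_left _ hc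
          nlinarith
        let u1 : σ →₀ ℕ := u.1.mapRange (fun x => x / q) (by simp)
        have hu1 : q • u1 = u.1 := by
          ext i; simp [u1, Nat.mul_div_cancel' (h i)]
        have hu1M : u1 ≤ M := fun i => by simpa [u1] using hle i
        refine ⟨(u1, M - u1), by simpa using add_tsub_cancel_of_le hu1M, ?_⟩
        refine Prod.ext hu1 ?_
        show q • (M - u1) + I = u.2
        have : u.1 + (q • (M - u1) + I) = u.1 + u.2 := by
          rw [hu, ← hu1, ← add_assoc, ← smul_add, add_tsub_cancel_of_le hu1M]
        exact add_left_cancel this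
      obtain ⟨i, hi⟩ := this
      rw [MvPowerSeries.coeff_expand_of_not_dvd _ _ _ hi, map_zero, zero_mul, map_zero]
    · intro u hu
      simp only
      rw [MvPowerSeries.coeff_map, MvPowerSeries.coeff_expand_smul, hφm, hψ]
  · intro N f hf
    rw [mem_MPI_pow] at hf ⊢
    intro M
    rw [hψ]
    by_cases hM : N ≤ M.degree
    · rw [Nat.sub_eq_zero_of_le hM]; simp
    · have h1 := hf (q • M + I)
      have h2 : (q • M + I).degree = q * M.degree + I.degree := by simp
      have : (q + I.degree) * (N + 1) - (q • M + I).degree ≠ 0 := by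
        rw [h2]
        have : q * M.degree ≤ q * N := Nat.mul_le_mul_left _ (by omega)
        have : (q + I.degree) * (N + 1) = q * N + q + I.degree * N + I.degree := by ring
        have : 0 ≤ I.degree * N := by positivity
        omega
      rw [zero_pow this, zero_dvd_iff] at h1
      rw [h1, map_zero]
      exact dvd_zero _

end Izumi

end

section

namespace Izumi

open IsLocalRing

lemma precomplete_pi {A ι : Type*} [CommRing A] [Finite ι] (I : Ideal A) (h : IsPrecomplete I A) :
    IsPrecomplete I (ι → A) := by
  classical
  cases nonempty_fintype ι
  have key : ∀ n (x : ι → A), x ∈ (I ^ n • ⊤ : Submodule A (ι → A)) ↔ ∀ i, x i ∈ I ^ n := by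
    intro n x
    constructor
    · intro hx i
      have := Submodule.mem_map_of_mem (f := LinearMap.proj (R := A) (φ := fun _ : ι => A) i) hx
      rw [Submodule.map_smul''] at this
      have := Submodule.smul_mono (le_refl (I ^ n)) (le_top) this
      simpa [smul_eq_mul, Ideal.mul_top] using this
    · intro hx
      have : x = ∑ i, x i • (Pi.single i 1 : ι → A) := by
        ext j; simp [Finset.sum_apply, Pi.single_apply]
      rw [this]
      exact Submodule.sum_mem _ fun i _ => Submodule.smul_mem_smul (hx i) trivial
  refine ⟨fun f hf => ?_⟩
  have := fun i => prec_lim h (fun n => f n i) (fun n => by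
    have := hf (Nat.le_succ n)
    rw [SModEq.sub_mem, key] at this
    have := this i
    rw [← neg_mem_iff]; simpa using this)
  choose L hL using this
  refine ⟨L, fun n => ?_⟩
  rw [SModEq.sub_mem, key]
  intro i
  have := hL i n
  rw [← neg_mem_iff]; simpa using this

lemma finite_of_complete {A S : Type*} [CommRing A] [CommRing S] [Algebra A S] (m : Ideal A)
    (hc : IsPrecomplete m A) (hH : ∀ x : S, (∀ n, x ∈ (m.map (algebraMap A S)) ^ n) → x = 0)
    (N : Submodule A S) (hN : N.FG)
    (htop : ∀ x : S, ∃ y ∈ N, x - y ∈ m.map (algebraMap A S)) : Module.Finite A S := by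
  have hHm : IsHausdorff m S := by
    refine ⟨fun x hx => hH x fun n => ?_⟩
    have := hx n
    rw [SModEq.zero, Ideal.smul_top_eq_map, Submodule.restrictScalars_mem, Ideal.map_pow] at this
    exact this
  obtain ⟨r, f, hf⟩ := (Submodule.fg_iff_exists_fin_linearMap A S).1 hN
  haveI := precomplete_pi (ι := Fin r) m hc
  have hsurj : Function.Surjective f := by
    apply surjective_of_mkQ_comp_surjective (I := m)
    intro z
    obtain ⟨x, rfl⟩ := Submodule.mkQ_surjective _ z
    obtain ⟨y, hy, hxy⟩ := htop x
    rw [← hf] at hy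
    obtain ⟨w, rfl⟩ := hy
    refine ⟨w, ?_⟩
    rw [LinearMap.comp_apply, ← sub_eq_zero, ← map_sub, Submodule.mkQ_apply,
      Submodule.Quotient.mk_eq_zero, Ideal.smul_top_eq_map, Submodule.restrictScalars_mem, ← neg_mem_iff]
    simpa using hxy
  exact Module.Finite.of_surjective f hsurj

lemma finite_of_local {A S : Type*} [CommRing A] [CommRing S] [Algebra A S] (m : Ideal A)
    (hc : IsPrecomplete m A) (M : Ideal S) (hM : M.FG) (hH : IsHausdorff M S)
    (hle : m.map (algebraMap A S) ≤ M) (h : ℕ) (hh : M ^ h ≤ m.map (algebraMap A S))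
    (hres : ∀ s : S, ∃ a : A, s - algebraMap A S a ∈ M) : Module.Finite A S := by
  have key : ∀ i, ∃ N : Submodule A S, N.FG ∧ ∀ x : S, ∃ y ∈ N, x - y ∈ M ^ i := by
    intro i
    induction i with
    | zero => exact ⟨⊥, Submodule.fg_bot, fun x => ⟨0, by simp, by simp⟩⟩
    | succ i ih =>
      obtain ⟨N, hN, hx⟩ := ih
      obtain ⟨T, hT⟩ := Ideal.FG.pow (n := i) hM
      refine ⟨N ⊔ Submodule.span A (T : Set S), hN.sup ⟨T, rfl⟩, fun x => ?_⟩
      obtain ⟨y, hy, hxy⟩ := hx x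
      have : ∀ z ∈ Submodule.span S (T : Set S), ∃ w ∈ Submodule.span A (T : Set S), z - w ∈ M ^ (i + 1) := by
        intro z hz
        induction hz using Submodule.span_induction with
        | mem z hz => exact ⟨z, Submodule.subset_span hz, by simp⟩
        | zero => exact ⟨0, by simp, by simp⟩
        | add u v _ _ hu hv =>
          obtain ⟨a, ha, ha'⟩ := hu
          obtain ⟨b, hb, hb'⟩ := hv
          refine ⟨a + b, add_mem ha hb, ?_⟩
          have := Ideal.add_mem _ ha' hb'
          rwa [add_sub_add_comm]
        | smul s u hu' hu =>
          obtain ⟨a, ha, ha'⟩ := hu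
          obtain ⟨c, hc⟩ := hres s
          refine ⟨c • a, Submodule.smul_mem _ _ ha, ?_⟩
          have h1 : s • u - c • a = (s - algebraMap A S c) * u + algebraMap A S c * (u - a) := by
            rw [smul_eq_mul, Algebra.smul_def]; ring
          rw [h1]
          refine Ideal.add_mem _ ?_ (Ideal.mul_mem_left _ _ ha')
          rw [pow_succ']
          exact Ideal.mul_mem_mul hc (hT ▸ hu')
      obtain ⟨w, hw, hw'⟩ := this (x - y) (by rw [← hT] at hxy; exact hxy)
      refine ⟨y + w, Submodule.add_mem_sup hy hw, ?_⟩
      rwa [← sub_sub]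
  obtain ⟨N, hN, hx⟩ := key h
  refine finite_of_complete m hc (fun x hx => haus_zero hH x fun n => Ideal.pow_right_mono hle n (hx n)) N hN fun x => ?_
  obtain ⟨y, hy, hxy⟩ := hx x
  exact ⟨y, hy, hh hxy⟩

lemma injective_of_dim {A S : Type*} [CommRing A] [IsDomain A] [CommRing S] (G : A →+* S)
    (hG : G.IsIntegral) (hd : ringKrullDim A ≤ ringKrullDim S) (hf : ringKrullDim S < ⊤)
    (hb : ringKrullDim S ≠ ⊥) : Function.Injective G := by
  rw [RingHom.injective_iff_ker_eq_bot]
  by_contra hker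
  obtain ⟨r, hr, hr0⟩ := Submodule.exists_mem_ne_zero_of_ne_bot hker
  have h1 : ringKrullDim S ≤ ringKrullDim (A ⧸ RingHom.ker G) := by
    let B := A ⧸ RingHom.ker G
    letI : Algebra B S := (RingHom.kerLift G).toAlgebra
    haveI : Algebra.IsIntegral B S := ⟨fun x => by
      have := hG x
      obtain ⟨P, hP, hx⟩ := this
      refine ⟨P.map (Ideal.Quotient.mk _), hP.map _, ?_⟩
      rw [Polynomial.eval₂_map]
      exact hx⟩
    refine Order.krullDim_le_of_strictMono (PrimeSpectrum.comap (algebraMap B S)) ?_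
    intro I J hIJ
    exact Ideal.IsIntegral.comap_lt_comap (R := B) hIJ
  have h2 := ringKrullDim_quotient_succ_le_of_nonZeroDivisor (mem_nonZeroDivisors_of_ne_zero hr0)
  have h3 : ringKrullDim (A ⧸ RingHom.ker G) ≤ ringKrullDim (A ⧸ Ideal.span {r}) := by
    apply ringKrullDim_le_of_surjective (Ideal.Quotient.factor ((Ideal.span_singleton_le_iff_mem _).2 hr))
    exact Ideal.Quotient.factor_surjective _
  have h4 : ringKrullDim S + 1 ≤ ringKrullDim S := 
    le_trans (add_le_add_left (h1.trans h3) 1) (h2.trans hd)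
  generalize ringKrullDim S = d at *
  cases d with
  | bot => exact hb rfl
  | coe d =>
    cases d with
    | top => exact absurd hf (lt_irrefl _)
    | coe d =>
      have : d + 1 ≤ d := by exact_mod_cast h4
      omega

end Izumi

end

section

namespace Izumi

open IsLocalRing

def Izu (S : Type*) [CommRing S] (m : Ideal S) : Prop :=
  ∃ c, ∀ n (x y : S), x * y ∈ m ^ (c * n) → x ∈ m ^ n ∨ y ∈ m ^ n

lemma domain_of_propN {A : Type*} [CommRing A] [Nontrivial A] {m : Ideal A} (hP : PropN A m)
    (hH : IsHausdorff m A) : IsDomain A := by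
  have : NoZeroDivisors A := ⟨by
    intro x y hxy
    by_contra h
    push Not at h
    have ho : ∀ z : A, z ≠ 0 → ∃ r, z ∉ m ^ (r + 1) := by
      intro z hz
      by_contra hc
      push Not at hc
      refine hz (haus_zero' hH z 1 fun n hn => ?_)
      obtain ⟨j, rfl⟩ := Nat.exists_eq_add_of_le hn
      rw [add_comm]; exact hc j
    obtain ⟨r, hr⟩ := ho x h.1
    obtain ⟨s, hs⟩ := ho y h.2
    exact hP.1 r s x y hr hs (by rw [hxy]; exact zero_mem _)⟩
  exact NoZeroDivisors.to_isDomain A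

lemma MPI_eq_maximal {V σ : Type*} [CommRing V] [IsLocalRing V] [Finite σ] (π : V)
    (hπ : maximalIdeal V = Ideal.span {π}) :
    MPI σ π = maximalIdeal (MvPowerSeries σ V) := by
  ext f
  rw [← pow_one (MPI σ π), mem_MPI_pow, IsLocalRing.mem_maximalIdeal, mem_nonunits_iff,
    MvPowerSeries.isUnit_iff_constantCoeff, ← mem_nonunits_iff, ← IsLocalRing.mem_maximalIdeal,
    hπ, Ideal.mem_span_singleton]
  constructor
  · intro h
    simpa using h 0
  · intro h α
    by_cases hα : α = 0
    · subst hα; simpa using h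
    · have : α.degree ≠ 0 := fun hc => hα ((Finsupp.degree_eq_zero_iff α).1 hc)
      rw [show 1 - α.degree = 0 by omega]; simp

theorem izumi_of_param {V S σ : Type*} [CommRing V] [IsDomain V] [IsNoetherianRing V] [IsLocalRing V]
    [CommRing S] [IsDomain S] [IsNoetherianRing S] [IsLocalRing S] [Finite σ]
    (hS : IsAdicComplete (maximalIdeal S) S) (π : V) (hπ : maximalIdeal V = Ideal.span {π})
    (hV : IsAdicComplete (Ideal.span {π}) V) (g : V →+* S) (hg : g π ∈ maximalIdeal S)
    (hres : ∀ s, ∃ v, s - g v ∈ maximalIdeal S) (x : σ → S) (hx : ∀ i, x i ∈ maximalIdeal S)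
    (h : ℕ) (hh : maximalIdeal S ^ h ≤ Ideal.span (insert (g π) (Set.range x)))
    (hdim : ((MPI σ π).spanFinrank : WithBot ℕ∞) ≤ ringKrullDim S)
    (hP : PropN (MvPowerSeries σ V) (MPI σ π)) (p : ℕ) [ExpChar (MvPowerSeries σ V) p]
    (hpsi : ∀ n, HasPsi (MvPowerSeries σ V) (MPI σ π) (p ^ n)) : Izu S (maximalIdeal S) := by
  have hA := complete_ps (σ := σ) π
  have hmax := MPI_eq_maximal (σ := σ) π hπ
  haveI : IsDomain (MvPowerSeries σ V) := domain_of_propN hP hA.toIsHausdorff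
  obtain ⟨G, hG, hGn⟩ := (dense_ps (σ := σ) π).extend (maximalIdeal S) (MvPolynomial.eval₂Hom g x) (by
    rw [MI, Ideal.span_le]
    rintro y (rfl | ⟨i, rfl⟩)
    · simpa using hg
    · simpa using hx i)
  have hGC : ∀ v, G (MvPowerSeries.C v) = g v := by
    intro v
    have := RingHom.congr_fun hG (MvPolynomial.C v)
    simpa using this
  have hGX : ∀ i, G (MvPowerSeries.X i) = x i := by
    intro i
    have := RingHom.congr_fun hG (MvPolynomial.X i)
    simpa using this
  letI := G.toAlgebra
  have hGa : algebraMap (MvPowerSeries σ V) S = G := rfl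
  have hmap : (MPI σ π).map (algebraMap (MvPowerSeries σ V) S) = Ideal.span (insert (g π) (Set.range x)) := by
    rw [MPI, Ideal.map_span, Set.image_insert_eq, hGa, hGC]
    congr 2
    ext y
    simp [hGX]
  have hle : (MPI σ π).map (algebraMap (MvPowerSeries σ V) S) ≤ maximalIdeal S := by
    rw [hmap, Ideal.span_le]
    rintro y (rfl | ⟨i, rfl⟩)
    · exact hg
    · exact hx i
  rw [← hmap] at hh
  haveI : Module.Finite (MvPowerSeries σ V) S := finite_of_local (MPI σ π) hA.toIsPrecomplete (maximalIdeal S)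
    (IsNoetherian.noetherian _) hS.toIsHausdorff hle h hh (fun s => by
      obtain ⟨v, hv⟩ := hres s
      exact ⟨MvPowerSeries.C v, by rw [hGa, hGC]; exact hv⟩)
  have hdA : ringKrullDim (MvPowerSeries σ V) ≤ ringKrullDim S := by
    refine le_trans ?_ hdim
    rw [hmax]
    exact ringKrullDim_le_spanFinrank_maximalIdeal _
  have hinj : Function.Injective G := injective_of_dim G (algebraMap_isIntegral_iff.2 inferInstance) hdA
    (ringKrullDim_lt_top) ringKrullDim_ne_bot
  haveI : FaithfulSMul (MvPowerSeries σ V) S := (faithfulSMul_iff_algebraMap_injective _ _).2 hinj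
  obtain ⟨c, hc⟩ := izumi_finite (S := S) (MPI σ π) (by rw [hmax]; exact Ideal.IsPrime.ne_top') hP hA p hpsi
  refine ⟨h * c, fun n y z hyz => ?_⟩
  rw [mul_assoc, pow_mul] at hyz
  have := hc n y z (Ideal.pow_right_mono hh _ hyz)
  exact this.imp (fun h => Ideal.pow_right_mono hle _ h) (fun h => Ideal.pow_right_mono hle _ h)

/-- Systems of parameters. -/
lemma exists_sop (T : Type*) [CommRing T] [IsNoetherianRing T] [IsLocalRing T] :
    ∃ (d : ℕ) (x : Fin d → T) (h : ℕ), (d : WithBot ℕ∞) = ringKrullDim T ∧ (∀ i, x i ∈ maximalIdeal T) ∧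
      maximalIdeal T ^ h ≤ Ideal.span (Set.range x) := by
  obtain ⟨s, hs, hc⟩ := Ideal.exists_finset_card_eq_height_of_isNoetherianRing (maximalIdeal T)
  have hrad : (Ideal.span (s : Set T)).radical = maximalIdeal T := by
    apply le_antisymm
    · have := Ideal.radical_mono hs.1.2
      rwa [(maximalIdeal.isMaximal T).isPrime.radical] at this
    · rw [Ideal.radical_eq_sInf]
      refine le_sInf fun J hJ => ?_
      have := hJ.2
      exact hs.2 ⟨hJ.2, hJ.1⟩ (le_maximalIdeal hJ.2.ne_top)
  obtain ⟨h, hh⟩ := Ideal.exists_radical_pow_le_of_fg (Ideal.span (s : Set T)) (IsNoetherian.noetherian _)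
  have e := s.equivFin.symm
  refine ⟨s.card, fun i => (e i : T), h, ?_, fun i => hs.1.2 (Ideal.subset_span (e i).2), ?_⟩
  · rw [← IsLocalRing.maximalIdeal_height_eq_ringKrullDim, ← hc]; rfl
  · rw [hrad] at hh
    refine hh.trans (Ideal.span_mono ?_)
    intro y hy
    exact ⟨e.symm ⟨y, hy⟩, by simp⟩

end Izumi

end

section

namespace Izumi

open IsLocalRing

lemma izu_bot (S : Type*) [CommRing S] [IsDomain S] : Izu S (⊥ : Ideal S) := by
  refine ⟨1, fun n x y h => ?_⟩
  rw [one_mul] at h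
  rcases n with _ | n
  · simp
  · rw [Ideal.bot_pow (by omega)] at h ⊢
    simpa using h

lemma spanFinrank_MPI_zero {k σ : Type*} [Field k] [Finite σ] :
    (MPI σ (0 : k)).spanFinrank ≤ Nat.card σ := by
  have : MPI σ (0 : k) = Submodule.span _ (Set.range (MvPowerSeries.X : σ → MvPowerSeries σ k)) := by
    rw [MPI, map_zero]; exact Submodule.span_insert_zero
  rw [this]
  refine (Submodule.spanFinrank_span_le_ncard_of_finite (Set.finite_range _)).trans ?_
  rw [← Set.image_univ, ← Set.ncard_univ]
  exact Set.ncard_image_le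

lemma spanFinrank_MPI {V σ : Type*} [CommRing V] [Finite σ] (π : V) :
    (MPI σ π).spanFinrank ≤ Nat.card σ + 1 := by
  refine (Submodule.spanFinrank_span_le_ncard_of_finite (Set.toFinite _)).trans ?_
  refine (Set.ncard_insert_le _ _).trans ?_
  rw [← Set.image_univ, ← Set.ncard_univ]
  exact Nat.add_le_add_right Set.ncard_image_le _

theorem izu_of_coeff_field {S : Type*} [CommRing S] [IsDomain S] [IsNoetherianRing S] [IsLocalRing S]
    (hS : IsAdicComplete (maximalIdeal S) S) (ι : ResidueField S →+* S)
    (hι : ∀ x, residue S (ι x) = x) : Izu S (maximalIdeal S) := by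
  by_cases hm : maximalIdeal S = ⊥
  · rw [hm]; exact izu_bot S
  obtain ⟨d, x, h, hd, hx, hh⟩ := exists_sop S
  obtain ⟨d, rfl⟩ : ∃ d', d = d' + 1 := by
    rcases d with _ | d
    · exfalso
      apply hm
      have : Set.range x = ∅ := Set.range_eq_empty x
      rw [this, Ideal.span_empty, le_bot_iff] at hh
      rw [eq_bot_iff]
      intro z hz
      have : z ^ h ∈ maximalIdeal S ^ h := Ideal.pow_mem_pow hz h
      rw [hh] at this
      have hne : h ≠ 0 := by
        rintro rfl
        rw [pow_zero, Ideal.one_eq_top] at hh; exact top_ne_bot hh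
      exact (pow_eq_zero_iff hne).1 this
    · exact ⟨d, rfl⟩
  let e : Option (Fin d) ≃ Fin (d + 1) := (finSuccEquiv d).symm
  obtain ⟨p, hp⟩ := ExpChar.exists (ResidueField S)
  haveI : ExpChar (MvPowerSeries (Option (Fin d)) (ResidueField S)) p :=
    expChar_of_injective_ringHom (f := MvPowerSeries.C) MvPowerSeries.C_injective p
  refine izumi_of_param (σ := Option (Fin d)) (V := ResidueField S) hS 0 ?_ ?_ ι ?_ ?_ (x ∘ e) (fun i => hx _) h ?_ ?_ propN_ps_field p
    (fun n => hasPsi_ps p n)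
  · rw [Ideal.span_singleton_eq_bot.2 rfl]
    exact IsLocalRing.isField_iff_maximalIdeal_eq.1 (Field.toIsField _)
  · rw [Ideal.span_singleton_eq_bot.2 rfl]; infer_instance
  · rw [map_zero]; exact zero_mem _
  · intro s
    refine ⟨ι (residue S s) |> fun _ => residue S s, ?_⟩
    rw [← residue_eq_zero_iff, map_sub, hι, sub_self]
  · refine hh.trans (Ideal.span_mono ?_)
    rw [EquivLike.range_comp x e]
    exact Set.subset_insert _ _
  · rw [← hd]
    have := spanFinrank_MPI_zero (σ := Option (Fin d)) (k := ResidueField S)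
    rw [Nat.card_eq_fintype_card, Fintype.card_option, Fintype.card_fin] at this
    exact_mod_cast this

/-- mixed characteristic -/
theorem izu_of_coeff_ring {V S : Type*} [CommRing V] [IsDomain V] [IsNoetherianRing V] [IsLocalRing V] [CharZero V]
    [CommRing S] [IsDomain S] [IsNoetherianRing S] [IsLocalRing S]
    (hS : IsAdicComplete (maximalIdeal S) S) (π : V) (hπ0 : π ≠ 0) (hπ : maximalIdeal V = Ideal.span {π})
    (hV : IsAdicComplete (Ideal.span {π}) V) (g : V →+* S) (hg : g π ∈ maximalIdeal S) (hg0 : g π ≠ 0)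
    (hres : ∀ s, ∃ v, s - g v ∈ maximalIdeal S) : Izu S (maximalIdeal S) := by
  let I := Ideal.span {g π}
  have hI : I ≤ maximalIdeal S := (Ideal.span_singleton_le_iff_mem _).2 hg
  haveI : Nontrivial (S ⧸ I) := Ideal.Quotient.nontrivial_iff.2 (fun h => Ideal.IsPrime.ne_top' (top_le_iff.1 (h ▸ hI)))
  haveI : IsLocalRing (S ⧸ I) := IsLocalRing.of_surjective' _ Ideal.Quotient.mk_surjective
  have hmax : ∀ z : S, Ideal.Quotient.mk I z ∈ maximalIdeal (S ⧸ I) ↔ z ∈ maximalIdeal S := by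
    intro z
    have : IsLocalHom (Ideal.Quotient.mk I) := IsLocalHom.of_surjective _ Ideal.Quotient.mk_surjective
    rw [mem_maximalIdeal, mem_maximalIdeal, mem_nonunits_iff, mem_nonunits_iff, isUnit_map_iff]
  obtain ⟨d, x', h, hd, hx', hh⟩ := exists_sop (S ⧸ I)
  choose x hx using fun i => Ideal.Quotient.mk_surjective (I := I) (x' i)
  haveI : CharZero (MvPowerSeries (Fin d) V) := charZero_of_injective_ringHom (MvPowerSeries.C_injective (σ := Fin d) (R := V))
  have hdS : ((d + 1 : ℕ) : WithBot ℕ∞) ≤ ringKrullDim S := by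
    push_cast
    rw [hd]
    exact ringKrullDim_quotient_succ_le_of_nonZeroDivisor (mem_nonZeroDivisors_of_ne_zero hg0)
  refine izumi_of_param (σ := Fin d) hS π hπ hV g hg hres x (fun i => ?_) h ?_ ?_ ?_ 1 ?_
  · rw [← hmax, hx]; exact hx' i
  · intro z hz
    have h1 : Ideal.Quotient.mk I z ∈ maximalIdeal (S ⧸ I) ^ h := by
      have := Ideal.mem_map_of_mem (Ideal.Quotient.mk I) hz
      rw [Ideal.map_pow] at this
      exact Ideal.pow_right_mono (Ideal.map_le_iff_le_comap.2 fun y (hy : y ∈ maximalIdeal S) => Ideal.mem_comap.2 ((hmax y).2 hy)) h this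
    have h2 := hh h1
    have h3 : Ideal.span (Set.range x') = (Ideal.span (Set.range x)).map (Ideal.Quotient.mk I) := by
      rw [Ideal.map_span]
      congr 1
      ext y
      simp [hx]
    rw [h3, Ideal.mem_map_iff_of_surjective _ Ideal.Quotient.mk_surjective] at h2
    obtain ⟨w, hw, hwz⟩ := h2
    rw [Ideal.Quotient.mk_eq_mk_iff_sub_mem] at hwz
    have h4 : z = w - (w - z) := by ring
    rw [h4]
    refine Ideal.sub_mem _ (Ideal.span_mono (Set.subset_insert _ _) hw) (Ideal.span_mono ?_ hwz)
    simp
  · refine le_trans ?_ hdS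
    have := spanFinrank_MPI (σ := Fin d) π
    rw [Nat.card_eq_fintype_card, Fintype.card_fin] at this
    exact_mod_cast this
  · exact propN_ps π hπ0 (residue V) residue_surjective (by rw [ker_residue, hπ])
  · intro n
    rw [one_pow]
    exact hasPsi_one _ _

end Izumi

end

section

namespace Izumi

open IsLocalRing

/-- Sections of square-zero extensions of a field in characteristic `p`. -/
lemma sz_section {B k : Type*} [CommRing B] [Field k] (p : ℕ) [hp : Fact p.Prime] [CharP B p] (q : B →+* k)
    (hq : Function.Surjective q) (hker : ∀ x y, q x = 0 → q y = 0 → x * y = 0) :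
    ∃ s : k →+* B, ∀ x, q (s x) = x := by
  classical
  haveI : CharP k p := (CharP.charP_iff_prime_eq_zero hp.1).2 (by
    have : ((p : B)) = 0 := CharP.cast_eq_zero B p
    have h2 := congrArg q this
    rwa [map_natCast, map_zero] at h2)
  let good : Set (Subring B) := {W | (∀ b, b ^ p ∈ W) ∧ ∀ w ∈ W, q w = 0 → w = 0}
  have h0 : (frobenius B p).range ∈ good := by
    refine ⟨fun b => ⟨b, rfl⟩, ?_⟩
    rintro w ⟨b, rfl⟩ hb
    rw [frobenius_def] at hb ⊢
    rw [map_pow] at hb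
    have hb' := (pow_eq_zero_iff hp.1.ne_zero).1 hb
    have : b ^ p = b * b * b ^ (p - 2) := by
      rw [← pow_two, ← pow_add]; congr 1; have := hp.1.two_le; omega
    rw [this, hker b b hb' hb', zero_mul]
  obtain ⟨W, hW0, hW⟩ := zorn_le_nonempty₀ good (by
    intro c hc hch y hy
    have hdir := hch.directedOn
    refine ⟨sSup c, ⟨fun b => ?_, fun w hw hqw => ?_⟩, fun z hz => le_sSup hz⟩
    · exact (le_sSup hy : y ≤ sSup c) ((hc hy).1 b)
    · obtain ⟨U, hU, hwU⟩ := (Subring.mem_sSup_of_directedOn ⟨y, hy⟩ hdir).1 hw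
      exact (hc hU).2 w hwU hqw) _ h0
  have hWg := hW.1
  have hmax := hW.2
  -- W maps onto k
  have hsurj : ∀ β : k, ∃ w ∈ W, q w = β := by
    intro β
    by_contra hβ
    push Not at hβ
    obtain ⟨b, rfl⟩ := hq β
    let φ : W →+* k := q.comp W.subtype
    have hφ : Function.Injective φ := by
      rw [injective_iff_map_eq_zero]
      intro w hw
      exact Subtype.ext (hWg.2 w w.2 hw)
    have hfield : IsField W := by
      haveI : IsDomain W := hφ.isDomain φ
      refine ⟨⟨0, 1, zero_ne_one⟩, mul_comm, ?_⟩
      intro a ha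
      have hφa : φ a ≠ 0 := fun h => ha (hφ (by rw [h, map_zero]))
      obtain ⟨c, hc⟩ := hq ((φ a)⁻¹)
      refine ⟨a ^ (p - 1) * ⟨c ^ p, hWg.1 c⟩, hφ ?_⟩
      have h1 : φ ⟨c ^ p, hWg.1 c⟩ = (φ a)⁻¹ ^ p := by
        show q (c ^ p) = _
        rw [map_pow, hc]
      rw [map_mul, map_mul, map_pow, h1, map_one, ← mul_assoc, ← pow_succ',
        Nat.sub_add_cancel hp.1.one_le, ← mul_pow, mul_inv_cancel₀ hφa, one_pow]
    letI := hfield.toField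
    let b' : W := ⟨b ^ p, hWg.1 b⟩
    have hirr : Irreducible (Polynomial.X ^ p - Polynomial.C b' : Polynomial W) := by
      apply X_pow_sub_C_irreducible_of_prime hp.1
      intro c hc
      have h1 := congrArg φ hc
      have h2 : (q c) ^ p = (q b) ^ p := by
        rw [map_pow] at h1
        rw [← map_pow q b]
        exact h1
      exact hβ c c.2 (frobenius_inj k p h2)
    let ev : Polynomial W →+* B := Polynomial.eval₂RingHom W.subtype b
    have hev : ∀ P, q (ev P) = P.eval₂ φ (q b) := by
      intro P
      simp only [ev, Polynomial.coe_eval₂RingHom]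
      rw [Polynomial.hom_eval₂]
    have hmem : ev.range ∈ good := by
      refine ⟨fun c => ⟨Polynomial.C ⟨c ^ p, hWg.1 c⟩, by simp [ev]⟩, ?_⟩
      rintro _ ⟨P, rfl⟩ hP
      have hdvd : (Polynomial.X ^ p - Polynomial.C b' : Polynomial W) ∣ P := by
        rcases (EuclideanDomain.dvd_or_coprime _ P hirr).symm with h | h
        · exfalso
          obtain ⟨u, v, huv⟩ := h
          have := congrArg (Polynomial.eval₂RingHom φ (q b)) huv
          rw [map_add, map_mul, map_mul, map_one] at this
          have e1 : Polynomial.eval₂RingHom φ (q b) P = 0 := by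
            rw [← hP, hev]; rfl
          have e2 : Polynomial.eval₂RingHom φ (q b) (Polynomial.X ^ p - Polynomial.C b') = 0 := by
            have : φ b' = q b ^ p := by
              show q (b ^ p) = _
              rw [map_pow]
            simp [this]
          rw [e1, e2] at this
          simp at this
        · exact h
      obtain ⟨R, rfl⟩ := hdvd
      rw [map_mul]
      have : ev (Polynomial.X ^ p - Polynomial.C b') = 0 := by
        simp [ev, b']
      rw [this, zero_mul]
    have hle : W ≤ ev.range := fun w hw => ⟨Polynomial.C ⟨w, hw⟩, by simp [ev]⟩
    have hb : b ∈ ev.range := ⟨Polynomial.X, by simp [ev]⟩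
    exact hβ b (hmax hmem hle hb) rfl
  let φ : W →+* k := q.comp W.subtype
  have hφ : Function.Bijective φ := by
    constructor
    · rw [injective_iff_map_eq_zero]
      intro w hw
      exact Subtype.ext (hWg.2 w w.2 hw)
    · intro β
      obtain ⟨w, hw, h⟩ := hsurj β
      exact ⟨⟨w, hw⟩, h⟩
  let e := RingEquiv.ofBijective φ hφ
  refine ⟨W.subtype.comp e.symm.toRingHom, fun x => ?_⟩
  exact e.apply_symm_apply x

end Izumi

end

section

namespace Izumi

open IsLocalRing

lemma formallySmooth_zmod (p : ℕ) [hp : Fact p.Prime] (k : Type*) [Field k] [Algebra (ZMod p) k] :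
    Algebra.FormallySmooth (ZMod p) k := by
  let f : MvPolynomial k (ZMod p) →ₐ[ZMod p] k := MvPolynomial.aeval id
  have hf : Function.Surjective f := fun x => ⟨MvPolynomial.X x, by simp [f]⟩
  have hks : ∀ x, f.kerSquareLift (Ideal.Quotient.mk _ x) = f x := fun x => rfl
  haveI : Nontrivial (MvPolynomial k (ZMod p) ⧸ RingHom.ker f.toRingHom ^ 2) :=
    f.kerSquareLift.toRingHom.domain_nontrivial
  haveI : CharP (MvPolynomial k (ZMod p) ⧸ RingHom.ker f.toRingHom ^ 2) p :=
    (CharP.charP_iff_prime_eq_zero hp.1).2 (by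
      have : ((p : ZMod p)) = 0 := CharP.cast_eq_zero _ p
      have h2 := congrArg (algebraMap (ZMod p) (MvPolynomial k (ZMod p) ⧸ RingHom.ker f.toRingHom ^ 2)) this
      rwa [map_natCast, map_zero] at h2)
  obtain ⟨s, hs⟩ := sz_section p f.kerSquareLift.toRingHom (fun x => by
      obtain ⟨y, rfl⟩ := hf x
      exact ⟨Ideal.Quotient.mk _ y, rfl⟩) (by
      intro x y hx hy
      obtain ⟨x, rfl⟩ := Ideal.Quotient.mk_surjective x
      obtain ⟨y, rfl⟩ := Ideal.Quotient.mk_surjective y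
      rw [← map_mul, Ideal.Quotient.eq_zero_iff_mem, pow_two]
      exact Ideal.mul_mem_mul hx hy)
  refine Algebra.FormallySmooth.of_split f { s with commutes' := fun r => ?_ } (AlgHom.ext hs)
  exact RingHom.congr_fun (Subsingleton.elim (s.comp (algebraMap (ZMod p) k)) (algebraMap _ _)) r

lemma formallySmooth_rat (k : Type*) [Field k] [Algebra ℚ k] :
    Algebra.FormallySmooth ℚ k := by
  obtain ⟨s, hs⟩ := exists_isTranscendenceBasis ℚ k
  have := hs.isAlgebraic_field
  haveI : CharZero (IntermediateField.adjoin ℚ (Set.range ((↑) : s → k))) := algebraRat.charZero _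
  haveI : Algebra.IsSeparable (IntermediateField.adjoin ℚ (Set.range ((↑) : s → k))) k := inferInstance
  exact Algebra.FormallySmooth.of_algebraicIndependent_of_isSeparable hs.1

lemma section_of_smooth {F T k : Type*} [Field F] [CommRing T] [Field k] [Algebra F T] [Algebra F k]
    [Algebra.FormallySmooth F k] (q : T →ₐ[F] k) (hq : Function.Surjective q)
    (hc : IsAdicComplete (RingHom.ker q) T) : ∃ s : k →+* T, ∀ x, q (s x) = x := by
  obtain ⟨g, hg⟩ := Algebra.FormallySmooth.exists_mkₐ_comp_eq_of_isAdicComplete (I := RingHom.ker q)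
    (Ideal.quotientKerAlgEquivOfSurjective hq).symm.toAlgHom
  refine ⟨g.toRingHom, fun x => ?_⟩
  have := congrArg (Ideal.quotientKerAlgEquivOfSurjective hq) (AlgHom.congr_fun hg x)
  simpa using this

lemma section_p {T k : Type*} [CommRing T] [Field k] (p : ℕ) [hp : Fact p.Prime] (hpT : (p : T) = 0)
    (q : T →+* k) (hq : Function.Surjective q)
    (hc : IsAdicComplete (RingHom.ker q) T) : ∃ s : k →+* T, ∀ x, q (s x) = x := by
  haveI : Nontrivial T := q.domain_nontrivial
  haveI : CharP T p := (CharP.charP_iff_prime_eq_zero hp.1).2 hpT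
  letI : Algebra (ZMod p) T := ZMod.algebra T p
  letI : Algebra (ZMod p) k := (q.comp (algebraMap (ZMod p) T)).toAlgebra
  haveI := formallySmooth_zmod p k
  let q' : T →ₐ[ZMod p] k := { q with commutes' := fun r => rfl }
  exact section_of_smooth q' hq hc

lemma section_zero {T k : Type*} [CommRing T] [Field k] [Algebra ℚ T]
    (q : T →+* k) (hq : Function.Surjective q)
    (hc : IsAdicComplete (RingHom.ker q) T) : ∃ s : k →+* T, ∀ x, q (s x) = x := by
  letI : Algebra ℚ k := (q.comp (algebraMap ℚ T)).toAlgebra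
  haveI := formallySmooth_rat k
  let q' : T →ₐ[ℚ] k := { q with commutes' := fun r => rfl }
  exact section_of_smooth q' hq hc

end Izumi

end

section

namespace Izumi

open IsLocalRing

lemma padic_lim {S : Type*} [CommRing S] {M : Ideal S} (hM : IsAdicComplete M S) {π : S} (hπ : π ∈ M)
    (f : ℕ → S) (u : ℕ → S) (hf : ∀ n, f (n + 1) = f n + π ^ n * u n) :
    ∃ v, ∀ n, ∃ w, v - f n = π ^ n * w := by
  have := fun i => prec_lim hM.toIsPrecomplete (fun N => ∑ l ∈ Finset.range N, π ^ l * u (i + l)) (fun n => by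
    simp only [Finset.sum_range_succ, add_sub_cancel_left]
    exact Ideal.mul_mem_right _ _ (Ideal.pow_mem_pow hπ n))
  choose L hL using this
  have hrec : ∀ i, L i = u i + π * L (i + 1) := by
    intro i
    rw [← sub_eq_zero]
    apply haus_zero hM.toIsHausdorff
    intro n
    have h1 := Ideal.pow_le_pow_right (Nat.le_succ n) (hL i (n + 1))
    have h2 := Ideal.mul_mem_left _ π (hL (i + 1) n)
    have h3 := Ideal.sub_mem _ h1 h2
    rw [Finset.sum_range_succ'] at h3
    convert h3 using 1
    simp only [pow_zero, add_zero, one_mul, mul_sub, Finset.mul_sum]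
    have : ∀ l, π ^ (l + 1) * u (i + (l + 1)) = π * (π ^ l * u (i + 1 + l)) := by
      intro l; rw [pow_succ', mul_assoc, show i + (l + 1) = i + 1 + l by omega]
    simp only [this]
    ring
  refine ⟨f 0 + L 0, fun n => ⟨L n, ?_⟩⟩
  induction n with
  | zero => simp
  | succ n ih =>
    rw [hf, ← sub_sub, ih, hrec n]; ring

lemma complete_quot {S : Type*} [CommRing S] [IsNoetherianRing S] [IsLocalRing S]
    (hS : IsAdicComplete (maximalIdeal S) S) (I : Ideal S) (hI : I ≤ maximalIdeal S) :
    IsAdicComplete ((maximalIdeal S).map (Ideal.Quotient.mk I)) (S ⧸ I) := by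
  haveI : Nontrivial (S ⧸ I) := Ideal.Quotient.nontrivial_iff.2 (fun h => Ideal.IsPrime.ne_top' (top_le_iff.1 (h ▸ hI)))
  haveI : IsLocalRing (S ⧸ I) := IsLocalRing.of_surjective' _ Ideal.Quotient.mk_surjective
  have hloc : IsLocalHom (Ideal.Quotient.mk I) := IsLocalHom.of_surjective _ Ideal.Quotient.mk_surjective
  have hne : (maximalIdeal S).map (Ideal.Quotient.mk I) ≠ ⊤ := by
    have h1 : (maximalIdeal S).map (Ideal.Quotient.mk I) ≤ maximalIdeal (S ⧸ I) :=
      ((local_hom_TFAE (Ideal.Quotient.mk I)).out 0 2).1 hloc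
    intro h
    exact Ideal.IsPrime.ne_top' (top_le_iff.1 (h ▸ h1))
  have lift : ∀ n (x : S ⧸ I), x ∈ ((maximalIdeal S).map (Ideal.Quotient.mk I)) ^ n →
      ∃ y ∈ maximalIdeal S ^ n, Ideal.Quotient.mk I y = x := by
    intro n x hx
    rw [← Ideal.map_pow, Ideal.mem_map_iff_of_surjective _ Ideal.Quotient.mk_surjective] at hx
    exact hx
  apply isAdicComplete_of
  · intro x hx
    have := Ideal.iInf_pow_eq_bot_of_isLocalRing _ hne
    have h2 : x ∈ (⨅ i : ℕ, ((maximalIdeal S).map (Ideal.Quotient.mk I)) ^ i) := by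
      rw [Ideal.mem_iInf]; exact hx
    rw [this] at h2
    exact h2
  · intro f hf
    choose d hd hd' using fun n => lift n _ (hf n)
    obtain ⟨f0, hf0⟩ := Ideal.Quotient.mk_surjective (f 0)
    let F : ℕ → S := fun n => f0 + ∑ i ∈ Finset.range n, d i
    have hF : ∀ n, Ideal.Quotient.mk I (F n) = f n := by
      intro n
      induction n with
      | zero => simp [F, hf0]
      | succ n ih =>
        simp only [F, Finset.sum_range_succ, ← add_assoc] at ih ⊢
        rw [map_add, ih, hd']; ring
    obtain ⟨L, hL⟩ := prec_lim hS.toIsPrecomplete F (fun n => by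
      simp only [F, Finset.sum_range_succ, ← add_assoc, add_sub_cancel_left]
      exact hd n)
    refine ⟨Ideal.Quotient.mk I L, fun n => ?_⟩
    rw [← hF, ← map_sub, ← Ideal.map_pow]
    exact Ideal.mem_map_of_mem _ (hL n)

def Good {S k : Type*} [CommRing S] [Field k] (q : S →+* k) (π : S) (E' E : Subring S) : Prop :=
  E ≤ E' ∧ (∀ x ∈ E', π * x ∈ E) ∧ (∀ y : k, ∃ e ∈ E, q e = y) ∧
    (∀ e ∈ E, q e = 0 → ∃ f ∈ E', e = π * f)

lemma good_init {S : Type*} [CommRing S] [IsNoetherianRing S] [IsLocalRing S]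
    (hS : IsAdicComplete (maximalIdeal S) S) (p : ℕ) [hp : Fact p.Prime] (hpS : (p : S) ∈ maximalIdeal S) :
    ∃ E, Good (residue S) (p : S) ⊤ E := by
  let I := Ideal.span {(p : S)}
  have hI : I ≤ maximalIdeal S := (Ideal.span_singleton_le_iff_mem _).2 hpS
  let q : S ⧸ I →+* ResidueField S := Ideal.Quotient.lift I (residue S) (fun a ha => (residue_eq_zero_iff a).2 (hI ha))
  have hqs : Function.Surjective q := Ideal.Quotient.lift_surjective_of_surjective _ _ residue_surjective
  have hker : RingHom.ker q = (maximalIdeal S).map (Ideal.Quotient.mk I) := by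
    exact (Ideal.ker_quotient_lift _ _).trans (by rw [ker_residue])
  obtain ⟨s, hs⟩ := section_p p (by
    rw [← map_natCast (Ideal.Quotient.mk I), Ideal.Quotient.eq_zero_iff_mem]
    exact Ideal.mem_span_singleton_self _) q hqs (by rw [hker]; exact complete_quot hS I hI)
  refine ⟨s.range.comap (Ideal.Quotient.mk I), le_top, fun x _ => ?_, fun y => ?_, fun e he hqe => ?_⟩
  · rw [Subring.mem_comap]
    have : Ideal.Quotient.mk I (p * x) = 0 := by
      rw [Ideal.Quotient.eq_zero_iff_mem]
      exact Ideal.mul_mem_right _ _ (Ideal.mem_span_singleton_self _)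
    rw [this]; exact zero_mem _
  · obtain ⟨e, he⟩ := Ideal.Quotient.mk_surjective (s y)
    refine ⟨e, ⟨y, he.symm⟩, ?_⟩
    have : q (Ideal.Quotient.mk I e) = residue S e := rfl
    rw [← this, he, hs]
  · obtain ⟨y, hy⟩ := he
    have h1 : q (Ideal.Quotient.mk I e) = residue S e := rfl
    rw [← hy, hs, hqe] at h1
    rw [h1, map_zero, eq_comm, Ideal.Quotient.eq_zero_iff_mem, Ideal.mem_span_singleton] at hy
    obtain ⟨f, rfl⟩ := hy
    exact ⟨f, trivial, rfl⟩

lemma good_step {S k : Type*} [CommRing S] [Field k] (p : ℕ) [hp : Fact p.Prime] (q : S →+* k)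
    (hq : q (p : S) = 0)
    {E' E : Subring S} (h : Good q (p : S) E' E) : ∃ E'', Good q (p : S) E E'' := by
  obtain ⟨h1, h2, h3, h4⟩ := h
  let I : Ideal E := Ideal.span {(p : E)}
  have hIq : ∀ a ∈ I, (q.comp E.subtype) a = 0 := by
    intro a ha
    obtain ⟨b, rfl⟩ := Ideal.mem_span_singleton.1 ha
    rw [map_mul, map_natCast]
    rw [map_natCast] at hq
    rw [hq, zero_mul]
  let Q : E ⧸ I →+* k := Ideal.Quotient.lift I (q.comp E.subtype) hIq
  have hQ : ∀ e : E, Q (Ideal.Quotient.mk I e) = q e := fun _ => rfl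
  haveI : Nontrivial (E ⧸ I) := Q.domain_nontrivial
  haveI : CharP (E ⧸ I) p := (CharP.charP_iff_prime_eq_zero hp.1).2 (by
    rw [← map_natCast (Ideal.Quotient.mk I), Ideal.Quotient.eq_zero_iff_mem]
    exact Ideal.mem_span_singleton_self _)
  obtain ⟨s, hs⟩ := sz_section p Q (fun y => by
    obtain ⟨e, he, rfl⟩ := h3 y
    exact ⟨Ideal.Quotient.mk I ⟨e, he⟩, rfl⟩) (by
    intro x y hx hy
    obtain ⟨x, rfl⟩ := Ideal.Quotient.mk_surjective x
    obtain ⟨y, rfl⟩ := Ideal.Quotient.mk_surjective y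
    rw [hQ] at hx hy
    obtain ⟨f, hf, hxf⟩ := h4 x x.2 hx
    obtain ⟨g, hg, hyg⟩ := h4 y y.2 hy
    rw [← map_mul, Ideal.Quotient.eq_zero_iff_mem, Ideal.mem_span_singleton]
    refine ⟨⟨p * (f * g), h2 _ (mul_mem hf hg)⟩, Subtype.ext ?_⟩
    simp only [Subring.coe_mul, hxf, hyg]
    push_cast
    ring)
  refine ⟨(s.range.comap (Ideal.Quotient.mk I)).map E.subtype, ?_, ?_, ?_, ?_⟩
  · rintro _ ⟨e, -, rfl⟩
    exact e.2
  · intro x hx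
    refine ⟨(p : E) * ⟨x, hx⟩, ?_, by simp⟩
    show _ ∈ s.range.comap (Ideal.Quotient.mk I)
    rw [Subring.mem_comap]
    have : Ideal.Quotient.mk I ((p : E) * ⟨x, hx⟩) = 0 := by
      rw [Ideal.Quotient.eq_zero_iff_mem]
      exact Ideal.mul_mem_right _ _ (Ideal.mem_span_singleton_self _)
    rw [this]; exact zero_mem _
  · intro y
    obtain ⟨e, he⟩ := Ideal.Quotient.mk_surjective (s y)
    refine ⟨e, ⟨e, ⟨y, he.symm⟩, rfl⟩, ?_⟩
    rw [← hQ, he, hs]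
  · rintro _ ⟨e, ⟨y, hy⟩, rfl⟩ hqe
    have h5 := hQ e
    rw [← hy, hs] at h5
    have h6 : y = 0 := h5.trans hqe
    rw [h6, map_zero, eq_comm, Ideal.Quotient.eq_zero_iff_mem, Ideal.mem_span_singleton] at hy
    obtain ⟨f, rfl⟩ := hy
    exact ⟨f, f.2, by simp⟩

lemma exists_good_seq {S : Type*} [CommRing S] [IsNoetherianRing S] [IsLocalRing S]
    (hS : IsAdicComplete (maximalIdeal S) S) (p : ℕ) [hp : Fact p.Prime] (hpS : (p : S) ∈ maximalIdeal S) :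
    ∃ E : ℕ → Subring S, E 0 = ⊤ ∧ ∀ n, Good (residue S) (p : S) (E n) (E (n + 1)) := by
  obtain ⟨E1, hE1⟩ := good_init hS p hpS
  let St := {x : Subring S × Subring S // Good (residue S) (p : S) x.1 x.2}
  have hst : ∀ x : St, ∃ y : St, y.1.1 = x.1.2 := by
    rintro ⟨x, hx⟩
    obtain ⟨E'', h⟩ := good_step p (residue S) ((residue_eq_zero_iff _).2 hpS) hx
    exact ⟨⟨(x.2, E''), h⟩, rfl⟩
  choose step hstep using hst
  let sq : ℕ → St := fun n => Nat.rec ⟨(⊤, E1), hE1⟩ (fun _ x => step x) n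
  refine ⟨fun n => (sq n).1.1, rfl, fun n => ?_⟩
  have : (sq (n + 1)).1.1 = (sq n).1.2 := hstep (sq n)
  simp only [this]
  exact (sq n).2

end Izumi

end

section

namespace Izumi

open IsLocalRing

section mixed
variable {S : Type*} [CommRing S] [IsDomain S] [IsNoetherianRing S] [IsLocalRing S]
    {p : ℕ} {E : ℕ → Subring S}

lemma gs_pow (h0 : E 0 = ⊤) (hE : ∀ n, Good (residue S) (p : S) (E n) (E (n + 1))) (n : ℕ) (x : S) :
    (p : S) ^ n * x ∈ E n := by
  induction n with
  | zero => rw [h0]; trivial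
  | succ n ih => rw [pow_succ', mul_assoc]; exact (hE n).2.1 _ ih

lemma gs_step (hE : ∀ n, Good (residue S) (p : S) (E n) (E (n + 1))) (n : ℕ) :
    ∀ e ∈ E n, ∃ e' ∈ E (n + 1), ∃ w, e' = e + (p : S) ^ n * w := by
  induction n with
  | zero => exact fun e _ => ⟨0, zero_mem _, -e, by simp⟩
  | succ n ih =>
    intro e he
    obtain ⟨e', he', hr⟩ := (hE (n + 1)).2.2.1 (residue S e)
    obtain ⟨f, hf, hef⟩ := (hE n).2.2.2 (e - e') (sub_mem he ((hE (n+1)).1 he')) (by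
      rw [map_sub, hr, sub_self])
    obtain ⟨f', hf', w, hw⟩ := ih f hf
    refine ⟨e' + p * f', add_mem he' ((hE (n+1)).2.1 _ hf'), w, ?_⟩
    rw [hw, mul_add, ← hef]; ring

lemma gs_lim (hS : IsAdicComplete (maximalIdeal S) S) (hpS : (p : S) ∈ maximalIdeal S)
    (h0 : E 0 = ⊤) (hE : ∀ n, Good (residue S) (p : S) (E n) (E (n + 1)))
    (f u : ℕ → S) (hf : ∀ n, f n ∈ E n) (hfu : ∀ n, f (n + 1) = f n + (p : S) ^ n * u n) :
    ∃ v ∈ (⨅ n, E n : Subring S), ∀ n, ∃ w, v - f n = (p : S) ^ n * w := by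
  obtain ⟨v, hv⟩ := padic_lim hS hpS f u hfu
  refine ⟨v, ?_, hv⟩
  rw [Subring.mem_iInf]
  intro n
  obtain ⟨w, hw⟩ := hv n
  rw [sub_eq_iff_eq_add.1 hw]
  exact add_mem (gs_pow h0 hE n w) (hf n)

lemma gs_div (hp0 : (p : S) ≠ 0) (hE : ∀ n, Good (residue S) (p : S) (E n) (E (n + 1)))
    {v : S} (hv : v ∈ (⨅ n, E n : Subring S)) (h : residue S v = 0) :
    ∃ w ∈ (⨅ n, E n : Subring S), v = p * w := by
  rw [Subring.mem_iInf] at hv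
  have h1 := fun n => (hE n).2.2.2 v (hv (n + 1)) h
  choose f hf hvf using h1
  refine ⟨f 0, ?_, hvf 0⟩
  rw [Subring.mem_iInf]
  intro n
  have : f 0 = f n := mul_left_cancel₀ hp0 ((hvf 0).symm.trans (hvf n))
  rw [this]; exact hf n

lemma gs_div_pow (hp0 : (p : S) ≠ 0) (hpS : (p : S) ∈ maximalIdeal S)
    (hE : ∀ n, Good (residue S) (p : S) (E n) (E (n + 1)))
    (n : ℕ) (w : S) (hv : (p : S) ^ n * w ∈ (⨅ n, E n : Subring S)) : w ∈ (⨅ n, E n : Subring S) := by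
  induction n with
  | zero => simpa using hv
  | succ n ih =>
    apply ih
    rw [pow_succ', mul_assoc] at hv
    obtain ⟨w', hw', h⟩ := gs_div hp0 hE hv ((residue_eq_zero_iff _).2 (Ideal.mul_mem_right _ _ hpS))
    rw [mul_left_cancel₀ hp0 h]; exact hw'

lemma gs_surj (hS : IsAdicComplete (maximalIdeal S) S) (hpS : (p : S) ∈ maximalIdeal S)
    (h0 : E 0 = ⊤) (hE : ∀ n, Good (residue S) (p : S) (E n) (E (n + 1))) (y : ResidueField S) :
    ∃ v ∈ (⨅ n, E n : Subring S), residue S v = y := by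
  obtain ⟨e1, he1, rfl⟩ := (hE 0).2.2.1 y
  have hst : ∀ n (x : E (n + 1)), ∃ y : E (n + 2), ∃ w, (y : S) = x + (p : S) ^ (n + 1) * w := by
    rintro n ⟨x, hx⟩
    obtain ⟨e', h, w, hw⟩ := gs_step hE (n + 1) x hx
    exact ⟨⟨e', h⟩, w, hw⟩
  choose st W hW using hst
  let g : (n : ℕ) → E (n + 1) := fun n => Nat.rec ⟨e1, he1⟩ (fun n x => st n x) n
  have hg : ∀ n, g (n + 1) = st n (g n) := fun n => rfl
  obtain ⟨v, hv, hl⟩ := gs_lim hS hpS h0 hE (fun n => (g n).1) (fun n => p * W n (g n))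
    (fun n => by exact (hE n).1 (g n).2) (fun n => by
      show (g (n + 1) : S) = _
      rw [hg, hW]; ring)
  refine ⟨v, hv, ?_⟩
  obtain ⟨w, hw⟩ := hl 1
  have h2 : (g 1).1 = e1 + (p : S) ^ 1 * W 0 (g 0) := by
    exact hW 0 (g 0)
  rw [sub_eq_iff_eq_add.1 hw, h2]
  have : residue S (p : S) = 0 := (residue_eq_zero_iff _).2 hpS
  simp only [map_add, map_mul, map_pow, this]
  simp

lemma gs_complete (hS : IsAdicComplete (maximalIdeal S) S) (hpS : (p : S) ∈ maximalIdeal S)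
    (hp0 : (p : S) ≠ 0)
    (h0 : E 0 = ⊤) (hE : ∀ n, Good (residue S) (p : S) (E n) (E (n + 1))) :
    IsAdicComplete (Ideal.span {((p : ℕ) : (⨅ n, E n : Subring S))}) (⨅ n, E n : Subring S) := by
  apply isAdicComplete_of
  · intro x hx
    apply Subtype.ext
    apply haus_zero hS.toIsHausdorff
    intro n
    have := hx n
    rw [Ideal.span_singleton_pow, Ideal.mem_span_singleton] at this
    obtain ⟨y, rfl⟩ := this
    push_cast
    exact Ideal.mul_mem_right _ _ (Ideal.pow_mem_pow hpS n)
  · intro f hf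
    simp only [Ideal.span_singleton_pow, Ideal.mem_span_singleton] at hf ⊢
    choose u hu using hf
    obtain ⟨v, hv, hl⟩ := gs_lim hS hpS h0 hE (fun n => (f n : S)) (fun n => (u n : S))
      (fun n => (Subring.mem_iInf.1 (f n).2) n) (fun n => by
        have := congrArg Subtype.val (sub_eq_iff_eq_add'.1 (hu n))
        simpa using this)
    refine ⟨⟨v, hv⟩, fun n => ?_⟩
    obtain ⟨w, hw⟩ := hl n
    have hmem : (p : S) ^ n * w ∈ (⨅ n, E n : Subring S) := hw ▸ sub_mem hv (f n).2
    refine ⟨⟨w, gs_div_pow hp0 hpS hE n w hmem⟩, Subtype.ext ?_⟩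
    simpa using hw

end mixed

/-- A `π`-complete domain `V` in which every nonmultiple of `π` is a unit is local Noetherian. -/
lemma dvr_like {V : Type*} [CommRing V] [IsDomain V] (π : V)
    (hV : IsAdicComplete (Ideal.span {π}) V) (hπ : ¬ IsUnit π)
    (hu : ∀ v, ¬ π ∣ v → IsUnit v) :
    ∃ _ : IsLocalRing V, IsNoetherianRing V ∧ maximalIdeal V = Ideal.span {π} := by
  have hiff : ∀ v, ¬ IsUnit v ↔ π ∣ v :=
    fun v => ⟨fun h => by_contra fun h' => h (hu v h'), fun h h' => hπ (isUnit_of_dvd_unit h h')⟩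
  have hloc : IsLocalRing V := IsLocalRing.of_nonunits_add (fun a b ha hb => by
    rw [mem_nonunits_iff, hiff] at *
    exact dvd_add ha hb)
  refine ⟨hloc, ?_, ?_⟩
  · have hm : (Ideal.span {π}).IsMaximal := by
      have : maximalIdeal V = Ideal.span {π} := by
        ext x
        rw [mem_maximalIdeal, mem_nonunits_iff, hiff, Ideal.mem_span_singleton]
      rw [← this]; infer_instance
    have : IsPrincipalIdealRing V := by
      apply IsPrincipalIdealRing.of_prime
      intro P hP
      by_cases h : π ∈ P
      · have := hm.eq_of_le hP.ne_top ((Ideal.span_singleton_le_iff_mem _).2 h)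
        exact ⟨π, this.symm⟩
      · have : P = ⊥ := by
          rw [eq_bot_iff]
          intro x hx
          have h1 : ∀ n, ∃ y ∈ P, x = π ^ n * y := by
            intro n
            induction n with
            | zero => exact ⟨x, hx, by simp⟩
            | succ n ih =>
              obtain ⟨y, hy, rfl⟩ := ih
              have : π ∣ y := (hiff y).1 (fun hyu => hP.ne_top (Ideal.eq_top_of_isUnit_mem _ hy hyu))
              obtain ⟨z, rfl⟩ := this
              exact ⟨z, (hP.mem_or_mem hy).resolve_left h, by ring⟩
          apply haus_zero hV.toIsHausdorff
          intro n
          obtain ⟨y, -, rfl⟩ := h1 n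
          exact Ideal.mul_mem_right _ _ (Ideal.pow_mem_pow (Ideal.mem_span_singleton_self _) n)
        rw [this]; infer_instance
    infer_instance
  · ext x
    rw [mem_maximalIdeal, mem_nonunits_iff, hiff, Ideal.mem_span_singleton]

lemma izu_mixed {S : Type*} [CommRing S] [IsDomain S] [IsNoetherianRing S] [IsLocalRing S]
    (hS : IsAdicComplete (maximalIdeal S) S) (p : ℕ) [hp : Fact p.Prime]
    (hpS : (p : S) ∈ maximalIdeal S) (hp0 : (p : S) ≠ 0) : Izu S (maximalIdeal S) := by
  obtain ⟨E, h0, hE⟩ := exists_good_seq hS p hpS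
  have hVc := gs_complete hS hpS hp0 h0 hE
  have hdvd : ∀ v : (⨅ n, E n : Subring S), residue S (v : S) = 0 → ((p : ℕ) : (⨅ n, E n : Subring S)) ∣ v := by
    rintro ⟨v, hv⟩ h
    obtain ⟨w, hw, rfl⟩ := gs_div hp0 hE hv h
    exact ⟨⟨w, hw⟩, Subtype.ext (by simp)⟩
  have hpr : residue S (p : S) = 0 := (residue_eq_zero_iff _).2 hpS
  obtain ⟨hloc, hN, hmax⟩ := dvr_like ((p : ℕ) : (⨅ n, E n : Subring S)) hVc (by
      intro h
      have h2 := (h.map (⨅ n, E n : Subring S).subtype).map (residue S)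
      have h3 : (residue S) ((⨅ n, E n : Subring S).subtype ((p : ℕ) : (⨅ n, E n : Subring S))) = 0 := by
        rw [map_natCast]; exact hpr
      rw [h3] at h2
      exact not_isUnit_zero h2) (by
      intro v hv
      have hv0 : residue S (v : S) ≠ 0 := fun h => hv (hdvd v h)
      obtain ⟨w, hw, hwr⟩ := gs_surj hS hpS h0 hE (residue S (v : S))⁻¹
      have h1 := hdvd (1 - v * ⟨w, hw⟩) (by
        push_cast
        rw [map_sub, map_mul, hwr, map_one, mul_inv_cancel₀ hv0, sub_self])
      have h2 : (1 - v * ⟨w, hw⟩) ∈ Ideal.jacobson (⊥ : Ideal (⨅ n, E n : Subring S)) :=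
        IsAdicComplete.le_jacobson_bot (Ideal.span {((p : ℕ) : (⨅ n, E n : Subring S))}) (Ideal.mem_span_singleton.2 h1)
      have h3 := Ideal.mem_jacobson_bot.1 h2 (-1)
      have h4 : (1 - v * ⟨w, hw⟩) * -1 + 1 = v * ⟨w, hw⟩ := by ring
      rw [h4] at h3
      exact isUnit_of_mul_isUnit_left h3)
  have hcS : CharZero S := by
    obtain ⟨ℓ, hℓ⟩ := CharP.exists S
    rcases CharP.char_is_prime_or_zero S ℓ with h | h
    · exfalso
      have h1 : residue S (ℓ : S) = 0 := by rw [CharP.cast_eq_zero, map_zero]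
      rw [map_natCast] at h1 hpr
      have h2 : ℓ ≠ p := by
        rintro rfl; exact hp0 (CharP.cast_eq_zero _ _)
      have h3 := Nat.isCoprime_iff_coprime.2 ((Nat.coprime_primes h hp.1).2 h2)
      obtain ⟨a, b, hab⟩ := h3
      have h4 := congrArg (Int.cast : ℤ → ResidueField S) hab
      push_cast at h4
      rw [h1, hpr] at h4
      simp at h4
    · subst h
      exact CharP.charP_to_charZero S
  have hcV : CharZero (⨅ n, E n : Subring S) := ⟨fun a b h => by
    have := congrArg (⨅ n, E n : Subring S).subtype h
    rw [map_natCast, map_natCast] at this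
    exact Nat.cast_injective this⟩
  refine izu_of_coeff_ring hS ((p : ℕ) : (⨅ n, E n : Subring S)) (by exact_mod_cast hp.1.ne_zero) hmax hVc
    (⨅ n, E n : Subring S).subtype (by rw [map_natCast]; exact hpS) (by rw [map_natCast]; exact hp0) ?_
  intro s
  obtain ⟨w, hw, hwr⟩ := gs_surj hS hpS h0 hE (residue S s)
  refine ⟨⟨w, hw⟩, ?_⟩
  rw [← residue_eq_zero_iff, map_sub, sub_eq_zero]
  exact hwr.symm

end Izumi

end

section

namespace Izumi

open IsLocalRing

lemma izu_complete {S : Type*} [CommRing S] [IsDomain S] [IsNoetherianRing S] [IsLocalRing S]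
    (hS : IsAdicComplete (maximalIdeal S) S) : Izu S (maximalIdeal S) := by
  obtain ⟨p, hp⟩ := CharP.exists (ResidueField S)
  rcases CharP.char_is_prime_or_zero (ResidueField S) p with h | h
  · haveI : Fact p.Prime := ⟨h⟩
    have hpS : (p : S) ∈ maximalIdeal S := by
      rw [← residue_eq_zero_iff, map_natCast]; exact CharP.cast_eq_zero _ _
    by_cases hp0 : (p : S) = 0
    · obtain ⟨s, hs⟩ := section_p p hp0 (residue S) residue_surjective (by rw [ker_residue]; exact hS)
      exact izu_of_coeff_field hS s hs
    · exact izu_mixed hS p hpS hp0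
  · subst h
    haveI : CharZero (ResidueField S) := CharP.charP_to_charZero _
    have hu : ∀ y : nonZeroDivisors ℤ, IsUnit (Int.castRingHom S y) := by
      intro y
      by_contra h
      have h1 : Int.castRingHom S y ∈ maximalIdeal S := h
      rw [← residue_eq_zero_iff] at h1
      have h2 : (((y : ℤ)) : ResidueField S) = 0 := by
        rw [← h1]; simp
      exact nonZeroDivisors.coe_ne_zero y (Int.cast_eq_zero.1 h2)
    letI : Algebra ℚ S := (IsLocalization.lift (M := nonZeroDivisors ℤ) (S := ℚ) hu).toAlgebra
    obtain ⟨s, hs⟩ := section_zero (residue S) residue_surjective (by rw [ker_residue]; exact hS)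
    exact izu_of_coeff_field hS s hs

end Izumi

end

section

namespace Izumi

open IsLocalRing

lemma dense_completion (R : Type*) [CommRing R] [IsNoetherianRing R] [IsLocalRing R] :
    Dense (maximalIdeal R) (maximalIdeal (AdicCompletion (maximalIdeal R) R))
      (algebraMap R (AdicCompletion (maximalIdeal R) R)) := by
  have hfg : (maximalIdeal R).FG := (maximalIdeal R).fg_of_isNoetherianRing
  have key : ∀ n (x : AdicCompletion (maximalIdeal R) R),
      x ∈ maximalIdeal (AdicCompletion (maximalIdeal R) R) ^ n ↔
        AdicCompletion.eval (maximalIdeal R) R n x = 0 := by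
    intro n x
    rw [AdicCompletion.maximalIdeal_eq_map_of_fg hfg, ← Ideal.map_pow, ← LinearMap.mem_ker,
      ← AdicCompletion.pow_smul_top_eq_ker_eval hfg, Ideal.smul_top_eq_map]
    rfl
  constructor
  · intro n x
    rw [key, AdicCompletion.algebraMap_apply]
    rw [AdicCompletion.eval_of, Submodule.mkQ_apply, Submodule.Quotient.mk_eq_zero]
    simp
  · intro n a
    obtain ⟨x, hx⟩ := Submodule.mkQ_surjective _ (AdicCompletion.eval (maximalIdeal R) R n a)
    refine ⟨x, ?_⟩
    rw [key, map_sub, AdicCompletion.algebraMap_apply, AdicCompletion.eval_of, ← hx]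
    exact sub_self _

lemma noeth_completion (R : Type*) [CommRing R] [IsNoetherianRing R] [IsLocalRing R] :
    IsNoetherianRing (AdicCompletion (maximalIdeal R) R) := by
  have hfg : (maximalIdeal R).FG := (maximalIdeal R).fg_of_isNoetherianRing
  have hd := dense_completion R
  obtain ⟨s, hs⟩ := hfg
  haveI hb : IsAdicComplete (Ideal.span {(0 : R)}) R := by
    rw [Ideal.span_singleton_eq_bot.2 rfl]; infer_instance
  let ι := algebraMap R (AdicCompletion (maximalIdeal R) R)
  let g : MvPolynomial s R →+* AdicCompletion (maximalIdeal R) R :=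
    MvPolynomial.eval₂Hom ι (fun i => ι i.1)
  have hM : maximalIdeal (AdicCompletion (maximalIdeal R) R) = (maximalIdeal R).map ι :=
    AdicCompletion.maximalIdeal_eq_map_of_fg (maximalIdeal R).fg_of_isNoetherianRing
  obtain ⟨G, hG, hGn⟩ := (dense_ps (σ := s) (0 : R)).extend
    (maximalIdeal (AdicCompletion (maximalIdeal R) R)) g (by
      rw [MI, Ideal.span_le]
      rintro x (rfl | ⟨i, rfl⟩)
      · simp
      · show g (MvPolynomial.X i) ∈ maximalIdeal (AdicCompletion (maximalIdeal R) R)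
        simp only [g, MvPolynomial.eval₂Hom_X']
        rw [hM]
        apply Ideal.mem_map_of_mem
        rw [← hs]
        exact Ideal.subset_span i.2)
  haveI hc : IsAdicComplete (MPI s (0 : R)) (MvPowerSeries s R) := complete_ps (σ := s) (0 : R)
  have hGX : ∀ i : s, G (MvPowerSeries.X i) = ι i.1 := by
    intro i
    have := RingHom.congr_fun hG (MvPolynomial.X i)
    simpa [g] using this
  have hGC : ∀ r, G (MvPowerSeries.C r) = ι r := by
    intro i
    have := RingHom.congr_fun hG (MvPolynomial.C i)
    simpa [g] using this
  have hmap : (MPI s (0 : R)).map G = maximalIdeal (AdicCompletion (maximalIdeal R) R) := by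
    apply le_antisymm
    · rw [Ideal.map_le_iff_le_comap]
      intro x hx
      have := hGn 1 x (by simpa using hx)
      simpa using this
    · rw [hM]
      have h3 : (maximalIdeal R).map ι = (Ideal.span (s : Set R)).map ι := congrArg (Ideal.map ι) hs.symm
      rw [h3, Ideal.map_span, Ideal.span_le]
      rintro _ ⟨x, hx, rfl⟩
      have h1 : MvPowerSeries.X (⟨x, hx⟩ : s) ∈ MPI s (0 : R) :=
        Ideal.subset_span (Or.inr ⟨_, rfl⟩)
      have h2 := Ideal.mem_map_of_mem G h1
      rw [hGX] at h2
      exact h2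
  haveI : IsHausdorff ((MPI s (0 : R)).map G) (AdicCompletion (maximalIdeal R) R) := by
    rw [hmap]; infer_instance
  haveI := hc.toIsPrecomplete
  have hsurj : Function.Surjective G := by
    apply surjective_of_mk_map_comp_surjective (I := MPI s (0 : R)) G
    intro y
    obtain ⟨y, rfl⟩ := Ideal.Quotient.mk_surjective y
    obtain ⟨x, hx⟩ := hd.dense 1 y
    refine ⟨MvPowerSeries.C x, ?_⟩
    rw [RingHom.comp_apply, hGC, eq_comm, Ideal.Quotient.eq, hmap]
    simpa using hx
  exact isNoetherianRing_of_surjective _ _ G hsurj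

lemma izu_main (R : Type*) [CommRing R] [IsNoetherianRing R] [IsLocalRing R]
    (hirr : IsDomain (AdicCompletion (maximalIdeal R) R)) : Izu R (maximalIdeal R) := by
  haveI := noeth_completion R
  have hd := dense_completion R
  obtain ⟨c, hc⟩ := izu_complete (S := AdicCompletion (maximalIdeal R) R) inferInstance
  refine ⟨c, fun n x y h => ?_⟩
  rw [← hd.comap, map_mul] at h
  rcases hc n _ _ h with h | h
  · exact Or.inl ((hd.comap _ _).1 h)
  · exact Or.inr ((hd.comap _ _).1 h)

lemma izu_pow {R : Type*} [CommRing R] {m : Ideal R} {c : ℕ} (h1 : 1 ≤ c) (hm : m ≠ ⊤)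
    (hc : ∀ n x y, x * y ∈ m ^ (c * n) → x ∈ m ^ n ∨ y ∈ m ^ n) (n : ℕ) (hn : 1 ≤ n) (x : R) (D : ℕ)
    (h : x ^ D ∈ m ^ (c ^ D * n)) : D ≠ 0 ∧ x ∈ m ^ n := by
  induction D with
  | zero =>
    exfalso
    simp only [pow_zero, one_mul] at h
    exact hm (Ideal.eq_top_iff_one _ |>.2 (Ideal.pow_le_self (by omega) h))
  | succ D ih =>
    refine ⟨by simp, ?_⟩
    rw [pow_succ x, pow_succ' c, mul_assoc] at h
    rcases hc _ _ _ h with h | h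
    · exact (ih h).2
    · exact Ideal.pow_le_pow_right (Nat.le_mul_of_pos_left _ (Nat.pow_pos h1)) h

lemma izu_prod {R : Type*} [CommRing R] {m : Ideal R} {c : ℕ} (h1 : 1 ≤ c) (hm : m ≠ ⊤)
    (hc : ∀ n x y, x * y ∈ m ^ (c * n) → x ∈ m ^ n ∨ y ∈ m ^ n) {N : ℕ} (a : Fin N → R) (e : Fin N → ℕ)
    (s : Finset (Fin N)) : ∀ (n : ℕ), 1 ≤ n → 
    (∏ j ∈ s, a j ^ e j) ∈ m ^ (c ^ (∑ j ∈ s, (e j + 1)) * n) → ∃ j ∈ s, e j ≠ 0 ∧ a j ∈ m ^ n := by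
  classical
  induction s using Finset.induction_on with
  | empty =>
    intro n hn h
    exfalso
    simp only [Finset.prod_empty, Finset.sum_empty, pow_zero, one_mul] at h
    exact hm (Ideal.eq_top_iff_one _ |>.2 (Ideal.pow_le_self (by omega) h))
  | insert j s hj ih =>
    intro n hn h
    rw [Finset.prod_insert hj, Finset.sum_insert hj] at h
    have he : c ^ (e j + 1 + ∑ j ∈ s, (e j + 1)) * n
        = c * (c ^ (e j + ∑ j ∈ s, (e j + 1)) * n) := by ring
    rw [he] at h
    have hle : ∀ d d', d ≤ d' → m ^ (c ^ d' * n) ≤ m ^ (c ^ d * n) := fun d d' hd =>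
      Ideal.pow_le_pow_right (Nat.mul_le_mul_right _ (Nat.pow_le_pow_right h1 hd))
    rcases hc _ _ _ h with h | h
    · obtain ⟨h2, h3⟩ := izu_pow h1 hm hc n hn _ _ (hle _ _ (Nat.le_add_right _ _) h)
      exact ⟨j, Finset.mem_insert_self _ _, h2, h3⟩
    · obtain ⟨i, hi, h2⟩ := ih n hn (hle _ _ (Nat.le_add_left _ _) h)
      exact ⟨i, Finset.mem_insert_of_mem hi, h2⟩

theorem final
    (R : Type*) [CommRing R] [IsDomain R] [IsNoetherianRing R] [IsLocalRing R]
    (hirr : IsDomain (AdicCompletion (maximalIdeal R) R))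
    (N k : ℕ) (α : Fin k → Fin N → ℕ) (hα : ∀ i, α i ≠ 0) :
    ∃ c : ℕ, ∀ n : ℕ, ∀ a : Fin N → R,
      (∀ i, (∏ j, a j ^ α i j) ∈ maximalIdeal R ^ (c * n)) →
      ∃ b : Fin N → R, (∀ i, (∏ j, b j ^ α i j) = 0) ∧
        ∀ j, a j - b j ∈ maximalIdeal R ^ n := by
  classical
  obtain ⟨c₀, hc₀⟩ := izu_main R hirr
  let c := c₀ + 1
  have hc : ∀ n x y, x * y ∈ maximalIdeal R ^ (c * n) → x ∈ maximalIdeal R ^ n ∨ y ∈ maximalIdeal R ^ n :=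
    fun n x y h => hc₀ n x y (Ideal.pow_le_pow_right (Nat.mul_le_mul_right _ (Nat.le_succ _)) h)
  have hc1 : 1 ≤ c := Nat.le_add_left _ _
  have hm : maximalIdeal R ≠ ⊤ := Ideal.IsPrime.ne_top'
  let d : Fin k → ℕ := fun i => ∑ j, (α i j + 1)
  refine ⟨c ^ (∑ i, d i), fun n a ha => ?_⟩
  rcases Nat.eq_zero_or_pos n with rfl | hn
  · refine ⟨0, fun i => ?_, fun j => by simp⟩
    obtain ⟨j, hj⟩ := Function.ne_iff.1 (hα i)
    exact Finset.prod_eq_zero (Finset.mem_univ j) (by simpa using hj)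
  · refine ⟨fun j => if a j ∈ maximalIdeal R ^ n then 0 else a j, fun i => ?_, fun j => ?_⟩
    · have hle : d i ≤ ∑ i, d i := Finset.single_le_sum (f := d) (fun _ _ => Nat.zero_le _) (Finset.mem_univ i)
      obtain ⟨j, -, hj0, hj⟩ := izu_prod hc1 hm hc a (α i) Finset.univ n hn
        (Ideal.pow_le_pow_right (Nat.mul_le_mul_right _ (Nat.pow_le_pow_right hc1 hle)) (ha i))
      exact Finset.prod_eq_zero (Finset.mem_univ j) (by simp [hj, hj0])
    · dsimp only
      split_ifs with h
      · simpa using h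
      · simp

end Izumi

end

/-- **Theorem.** Let `(R, m)` be an analytically irreducible Noetherian local domain and
`α₁,…,α_k` nonzero multi-indices.  Then there is `c ∈ ℕ` such that for every `n` and every
`a ∈ R^N` with `a^{αᵢ} ∈ m^(c n)` for all `i`, there is `b ∈ R^N` with `b^{αᵢ} = 0` for all `i`
and `a ≡ b (mod mⁿ R^N)`; that is, `β_n(X^{α₁},…,X^{α_k}) ≤ c n`. -/
theorem monomial_system_linear_bound_of_analyticallyIrreducible
    (R : Type*) [CommRing R] [IsDomain R] [IsNoetherianRing R] [IsLocalRing R]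
    (hirr : IsDomain (AdicCompletion (maximalIdeal R) R))
    (N k : ℕ) (α : Fin k → Fin N → ℕ) (hα : ∀ i, α i ≠ 0) :
    ∃ c : ℕ, ∀ n : ℕ, ∀ a : Fin N → R,
      (∀ i, (∏ j, a j ^ α i j) ∈ maximalIdeal R ^ (c * n)) →
      ∃ b : Fin N → R, (∀ i, (∏ j, b j ^ α i j) = 0) ∧
        ∀ j, a j - b j ∈ maximalIdeal R ^ n := by
  exact Izumi.final R hirr N k α hα
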